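/- Let (a,b) ∈ ℝ² be Diophantine, f(x) = ax + b, let 𝓘 ⊂ ℝ be a compact interval, and let ε > 0. For t, s > 0 set ℓ = s + t and B_ε(t,s) = {x ∈ 𝓘 : the lattice a(t,s) u(f(x), x) ℤ³ contains a nonzero vector v with ‖v‖ ≤ ε ℓ^{−2/3}}. Then there exist constants 0 < c₁ < c₂ < 1 such that, with 𝓡 = {(t,s) ∈ (ℤ_{>0})² : c₁ s ≤ t ≤ c₂ s} enumerated as (t_k, s_k), the Lebesgue measure of limsup_{k → ∞} B_ε(t_k, s_k) equals the Lebesgue measure of 𝓘. -/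

import Mathlib

/-!
Full measure of the limsup set (Chow–Yang, Proposition 3.1): for a
Diophantine vector `(a,b)`, a compact interval `𝓘 = [A,B]` and `ε > 0`,
there are `0 < c₁ < c₂ < 1` such that the set of `x ∈ 𝓘` lying in
`B_ε(t,s)` for infinitely many pairs `(t,s)` of positive integers with
`c₁ s ≤ t ≤ c₂ s` has full measure in `𝓘`.  Here `x ∈ B_ε(t,s)` iff the
lattice `a(t,s) u(ax+b, x) ℤ³` contains a nonzero vector of sup-norm at most
`ε (s+t)^{-2/3}`.
-/

open MeasureTheory Matrix

noncomputable section

/-- Distance from a real number to the nearest integer, `⟨x⟩`. -/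
def distNearestInt (x : ℝ) : ℝ := |x - round x|

/-- `(a, b) ∈ ℝ²` is Diophantine:
`inf_{q ∈ ℕ} q^{1/2+κ} max(⟨qa⟩, ⟨qb⟩) > 0` for some `κ > 0`. -/
def IsDiophantine (a b : ℝ) : Prop :=
  ∃ κ : ℝ, 0 < κ ∧ ∃ δ : ℝ, 0 < δ ∧ ∀ q : ℕ, 0 < q →
    δ ≤ (q : ℝ) ^ ((1 : ℝ) / 2 + κ) *
      max (distNearestInt (q * a)) (distNearestInt (q * b))

/-- The diagonal matrix `a(t,s) = diag(e^t, e^s, e^{-t-s})`. -/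
def aM (t s : ℝ) : Matrix (Fin 3) (Fin 3) ℝ :=
  !![Real.exp t, 0, 0; 0, Real.exp s, 0; 0, 0, Real.exp (-t - s)]

/-- The unipotent matrix `u(y,x)` with rows `(1,0,y), (0,1,x), (0,0,1)`. -/
def uM (y x : ℝ) : Matrix (Fin 3) (Fin 3) ℝ := !![1, 0, y; 0, 1, x; 0, 0, 1]

/-- `x ∈ B_ε(t,s)`: the lattice `a(t,s) u(ax+b, x) ℤ³` contains a nonzero
vector of sup-norm at most `ε (s+t)^{-2/3}`. -/
def memB (a b ε : ℝ) (t s : ℝ) (x : ℝ) : Prop :=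
  ∃ v : Fin 3 → ℤ, v ≠ 0 ∧
    ‖(aM t s * uM (a * x + b) x).mulVec fun i => ((v i : ℝ))‖
      ≤ ε * (s + t) ^ (-(2 / 3) : ℝ)

theorem dio_int (a b : ℝ) (hab : IsDiophantine a b) :
    ∃ κ : ℕ, ∃ s0 : ℝ, 0 < s0 ∧ ∀ E : ℤ, E ≠ 0 → ∀ m m' : ℤ,
      s0 ≤ |(E:ℝ)| ^ κ * max |E * a - m| |E * b - m'| := by
  obtain ⟨κ, hκ, δ, hδ, h⟩ := hab
  obtain ⟨k, hk⟩ := exists_nat_ge ((1:ℝ)/2 + κ)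
  refine ⟨k, δ, hδ, ?_⟩
  have key : ∀ q : ℕ, 0 < q → ∀ m m' : ℤ,
      δ ≤ (q:ℝ) ^ k * max |q * a - m| |q * b - m'| := by
    intro q hq m m'
    refine (h q hq).trans ?_
    have h1 : (1:ℝ) ≤ q := by exact_mod_cast hq
    have h2 : (q:ℝ) ^ ((1 : ℝ) / 2 + κ) ≤ (q:ℝ) ^ k := by
      rw [← Real.rpow_natCast]
      exact Real.rpow_le_rpow_of_exponent_le h1 hk
    refine mul_le_mul h2 ?_ ?_ (by positivity)
    · exact max_le_max (round_le _ _) (round_le _ _)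
    · exact le_max_of_le_left (abs_nonneg _)
  intro E hE m m'
  rcases lt_or_gt_of_ne hE with h0 | h0
  · have := key (E.natAbs) (by omega) (-m) (-m')
    have e1 : ((E.natAbs : ℕ) : ℝ) = -E := by
      have : ((E.natAbs : ℕ) : ℤ) = -E := by omega
      rw [← Int.cast_natCast, this]; push_cast; ring
    rw [e1] at this
    have e2 : |(E:ℝ)| = -E := abs_of_neg (by exact_mod_cast h0)
    rw [e2]
    have e3 : |-(E:ℝ) * a - ((-m : ℤ) : ℝ)| = |E * a - m| := by
      rw [← abs_neg]; push_cast; ring_nf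
    have e4 : |-(E:ℝ) * b - ((-m' : ℤ) : ℝ)| = |E * b - m'| := by
      rw [← abs_neg]; push_cast; ring_nf
    rwa [e3, e4] at this
  · have := key (E.natAbs) (by omega) m m'
    have e1 : ((E.natAbs : ℕ) : ℝ) = E := by
      have : ((E.natAbs : ℕ) : ℤ) = E := by omega
      rw [← Int.cast_natCast, this]
    rw [e1] at this
    have e2 : |(E:ℝ)| = E := abs_of_pos (by exact_mod_cast h0)
    rwa [e2]

def chi (a b : ℝ) (p q : ℤ) : ℝ := q * b + p * a

theorem par_of_close (a b : ℝ) (κ : ℕ) (s0 : ℝ)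
    (h : ∀ E : ℤ, E ≠ 0 → ∀ m m' : ℤ,
      s0 ≤ |(E:ℝ)| ^ κ * max |E * a - m| |E * b - m'|)
    (X σ : ℝ) (hX : 0 < X) (hσ : (2 * X ^ 2) ^ κ * (2 * X * σ) ≤ s0)
    (P R P' R' m m' : ℤ) (hP : |(P:ℝ)| ≤ X) (hR : |(R:ℝ)| ≤ X) (hP' : |(P':ℝ)| ≤ X)
    (hR' : |(R':ℝ)| ≤ X) (h1 : |chi a b P R - m| < σ) (h2 : |chi a b P' R' - m'| < σ) :
    P * R' = P' * R := by
  by_contra hne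
  have hE : P * R' - P' * R ≠ 0 := sub_ne_zero.mpr hne
  have hσ0 : 0 < σ := (abs_nonneg _).trans_lt h1
  have := h _ hE (R' * m - R * m') (P * m' - P' * m)
  have hb : ∀ x y u v : ℝ, |x| ≤ X → |y| ≤ X → |u| < σ → |v| < σ → |x * u - y * v| < 2 * X * σ := by
    intro x y u v hx hy hu hv
    have a1 : |x * u| ≤ X * |u| := by rw [abs_mul]; gcongr
    have a2 : |y * v| ≤ X * |v| := by rw [abs_mul]; gcongr
    have a3 := abs_sub (x*u) (y*v)
    have a4 : X * |u| < X * σ := by gcongr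
    have a5 : X * |v| < X * σ := by gcongr
    linarith
  have m1 : |((P * R' - P' * R : ℤ) : ℝ) * a - ((R' * m - R * m' : ℤ) : ℝ)| < 2 * X * σ := by
    have := hb R' R _ _ hR' hR h1 h2
    convert this using 2
    unfold chi; push_cast; ring
  have m2 : |((P * R' - P' * R : ℤ) : ℝ) * b - ((P * m' - P' * m : ℤ) : ℝ)| < 2 * X * σ := by
    have := hb P P' _ _ hP hP' h2 h1
    convert this using 2
    unfold chi; push_cast; ring
  have m3 := max_lt m1 m2
  have hEabs : |((P * R' - P' * R : ℤ) : ℝ)| ≤ 2 * X ^ 2 := by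
    push_cast
    have a1 : |(P:ℝ) * R'| ≤ X * X := by rw [abs_mul]; gcongr
    have a2 : |(P':ℝ) * R| ≤ X * X := by rw [abs_mul]; gcongr
    have a3 := abs_sub ((P:ℝ) * R') ((P':ℝ) * R)
    nlinarith
  have hEpos : 0 < |((P * R' - P' * R : ℤ) : ℝ)| := abs_pos.mpr (by exact_mod_cast hE)
  have : s0 < s0 := by
    calc s0 ≤ _ := this
      _ < |((P * R' - P' * R : ℤ) : ℝ)| ^ κ * (2 * X * σ) := by gcongr
      _ ≤ (2 * X ^ 2) ^ κ * (2 * X * σ) := by gcongr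
      _ ≤ s0 := hσ
  exact lt_irrefl _ this

theorem card_int_abs_le {ι : Type*} (U : Finset ι) (f : ι → ℤ) (X : ℝ)
    (hf : ∀ i ∈ U, |(f i : ℝ)| ≤ X) (hinj : ∀ i ∈ U, ∀ j ∈ U, f i = f j → i = j) :
    (U.card : ℝ) ≤ 2 * |X| + 1 := by
  classical
  have : U.card ≤ (Finset.Icc (-⌊|X|⌋) ⌊|X|⌋).card := by
    apply Finset.card_le_card_of_injOn f
    · intro i hi
      have := (hf i hi).trans (le_abs_self X)
      rw [abs_le] at this
      simp only [Finset.coe_Icc, Set.mem_Icc]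
      constructor
      · have : -(f i) ≤ ⌊|X|⌋ := Int.le_floor.mpr (by push_cast; linarith)
        linarith
      · exact Int.le_floor.mpr (by linarith)
    · intro i hi j hj hij
      exact hinj i hi j hj hij
  have h2 : ((Finset.Icc (-⌊|X|⌋) ⌊|X|⌋).card : ℝ) = 2 * ⌊|X|⌋ + 1 := by
    rw [Int.card_Icc]
    have h0 : 0 ≤ ⌊|X|⌋ := Int.floor_nonneg.mpr (abs_nonneg X)
    have : (((⌊|X|⌋ + 1 - -⌊|X|⌋).toNat : ℤ) : ℝ) = 2 * ⌊|X|⌋ + 1 := by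
      rw [Int.toNat_of_nonneg (by omega)]; push_cast; ring
    exact_mod_cast this
  calc (U.card : ℝ) ≤ ((Finset.Icc (-⌊|X|⌋) ⌊|X|⌋).card : ℝ) := by exact_mod_cast this
    _ = 2 * ⌊|X|⌋ + 1 := h2
    _ ≤ _ := by linarith [Int.floor_le |X|]

/-- few vectors in a box with small character -/
theorem card_bohr (a b : ℝ) (κ : ℕ) (s0 : ℝ)
    (h : ∀ E : ℤ, E ≠ 0 → ∀ m m' : ℤ,
      s0 ≤ |(E:ℝ)| ^ κ * max |E * a - m| |E * b - m'|)
    (X σ : ℝ) (hX : 0 < X) (hσ : (2 * X ^ 2) ^ κ * (2 * X * σ) ≤ s0)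
    (U : Finset (ℤ × ℤ)) (hU : ∀ u ∈ U, |(u.1:ℝ)| ≤ X ∧ |(u.2:ℝ)| ≤ X ∧
      ∃ m : ℤ, |chi a b u.1 u.2 - m| < σ) :
    (U.card : ℝ) ≤ 2 * X + 1 := by
  classical
  have hpar : ∀ u ∈ U, ∀ u' ∈ U, u.1 * u'.2 = u'.1 * u.2 := by
    intro u hu u' hu'
    obtain ⟨p1, p2, m, hm⟩ := hU u hu
    obtain ⟨p1', p2', m', hm'⟩ := hU u' hu'
    exact par_of_close a b κ s0 h X σ hX hσ _ _ _ _ m m' p1 p2 p1' p2' hm hm'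
  rw [← abs_of_pos hX]
  by_cases hex : ∃ u0 ∈ U, u0.1 ≠ 0
  · obtain ⟨u0, hu0, hne⟩ := hex
    apply card_int_abs_le U (fun u => u.1) X (fun u hu => (hU u hu).1)
    intro u hu u' hu' heq
    have e1 := hpar u0 hu0 u hu
    have e2 := hpar u0 hu0 u' hu'
    have heq2 : u.1 = u'.1 := heq
    rw [heq2, ← e2] at e1
    exact Prod.ext heq2 (mul_left_cancel₀ hne e1)
  · push Not at hex
    apply card_int_abs_le U (fun u => u.2) X (fun u hu => (hU u hu).2.1)
    intro u hu u' hu' heq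
    exact Prod.ext ((hex u hu).trans (hex u' hu').symm) heq

def ee (θ : ℝ) : ℂ := Complex.exp (((2 * Real.pi * θ : ℝ) : ℂ) * Complex.I)

theorem ee_add (x y : ℝ) : ee (x + y) = ee x * ee y := by
  unfold ee; rw [← Complex.exp_add]; push_cast; ring_nf

theorem norm_ee (x : ℝ) : ‖ee x‖ = 1 := Complex.norm_exp_ofReal_mul_I _

theorem conj_ee (x : ℝ) : (starRingEnd ℂ) (ee x) = ee (-x) := by
  unfold ee; rw [← Complex.exp_conj]; congr 1
  rw [map_mul, Complex.conj_ofReal, Complex.conj_I]; push_cast; ring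

theorem re_ee (x : ℝ) : (ee x).re = Real.cos (2 * Real.pi * x) := Complex.exp_ofReal_mul_I_re _

theorem norm_ee_sub_one (θ : ℝ) : ‖ee θ - 1‖ = 2 * |Real.sin (Real.pi * θ)| := by
  have h1 : ‖ee θ - 1‖ ^ 2 = (2 * |Real.sin (Real.pi * θ)|) ^ 2 := by
    rw [← Complex.normSq_eq_norm_sq, Complex.normSq_apply]
    have hr : (ee θ - 1).re = Real.cos (2 * Real.pi * θ) - 1 := by
      simp [re_ee]
    have hi : (ee θ - 1).im = Real.sin (2 * Real.pi * θ) := by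
      have : (ee θ).im = Real.sin (2 * Real.pi * θ) := Complex.exp_ofReal_mul_I_im _
      simp [this]
    rw [hr, hi, mul_pow, sq_abs]
    have e : 2 * Real.pi * θ = 2 * (Real.pi * θ) := by ring
    rw [e, Real.sin_two_mul, Real.cos_two_mul]
    nlinarith [Real.sin_sq_add_cos_sq (Real.pi * θ)]
  exact (sq_eq_sq₀ (norm_nonneg _) (by positivity)).mp h1

theorem abs_sin_pi_ge (θ σ : ℝ) (h : ∀ m : ℤ, σ ≤ |θ - m|) : 2 * σ ≤ |Real.sin (Real.pi * θ)| := by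
  have h0 := h (round θ)
  have h1 := abs_sub_round θ
  set x := θ - round θ with hx
  have e : |Real.sin (Real.pi * θ)| = |Real.sin (Real.pi * x)| := by
    have : Real.pi * θ = Real.pi * x + (round θ : ℤ) * Real.pi := by rw [hx]; ring
    rw [this, Real.sin_add_int_mul_pi, abs_mul]
    simp
  rw [e]
  have h2 := Real.mul_abs_le_abs_sin (x := Real.pi * x) (by
    rw [abs_mul, abs_of_pos Real.pi_pos]; nlinarith [Real.pi_pos])
  rw [abs_mul, abs_of_pos Real.pi_pos] at h2
  have : 2 / Real.pi * (Real.pi * |x|) = 2 * |x| := by field_simp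
  rw [this] at h2
  linarith

theorem ee_nat_mul (θ : ℝ) (n : ℕ) : ee (n * θ) = ee θ ^ n := by
  unfold ee; rw [← Complex.exp_nat_mul]; push_cast; ring_nf

theorem geom_bound (θ σ : ℝ) (hσ : 0 < σ) (h : ∀ m : ℤ, σ ≤ |θ - m|) (M : ℕ) :
    ‖∑ y ∈ Finset.Icc (-(M:ℤ)) M, ee ((y:ℝ) * θ)‖ ≤ 1 / (2 * σ) := by
  have e : ∑ y ∈ Finset.Icc (-(M:ℤ)) M, ee ((y:ℝ) * θ)
      = ee (-(M:ℝ) * θ) * ∑ j ∈ Finset.range (2 * M + 1), ee θ ^ j := by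
    rw [Finset.mul_sum]
    symm
    apply Finset.sum_bij (fun (j:ℕ) _ => (j:ℤ) - M)
    · intro j hj; simp at hj ⊢; omega
    · intro j _ j' _ hjj; simpa using hjj
    · intro y hy; simp at hy
      exact ⟨(y + M).toNat, by simp; omega, by simp; omega⟩
    · intro j hj
      rw [← ee_nat_mul, ← ee_add]; push_cast; ring_nf
  rw [e, norm_mul, norm_ee, one_mul]
  have h1 := abs_sin_pi_ge θ σ h
  have h2 : 4 * σ ≤ ‖ee θ - 1‖ := by rw [norm_ee_sub_one]; linarith
  have hne : ee θ ≠ 1 := by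
    intro hh; rw [hh] at h2; simp at h2; linarith
  rw [geom_sum_eq hne, norm_div]
  have h3 : ‖ee θ ^ (2 * M + 1) - 1‖ ≤ 2 := by
    refine (norm_sub_le _ _).trans ?_
    rw [norm_pow, norm_ee]; norm_num
  calc _ ≤ 2 / (4 * σ) := by gcongr
    _ = _ := by field_simp; norm_num

theorem normsq_sum_bound {ι : Type*} (F : Finset ι) (α γ : ι → ℝ) (σ Bd : ℝ) (hσ : 0 < σ) (M : ℕ)
    (hbad : ∀ r' ∈ F, ∀ U : Finset ι, U ⊆ F → (∀ r ∈ U, ∃ m : ℤ, |α r - α r' - m| < σ) →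
      (U.card : ℝ) ≤ Bd) :
    ∑ y ∈ Finset.Icc (-(M:ℤ)) M, ‖∑ r ∈ F, ee ((y:ℝ) * α r + γ r)‖ ^ 2
      ≤ F.card * (Bd * (2 * M + 1)) + (F.card : ℝ) ^ 2 * (1 / (2 * σ)) := by
  classical
  have e1 : ∀ y : ℤ, ((‖∑ r ∈ F, ee ((y:ℝ) * α r + γ r)‖ ^ 2 : ℝ) : ℂ)
      = ∑ r' ∈ F, ∑ r ∈ F, ee (γ r - γ r') * ee ((y:ℝ) * (α r - α r')) := by
    intro y
    have := Complex.mul_conj' (∑ r ∈ F, ee ((y:ℝ) * α r + γ r))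
    push_cast
    rw [← this, map_sum, Finset.sum_mul_sum, Finset.sum_comm]
    refine Finset.sum_congr rfl fun r' _ => Finset.sum_congr rfl fun r _ => ?_
    rw [conj_ee, ← ee_add, ← ee_add]; congr 1; ring
  have e2 : ((∑ y ∈ Finset.Icc (-(M:ℤ)) M, ‖∑ r ∈ F, ee ((y:ℝ) * α r + γ r)‖ ^ 2 : ℝ) : ℂ)
      = ∑ r' ∈ F, ∑ r ∈ F, ee (γ r - γ r') *
        ∑ y ∈ Finset.Icc (-(M:ℤ)) M, ee ((y:ℝ) * (α r - α r')) := by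
    rw [Complex.ofReal_sum]
    simp_rw [e1]
    rw [Finset.sum_comm]
    refine Finset.sum_congr rfl fun r' _ => ?_
    rw [Finset.sum_comm]
    refine Finset.sum_congr rfl fun r _ => ?_
    rw [Finset.mul_sum]
  have e3 : ∑ y ∈ Finset.Icc (-(M:ℤ)) M, ‖∑ r ∈ F, ee ((y:ℝ) * α r + γ r)‖ ^ 2
      ≤ ∑ r' ∈ F, ∑ r ∈ F, ‖∑ y ∈ Finset.Icc (-(M:ℤ)) M, ee ((y:ℝ) * (α r - α r'))‖ := by
    have h0 : 0 ≤ ∑ y ∈ Finset.Icc (-(M:ℤ)) M, ‖∑ r ∈ F, ee ((y:ℝ) * α r + γ r)‖ ^ 2 := by positivity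
    rw [← abs_of_nonneg h0, ← Real.norm_eq_abs, ← Complex.norm_real, e2]
    refine (norm_sum_le _ _).trans (Finset.sum_le_sum fun r' _ => ?_)
    refine (norm_sum_le _ _).trans (Finset.sum_le_sum fun r _ => ?_)
    rw [norm_mul, norm_ee, one_mul]
  refine e3.trans ?_
  have e4 : ∀ r' ∈ F, ∑ r ∈ F, ‖∑ y ∈ Finset.Icc (-(M:ℤ)) M, ee ((y:ℝ) * (α r - α r'))‖
      ≤ Bd * (2 * M + 1) + F.card * (1 / (2 * σ)) := by
    intro r' hr'
    rw [← Finset.sum_filter_add_sum_filter_not F (fun r => ∃ m : ℤ, |α r - α r' - m| < σ)]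
    apply add_le_add
    · have t1 : ∀ r ∈ F.filter (fun r => ∃ m : ℤ, |α r - α r' - m| < σ),
          ‖∑ y ∈ Finset.Icc (-(M:ℤ)) M, ee ((y:ℝ) * (α r - α r'))‖ ≤ 2 * M + 1 := by
        intro r _
        refine (norm_sum_le _ _).trans ?_
        simp only [norm_ee, Finset.sum_const, Int.card_Icc, nsmul_eq_mul, mul_one]
        have : ((M:ℤ) + 1 - -M).toNat = 2 * M + 1 := by omega
        rw [this]; push_cast; exact le_rfl
      refine (Finset.sum_le_card_nsmul _ _ _ t1).trans ?_
      rw [nsmul_eq_mul]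
      gcongr
      exact hbad r' hr' _ (Finset.filter_subset _ _) (fun r hr => (Finset.mem_filter.mp hr).2)
    · have t1 : ∀ r ∈ F.filter (fun r => ¬ ∃ m : ℤ, |α r - α r' - m| < σ),
          ‖∑ y ∈ Finset.Icc (-(M:ℤ)) M, ee ((y:ℝ) * (α r - α r'))‖ ≤ 1 / (2 * σ) := by
        intro r hr
        have := (Finset.mem_filter.mp hr).2
        push Not at this
        exact geom_bound _ σ hσ this M
      refine (Finset.sum_le_card_nsmul _ _ _ t1).trans ?_
      rw [nsmul_eq_mul]
      gcongr
      exact Finset.filter_subset _ _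
  refine (Finset.sum_le_sum e4).trans ?_
  rw [Finset.sum_const, nsmul_eq_mul]
  apply le_of_eq; ring

theorem card_sep {ι : Type*} (U : Finset ι) (f : ι → ℝ) (lo hi s : ℝ) (hs : 0 < s) (hlh : lo ≤ hi)
    (hf : ∀ i ∈ U, lo ≤ f i ∧ f i ≤ hi)
    (hsep : ∀ i ∈ U, ∀ j ∈ U, i ≠ j → s ≤ |f i - f j|) :
    (U.card : ℝ) ≤ (hi - lo) / s + 1 := by
  classical
  have h0 : 0 ≤ (hi - lo) / s := div_nonneg (by linarith) hs.le
  have : U.card ≤ (Finset.Icc (0:ℤ) ⌊(hi - lo) / s⌋).card := by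
    apply Finset.card_le_card_of_injOn (fun i => ⌊(f i - lo) / s⌋)
    · intro i hi'
      obtain ⟨h1, h2⟩ := hf i hi'
      simp only [Finset.coe_Icc, Set.mem_Icc]
      constructor
      · exact Int.floor_nonneg.mpr (div_nonneg (by linarith) hs.le)
      · apply Int.floor_le_floor; gcongr
    · intro i hi' j hj hij
      by_contra hne
      have h1 := hsep i hi' j hj hne
      have h2 := Int.abs_sub_lt_one_of_floor_eq_floor hij
      rw [← sub_div, abs_div, abs_of_pos hs, div_lt_one hs] at h2
      have : f i - lo - (f j - lo) = f i - f j := by ring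
      rw [this] at h2
      linarith
  have h2 : ((Finset.Icc (0:ℤ) ⌊(hi - lo) / s⌋).card : ℝ) = ⌊(hi - lo) / s⌋ + 1 := by
    rw [Int.card_Icc]
    have h0' : 0 ≤ ⌊(hi - lo) / s⌋ := Int.floor_nonneg.mpr h0
    have : (((⌊(hi - lo) / s⌋ + 1 - 0).toNat : ℤ) : ℝ) = ⌊(hi - lo) / s⌋ + 1 := by
      rw [Int.toNat_of_nonneg (by omega)]; push_cast; ring
    exact_mod_cast this
  calc (U.card : ℝ) ≤ ((Finset.Icc (0:ℤ) ⌊(hi - lo) / s⌋).card : ℝ) := by exact_mod_cast this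
    _ = _ := h2
    _ ≤ _ := by linarith [Int.floor_le ((hi - lo) / s)]

theorem rat_sep (r r' : ℚ) (T : ℝ) (hT : 0 < T) (h : (r.den : ℝ) ≤ T) (h' : (r'.den : ℝ) ≤ T)
    (hne : r ≠ r') : 1 / T ^ 2 ≤ |(r:ℝ) - r'| := by
  have e1 : (r:ℝ) = r.num / r.den := by exact_mod_cast (Rat.num_div_den r).symm
  have e2 : (r':ℝ) = r'.num / r'.den := by exact_mod_cast (Rat.num_div_den r').symm
  have p1 : (0:ℝ) < r.den := by exact_mod_cast r.pos
  have p2 : (0:ℝ) < r'.den := by exact_mod_cast r'.pos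
  have e3 : (r:ℝ) - r' = ((r.num * r'.den - r'.num * r.den : ℤ) : ℝ) / (r.den * r'.den) := by
    rw [e1, e2]; push_cast; field_simp
  have hz : r.num * r'.den - r'.num * r.den ≠ 0 := by
    intro h0
    have : (r:ℝ) - r' = 0 := by rw [e3, h0]; simp
    apply hne
    exact_mod_cast sub_eq_zero.mp this
  have h1 : (1:ℝ) ≤ |((r.num * r'.den - r'.num * r.den : ℤ) : ℝ)| := by
    exact_mod_cast Int.one_le_abs hz
  rw [e3, abs_div, abs_of_pos (mul_pos p1 p2), div_le_div_iff₀ (by positivity) (by positivity)]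
  have : (r.den:ℝ) * r'.den ≤ T ^ 2 := by nlinarith
  nlinarith

theorem rat_card_upper (F : Finset ℚ) (lo hi T : ℝ) (hT : 0 < T) (hlh : lo ≤ hi)
    (hF : ∀ r ∈ F, lo ≤ (r:ℝ) ∧ (r:ℝ) ≤ hi ∧ (r.den:ℝ) ≤ T) :
    (F.card : ℝ) ≤ (hi - lo) * T ^ 2 + 1 := by
  have := card_sep F (fun r => (r:ℝ)) lo hi (1 / T ^ 2) (by positivity) hlh
    (fun r hr => ⟨(hF r hr).1, (hF r hr).2.1⟩)
    (fun r hr r' hr' hne => rat_sep r r' T hT (hF r hr).2.2 (hF r' hr').2.2 hne)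
  simpa using this

theorem rat_finite (lo hi T : ℝ) : {r : ℚ | lo ≤ (r:ℝ) ∧ (r:ℝ) ≤ hi ∧ (r.den:ℝ) ≤ T}.Finite := by
  by_cases hT : 0 < T
  · by_cases hlh : lo ≤ hi
    · by_contra hinf
      have hinf : {r : ℚ | lo ≤ (r:ℝ) ∧ (r:ℝ) ≤ hi ∧ (r.den:ℝ) ≤ T}.Infinite := hinf
      obtain ⟨F, hF, hc⟩ := hinf.exists_subset_card_eq (⌈(hi - lo) * T ^ 2 + 1⌉₊ + 1)
      have := rat_card_upper F lo hi T hT hlh (fun r hr => hF hr)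
      rw [hc] at this
      push_cast at this
      linarith [Nat.le_ceil ((hi - lo) * T ^ 2 + 1)]
    · convert Set.finite_empty
      ext r; simp only [Set.mem_ofPred_eq, Set.mem_empty_iff_false, iff_false]
      intro h; exact hlh (h.1.trans h.2.1)
  · convert Set.finite_empty
    ext r; simp only [Set.mem_ofPred_eq, Set.mem_empty_iff_false, iff_false]
    intro h
    have : (0:ℝ) < r.den := by exact_mod_cast r.pos
    exact hT (this.trans_le h.2.2)

def ratSet (lo hi T : ℝ) : Finset ℚ :=
  (rat_finite lo hi T).toFinset.filter (fun r => T / 8 < (r.den:ℝ))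

theorem mem_ratSet {lo hi T : ℝ} {r : ℚ} : r ∈ ratSet lo hi T ↔
    lo ≤ (r:ℝ) ∧ (r:ℝ) ≤ hi ∧ T / 8 < (r.den:ℝ) ∧ (r.den:ℝ) ≤ T := by
  simp only [ratSet, Finset.mem_filter, Set.Finite.mem_toFinset, Set.mem_ofPred_eq]
  tauto

theorem ratSet_card_upper (lo hi T : ℝ) (hT : 0 < T) (hlh : lo ≤ hi) :
    ((ratSet lo hi T).card : ℝ) ≤ (hi - lo) * T ^ 2 + 1 :=
  rat_card_upper _ lo hi T hT hlh fun _ hr =>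
    ⟨(mem_ratSet.mp hr).1, (mem_ratSet.mp hr).2.1, (mem_ratSet.mp hr).2.2.2⟩

theorem exists_next (r : ℚ) : ∃ p' q' : ℤ, (r.den:ℤ) < q' ∧ q' ≤ 2 * r.den ∧
    p' * r.den - r.num * q' = 1 := by
  have hc : IsCoprime (r.num) (r.den:ℤ) := by
    rw [Int.isCoprime_iff_gcd_eq_one]; exact r.reduced
  obtain ⟨u, v, huv⟩ := hc
  have hd : (0:ℤ) < r.den := by exact_mod_cast r.pos
  -- u num + v den = 1 ; want p' = v + num*k, q' = -u + den*k
  set w := (-u - 1) % r.den with hw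
  have h1 : 0 ≤ w := Int.emod_nonneg _ hd.ne'
  have h2 : w < r.den := Int.emod_lt_of_pos _ hd
  have h3 : (-u - 1) = w + r.den * ((-u - 1) / r.den) := (Int.emod_add_mul_ediv _ _).symm
  set k := (-u - 1) / (r.den:ℤ) with hk
  refine ⟨v + r.num * (1 - k), w + 1 + r.den, by omega, by omega, ?_⟩
  have : w = -u - 1 - r.den * k := by linarith
  rw [this]
  linear_combination huv

def nn (r : ℚ) : ℤ := (exists_next r).choose
def nd (r : ℚ) : ℤ := (exists_next r).choose_spec.choose
theorem nd_gt (r : ℚ) : (r.den:ℤ) < nd r := (exists_next r).choose_spec.choose_spec.1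
theorem nd_le (r : ℚ) : nd r ≤ 2 * r.den := (exists_next r).choose_spec.choose_spec.2.1
theorem nn_det (r : ℚ) : nn r * r.den - r.num * nd r = 1 := (exists_next r).choose_spec.choose_spec.2.2

/-- residue class count -/
theorem card_residue {ι : Type*} (U : Finset ι) (x y : ι → ℤ) (dx dy e : ℤ) (G N : ℝ)
    (hdx : dx ≠ 0) (hG : ((Int.gcd dx dy : ℕ) : ℝ) ≤ G) (hN : 0 ≤ N)
    (he : ∀ i ∈ U, dx * y i - dy * x i = e)
    (hx : ∀ i ∈ U, 0 ≤ (x i : ℝ) ∧ (x i : ℝ) ≤ N)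
    (hinj : ∀ i ∈ U, ∀ j ∈ U, x i = x j → y i = y j → i = j) :
    (U.card : ℝ) ≤ N * G / |(dx:ℝ)| + 1 := by
  have hg : 0 < Int.gcd dx dy := Int.gcd_pos_of_ne_zero_left _ hdx
  have hg' : (0:ℝ) < Int.gcd dx dy := by exact_mod_cast hg
  have hG0 : 0 < G := hg'.trans_le hG
  have hd : 0 < |(dx:ℝ)| := abs_pos.mpr (by exact_mod_cast hdx)
  have := card_sep U (fun i => (x i : ℝ)) 0 N (|(dx:ℝ)| / G) (by positivity) hN hx ?_
  · refine this.trans (le_of_eq ?_)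
    rw [sub_zero]; field_simp
  · intro i hi j hj hij
    have e1 := he i hi
    have e2 := he j hj
    have hxne : x i ≠ x j := by
      intro h
      apply hij
      refine hinj i hi j hj h ?_
      rw [h, ← e2] at e1
      exact mul_left_cancel₀ hdx (by linarith)
    have e3 : dx * (y i - y j) = dy * (x i - x j) := by linarith
    have hdvd : dx / (Int.gcd dx dy) ∣ (x i - x j) := by
      have hcop : IsCoprime (dx / (Int.gcd dx dy)) (dy / (Int.gcd dx dy)) := by
        rw [Int.isCoprime_iff_gcd_eq_one]
        exact Int.gcd_ediv_gcd_ediv_gcd hg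
      apply hcop.dvd_of_dvd_mul_left
      have h1 : (Int.gcd dx dy : ℤ) ∣ dx := Int.gcd_dvd_left ..
      have h2 : (Int.gcd dx dy : ℤ) ∣ dy := Int.gcd_dvd_right ..
      have hgz : (Int.gcd dx dy : ℤ) ≠ 0 := by exact_mod_cast hg.ne'
      refine ⟨y i - y j, ?_⟩
      apply mul_left_cancel₀ hgz
      rw [← mul_assoc, ← mul_assoc, Int.mul_ediv_cancel' h1, Int.mul_ediv_cancel' h2, e3]
    obtain ⟨k, hk⟩ := hdvd
    have hk0 : k ≠ 0 := by
      rintro rfl; apply hxne; rw [mul_zero] at hk; linarith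
    have hk1 : (1:ℝ) ≤ |(k:ℝ)| := by exact_mod_cast Int.one_le_abs hk0
    have h4 : ((x i : ℝ) - x j) = (dx:ℝ) / (Int.gcd dx dy) * k := by
      have h1 : (Int.gcd dx dy : ℤ) ∣ dx := Int.gcd_dvd_left ..
      have : (((dx / (Int.gcd dx dy : ℤ)) : ℤ) : ℝ) = (dx:ℝ) / (Int.gcd dx dy) := by
        rw [Int.cast_div h1 (by exact_mod_cast hg.ne')]; simp
      rw [← this]
      exact_mod_cast hk
    rw [h4, abs_mul, abs_div, abs_of_pos hg']
    calc |(dx:ℝ)| / G ≤ |(dx:ℝ)| / (Int.gcd dx dy) := by gcongr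
      _ ≤ _ := le_mul_of_one_le_right (by positivity) hk1

theorem card_fiber_le {α β : Type*} [DecidableEq β] (s : Finset α) (f : α → β) (t : Finset β)
    (hm : ∀ x ∈ s, f x ∈ t) (B : ℝ) (h : ∀ b ∈ t, ((s.filter (fun x => f x = b)).card : ℝ) ≤ B) :
    (s.card : ℝ) ≤ t.card * B := by
  rw [Finset.card_eq_sum_card_fiberwise (f := f) (t := t) (fun x hx => hm x hx)]
  push_cast
  refine (Finset.sum_le_card_nsmul _ _ _ h).trans ?_
  rw [nsmul_eq_mul]

/-- nonzero integers of size at most Δ -/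
def nzI (Δ : ℝ) : Finset ℤ := (Finset.Icc (-⌊Δ⌋) ⌊Δ⌋).erase 0

theorem mem_nzI {Δ : ℝ} {d : ℤ} : d ∈ nzI Δ ↔ d ≠ 0 ∧ |(d:ℝ)| ≤ Δ := by
  unfold nzI
  simp only [Finset.mem_erase, Finset.mem_Icc, abs_le]
  refine and_congr_right fun _ => and_congr ?_ Int.le_floor
  rw [neg_le, Int.le_floor]; push_cast; exact neg_le

theorem card_nzI (Δ : ℝ) (hΔ : 0 ≤ Δ) : ((nzI Δ).card : ℝ) ≤ 2 * Δ := by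
  unfold nzI
  have h0' : 0 ≤ ⌊Δ⌋ := Int.floor_nonneg.mpr hΔ
  rw [Finset.card_erase_of_mem (by simp [h0']), Int.card_Icc]
  have : ((((⌊Δ⌋ + 1 - -⌊Δ⌋).toNat - 1 : ℕ) : ℤ) : ℝ) = 2 * ⌊Δ⌋ := by
    have : (((⌊Δ⌋ + 1 - -⌊Δ⌋).toNat - 1 : ℕ) : ℤ) = 2 * ⌊Δ⌋ := by omega
    rw [this]; push_cast; ring
  have h2 : ((((⌊Δ⌋ + 1 - -⌊Δ⌋).toNat - 1 : ℕ)) : ℝ) = 2 * ⌊Δ⌋ := by exact_mod_cast this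
  rw [h2]; linarith [Int.floor_le Δ]

def wedge (c c' : ℚ) : ℤ := c.num * c'.den - c'.num * c.den

theorem wedge_ne {c c' : ℚ} (h : c ≠ c') : wedge c c' ≠ 0 := by
  intro h0
  apply h
  rw [Rat.eq_iff_mul_eq_mul]
  unfold wedge at h0
  linarith

def pairs (N N' Δ : ℝ) : Finset (ℚ × ℚ) := by
  classical
  exact (ratSet 1 2 N ×ˢ ratSet 1 2 N').filter (fun c => c.1 ≠ c.2 ∧ |(wedge c.1 c.2 : ℝ)| ≤ Δ)

theorem mem_pairs {N N' Δ : ℝ} {c : ℚ × ℚ} : c ∈ pairs N N' Δ ↔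
    c.1 ∈ ratSet 1 2 N ∧ c.2 ∈ ratSet 1 2 N' ∧ c.1 ≠ c.2 ∧ |(wedge c.1 c.2 : ℝ)| ≤ Δ := by
  simp [pairs, and_assoc]

theorem num_bounds {N : ℝ} {c : ℚ} (h : c ∈ ratSet 1 2 N) :
    N / 8 < (c.den:ℝ) ∧ (c.den:ℝ) ≤ N ∧ N / 8 < (c.num:ℝ) ∧ (c.num:ℝ) ≤ 2 * N := by
  obtain ⟨h1, h2, h3, h4⟩ := mem_ratSet.mp h
  have e1 : (c:ℝ) = c.num / c.den := by exact_mod_cast (Rat.num_div_den c).symm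
  have p1 : (0:ℝ) < c.den := by exact_mod_cast c.pos
  rw [e1, le_div_iff₀ p1] at h1
  rw [e1, div_le_iff₀ p1] at h2
  refine ⟨h3, h4, by linarith, by linarith⟩

theorem pairs_card_le (N N' Δ : ℝ) (hN : 1 ≤ N) (hNN : N ≤ N') (hΔ : 0 ≤ Δ) :
    ((pairs N N' Δ).card : ℝ) ≤ 68 * (N * N' * Δ) := by
  classical
  have h1 : ((pairs N N' Δ).card : ℝ) ≤
      ((ratSet 1 2 N) ×ˢ (nzI Δ)).card * (16 * N' / N + 1) := by
    apply card_fiber_le _ (fun c => (c.1, wedge c.1 c.2))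
    · intro c hc
      obtain ⟨a1, a2, a3, a4⟩ := mem_pairs.mp hc
      simp only [Finset.mem_product]
      exact ⟨a1, mem_nzI.mpr ⟨wedge_ne a3, a4⟩⟩
    · rintro ⟨c, D⟩ hc
      simp only [Finset.mem_product] at hc
      have hb := num_bounds hc.1
      have hnum : (0:ℝ) < c.num := by linarith [hb.2.2.1]
      have := card_residue ((pairs N N' Δ).filter (fun x => (x.1, wedge x.1 x.2) = (c, D)))
        (fun x => x.2.num) (fun x => x.2.den) c.num c.den D 1 (2 * N')
        (by intro h; rw [h] at hnum; simp at hnum) ?_ (by linarith) ?_ ?_ ?_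
      · refine this.trans ?_
        rw [abs_of_pos hnum]
        have : 2 * N' * 1 / (c.num:ℝ) ≤ 16 * N' / N := by
          rw [mul_one, div_le_div_iff₀ hnum (by linarith)]
          nlinarith [hb.2.2.1]
        linarith
      · have : Int.gcd c.num (c.den:ℤ) = 1 := c.reduced
        rw [this]; simp
      · intro x hx
        have := (Finset.mem_filter.mp hx).2
        simp only [Prod.mk.injEq] at this
        rw [← this.2, ← this.1]; unfold wedge; ring
      · intro x hx
        have := num_bounds (mem_pairs.mp (Finset.mem_filter.mp hx).1).2.1
        exact ⟨by linarith, this.2.2.2⟩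
      · intro x hx x' hx' e1 e2
        have f1 := (Finset.mem_filter.mp hx).2
        have f2 := (Finset.mem_filter.mp hx').2
        simp only [Prod.mk.injEq] at f1 f2
        apply Prod.ext
        · rw [f1.1, f2.1]
        · exact Rat.ext e1 (by exact_mod_cast e2)
  refine h1.trans ?_
  rw [Finset.card_product]; push_cast
  have h2 := ratSet_card_upper 1 2 N (by linarith) (by norm_num)
  have h3 := card_nzI Δ hΔ
  have h4 : 16 * N' / N + 1 ≤ 17 * N' / N := by
    rw [← sub_nonneg]
    have : 17 * N' / N - (16 * N' / N + 1) = (N' - N) / N := by field_simp; ring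
    rw [this]; exact div_nonneg (by linarith) (by linarith)
  have h5 : 0 ≤ 16 * N' / N + 1 := by
    have : 0 ≤ 16 * N' / N := div_nonneg (by linarith) (by linarith)
    linarith
  calc ((ratSet 1 2 N).card : ℝ) * (nzI Δ).card * (16 * N' / N + 1)
      ≤ (2 * N ^ 2) * (2 * Δ) * (17 * N' / N) := by
        gcongr
        nlinarith
    _ = _ := by field_simp; ring

theorem pairs_swap_card (N N' Δ : ℝ) : (pairs N N' Δ).card = (pairs N' N Δ).card := by
  apply Finset.card_bij (fun c _ => c.swap)
  · intro c hc
    obtain ⟨a1, a2, a3, a4⟩ := mem_pairs.mp hc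
    refine mem_pairs.mpr ⟨a2, a1, a3.symm, ?_⟩
    rw [← abs_neg]; convert a4 using 2; simp only [wedge, Prod.fst_swap, Prod.snd_swap]; push_cast; ring
  · intro c _ c' _ h; exact Prod.swap_injective h
  · intro c hc
    obtain ⟨a1, a2, a3, a4⟩ := mem_pairs.mp hc
    refine ⟨c.swap, mem_pairs.mpr ⟨a2, a1, a3.symm, ?_⟩, by simp⟩
    rw [← abs_neg]; convert a4 using 2; simp only [wedge, Prod.fst_swap, Prod.snd_swap]; push_cast; ring

theorem pairs_card (N N' Δ : ℝ) (hN : 1 ≤ N) (hN' : 1 ≤ N') (hΔ : 0 ≤ Δ) :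
    ((pairs N N' Δ).card : ℝ) ≤ 68 * (N * N' * Δ) := by
  rcases le_total N N' with h | h
  · exact pairs_card_le N N' Δ hN h hΔ
  · rw [pairs_swap_card, mul_comm N N']; exact pairs_card_le N' N Δ hN' h hΔ

theorem vol_cb (x r : ℝ) (hr : 0 ≤ r) : volume.real (Metric.closedBall x r) = 2 * r := by
  rw [Measure.real, Real.volume_closedBall, ENNReal.toReal_ofReal (by positivity)]

theorem sum_inv_le (m : ℕ) : ∑ q ∈ Finset.Icc 1 m, (1:ℝ) / q ≤ 1 + Real.log m := by
  have := harmonic_le_one_add_log m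
  rw [harmonic_eq_sum_Icc] at this
  push_cast at this
  simpa [one_div] using this

theorem ratSet_lower_aux (lo hi T : ℝ) (h : lo < hi) (hT : 8 ≤ T) (hT2 : 2 / T < hi - lo) :
    hi - lo - 2 / T ≤ (ratSet lo hi T).card * (16 / T ^ 2) +
      ((hi - lo) / 4 + (2 / T) * (1 + Real.log T)) := by
  have hT0 : 0 < T := by linarith
  set m := ⌊T / 8⌋₊ with hm
  have hmT : (m:ℝ) ≤ T / 8 := Nat.floor_le (by positivity)
  set S1 : Set ℝ := ⋃ r ∈ ratSet lo hi T, Metric.closedBall (r:ℝ) (8 / T ^ 2) with hS1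
  set S2 : Set ℝ := ⋃ q ∈ Finset.Icc 1 m, ⋃ p ∈ Finset.Icc ⌈lo * (q:ℝ)⌉ ⌊hi * (q:ℝ)⌋,
    Metric.closedBall ((p:ℝ) / q) (1 / (T * q)) with hS2
  have hcov : Set.Icc (lo + 1 / T) (hi - 1 / T) ⊆ S1 ∪ S2 := by
    intro ξ hξ
    obtain ⟨r, h1, h2⟩ := Real.exists_rat_abs_sub_le_and_den_le ξ (n := ⌊T⌋₊)
      (Nat.floor_pos.mpr (by linarith))
    have hd : (0:ℝ) < r.den := by exact_mod_cast r.pos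
    have hd1 : (1:ℝ) ≤ r.den := by exact_mod_cast r.pos
    have hdT : (r.den:ℝ) ≤ T := (Nat.le_floor_iff hT0.le).mp h2
    have h3 : |ξ - r| ≤ 1 / (T * r.den) := by
      refine h1.trans ?_
      gcongr
      exact (Nat.lt_floor_add_one T).le
    have h4 : |ξ - r| ≤ 1 / T := by
      refine h3.trans ?_
      gcongr
      nlinarith
    rw [abs_le] at h4
    have hlo : lo ≤ (r:ℝ) := by linarith [hξ.1]
    have hhi : (r:ℝ) ≤ hi := by linarith [hξ.2]
    by_cases hb : T / 8 < r.den
    · left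
      rw [hS1]
      simp only [Set.mem_iUnion]
      refine ⟨r, mem_ratSet.mpr ⟨hlo, hhi, hb, hdT⟩, ?_⟩
      rw [Metric.mem_closedBall, Real.dist_eq]
      refine h3.trans ?_
      rw [div_le_div_iff₀ (by positivity) (by positivity)]
      nlinarith
    · right
      push Not at hb
      rw [hS2]
      simp only [Set.mem_iUnion]
      have e1 : (r:ℝ) = r.num / r.den := by exact_mod_cast (Rat.num_div_den r).symm
      refine ⟨r.den, ?_, r.num, ?_, ?_⟩
      · rw [Finset.mem_Icc]; exact ⟨r.pos, Nat.le_floor hb⟩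
      · rw [Finset.mem_Icc, Int.ceil_le, Int.le_floor]
        rw [e1, le_div_iff₀ hd] at hlo
        rw [e1, div_le_iff₀ hd] at hhi
        exact ⟨hlo, hhi⟩
      · rw [Metric.mem_closedBall, Real.dist_eq, ← e1]; exact h3
  have hv1 : volume.real S1 ≤ (ratSet lo hi T).card * (16 / T ^ 2) := by
    rw [hS1]
    refine (measureReal_biUnion_finset_le _ _).trans ?_
    rw [Finset.sum_congr rfl (fun (r:ℚ) _ => vol_cb (r:ℝ) (8 / T ^ 2) (by positivity))]
    rw [Finset.sum_const, nsmul_eq_mul]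
    apply le_of_eq; ring
  have hv2 : volume.real S2 ≤ (hi - lo) / 4 + (2 / T) * (1 + Real.log T) := by
    rw [hS2]
    refine (measureReal_biUnion_finset_le _ _).trans ?_
    have : ∀ q ∈ Finset.Icc 1 m, volume.real (⋃ p ∈ Finset.Icc ⌈lo * (q:ℝ)⌉ ⌊hi * (q:ℝ)⌋,
        Metric.closedBall ((p:ℝ) / q) (1 / (T * q))) ≤ (2 / T) * (hi - lo) + (2 / T) * (1 / q) := by
      intro q hq
      have hq0 : (0:ℝ) < q := by exact_mod_cast (Finset.mem_Icc.mp hq).1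
      refine (measureReal_biUnion_finset_le _ _).trans ?_
      rw [Finset.sum_congr rfl (fun (p:ℤ) _ => vol_cb ((p:ℝ)/q) (1 / (T * q)) (by positivity))]
      rw [Finset.sum_const, nsmul_eq_mul, Int.card_Icc]
      have hc : (((⌊hi * (q:ℝ)⌋ + 1 - ⌈lo * (q:ℝ)⌉).toNat : ℕ) : ℝ) ≤ (hi - lo) * q + 1 := by
        have h0 : (0:ℝ) ≤ (hi - lo) * q + 1 := by nlinarith
        have h1 : ((⌊hi * (q:ℝ)⌋ + 1 - ⌈lo * (q:ℝ)⌉ : ℤ) : ℝ) ≤ (hi - lo) * q + 1 := by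
          push_cast
          linarith [Int.floor_le (hi * (q:ℝ)), Int.le_ceil (lo * (q:ℝ))]
        have h2 : ((((⌊hi * (q:ℝ)⌋ + 1 - ⌈lo * (q:ℝ)⌉).toNat : ℕ) : ℤ) : ℝ) ≤ (hi - lo) * q + 1 := by
          rw [Int.toNat_eq_max]; push_cast
          push_cast at h1
          exact max_le h1 h0
        exact_mod_cast h2
      calc _ ≤ ((hi - lo) * q + 1) * (2 * (1 / (T * q))) := by gcongr
        _ = _ := by field_simp
    refine (Finset.sum_le_sum this).trans ?_
    rw [Finset.sum_add_distrib, Finset.sum_const, nsmul_eq_mul, ← Finset.mul_sum, Nat.card_Icc]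
    apply add_le_add
    · rw [Nat.add_sub_cancel]
      calc (m:ℝ) * (2 / T * (hi - lo)) ≤ T / 8 * (2 / T * (hi - lo)) := by
            have : 0 < hi - lo := by linarith
            gcongr
        _ = _ := by field_simp; ring
    · gcongr
      refine (sum_inv_le m).trans ?_
      rcases Nat.eq_zero_or_pos m with h0 | h0
      · rw [h0]; simp; exact Real.log_nonneg (by linarith)
      · have : (0:ℝ) < m := by exact_mod_cast h0
        gcongr; linarith
  have hfin1 : volume S1 ≠ ⊤ := by
    rw [hS1]
    refine ((measure_biUnion_lt_top (Finset.finite_toSet _) ?_)).ne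
    intro r _; exact measure_closedBall_lt_top
  have hfin2 : volume S2 ≠ ⊤ := by
    rw [hS2]
    refine ((measure_biUnion_lt_top (Finset.finite_toSet _) ?_)).ne
    intro q _
    refine ((measure_biUnion_lt_top (Finset.finite_toSet _) ?_))
    intro r _; exact measure_closedBall_lt_top
  have hfin : volume (S1 ∪ S2) ≠ ⊤ :=
    ((measure_union_le _ _).trans_lt (ENNReal.add_lt_top.mpr ⟨hfin1.lt_top, hfin2.lt_top⟩)).ne
  have h1 : volume.real (Set.Icc (lo + 1 / T) (hi - 1 / T)) = hi - lo - 2 / T := by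
    have e : hi - 1 / T - (lo + 1 / T) = hi - lo - 2 / T := by ring
    rw [Real.volume_real_Icc_of_le, e]
    have : (2:ℝ) / T = 1 / T + 1 / T := by ring
    linarith
  rw [← h1]
  calc _ ≤ volume.real (S1 ∪ S2) := measureReal_mono hcov hfin
    _ ≤ volume.real S1 + volume.real S2 := measureReal_union_le _ _
    _ ≤ _ := add_le_add hv1 hv2

theorem ratSet_card_lower (lo hi : ℝ) (h : lo < hi) : ∃ T0 : ℝ, ∀ T, T0 ≤ T →
    (hi - lo) * T ^ 2 / 32 ≤ (ratSet lo hi T).card := by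
  have hlim : Filter.Tendsto (fun T : ℝ => 2 / T + (2 / T) * (1 + Real.log T)) Filter.atTop (nhds 0) := by
    have h1 : Filter.Tendsto (fun T : ℝ => (2:ℝ) / T) Filter.atTop (nhds 0) :=
      tendsto_const_nhds.div_atTop Filter.tendsto_id
    have h2 : Filter.Tendsto (fun T : ℝ => Real.log T / T) Filter.atTop (nhds 0) := by
      simpa using Real.isLittleO_log_id_atTop.tendsto_div_nhds_zero
    have := (h1.add h1).add (h2.const_mul 2)
    simp only [add_zero, mul_zero] at this
    refine this.congr fun T => ?_
    ring
  have h1 := hlim.eventually (gt_mem_nhds (show (0:ℝ) < (hi - lo) / 4 by linarith))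
  obtain ⟨T0, hT0⟩ := Filter.eventually_atTop.mp h1
  refine ⟨max T0 8, fun T hT => ?_⟩
  have hT8 : 8 ≤ T := (le_max_right _ _).trans hT
  have h2 := hT0 T ((le_max_left _ _).trans hT)
  have hTp : 0 < T := by linarith
  have h3 : 0 ≤ 2 / T := by positivity
  have h4 : 0 ≤ (2 / T) * (1 + Real.log T) := by
    have := Real.log_nonneg (show 1 ≤ T by linarith)
    positivity
  have h5 := ratSet_lower_aux lo hi T h hT8 (by linarith)
  have h6 : (hi - lo) / 2 ≤ (ratSet lo hi T).card * (16 / T ^ 2) := by linarith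
  have h7 : ((ratSet lo hi T).card : ℝ) * (16 / T ^ 2) * (T ^ 2 / 16) = (ratSet lo hi T).card := by
    field_simp
  rw [← h7]
  calc _ = (hi - lo) / 2 * (T ^ 2 / 16) := by ring
    _ ≤ _ := by gcongr

/-- pair multiplicity -/
theorem pairs_mult (N N' Δ K0 Nm : ℝ) (hN : 1 ≤ N) (hN' : 1 ≤ N') (hNm : N ≤ Nm) (hNm' : N' ≤ Nm)
    (hΔ : 0 ≤ Δ)
    (k k' : ℤ) (hk : |(k:ℝ)| ≤ K0) (hk' : |(k':ℝ)| ≤ K0) (hkk : k ≠ 0 ∨ k' ≠ 0) (dx dy : ℤ)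
    (hdx : dx ≠ 0) :
    (((pairs N N' Δ).filter (fun c => k * c.1.num + k' * c.2.num = dx ∧
      k * c.1.den + k' * c.2.den = dy)).card : ℝ) ≤ 2 * Δ * (2 * Nm * (K0 * Δ) / |(dx:ℝ)| + 1) := by
  classical
  set U := (pairs N N' Δ).filter (fun c => k * c.1.num + k' * c.2.num = dx ∧
      k * c.1.den + k' * c.2.den = dy) with hU
  have hd : 0 < |(dx:ℝ)| := abs_pos.mpr (by exact_mod_cast hdx)
  have hK0 : 0 ≤ K0 := (abs_nonneg _).trans hk
  have hmain : (U.card : ℝ) ≤ (nzI Δ).card * (2 * Nm * (K0 * Δ) / |(dx:ℝ)| + 1) := by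
    apply card_fiber_le _ (fun c => wedge c.1 c.2)
    · intro c hc
      obtain ⟨a1, a2, a3, a4⟩ := mem_pairs.mp (Finset.mem_filter.mp hc).1
      exact mem_nzI.mpr ⟨wedge_ne a3, a4⟩
    · intro D hD
      obtain ⟨hD0, hDΔ⟩ := mem_nzI.mp hD
      have hgen : ∀ z : ℤ, z ≠ 0 → |(z:ℝ)| ≤ K0 → (Int.gcd dx dy : ℤ) ∣ z * D →
          ((Int.gcd dx dy : ℕ) : ℝ) ≤ K0 * Δ := by
        intro z hz hzK hdv
        have h1 : (Int.gcd dx dy : ℤ) ≤ |z * D| :=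
          Int.le_of_dvd (abs_pos.mpr (mul_ne_zero hz hD0)) ((dvd_abs _ _).mpr hdv)
        have h2 : ((Int.gcd dx dy : ℕ) : ℝ) ≤ |(z:ℝ) * D| := by exact_mod_cast h1
        refine h2.trans ?_
        rw [abs_mul]; gcongr
      have hg1 : (Int.gcd dx dy : ℤ) ∣ dx := Int.gcd_dvd_left ..
      have hg2 : (Int.gcd dx dy : ℤ) ∣ dy := Int.gcd_dvd_right ..
      have hdata : ∀ c ∈ U.filter (fun c => wedge c.1 c.2 = D), c ∈ pairs N N' Δ ∧
          k * c.1.num + k' * c.2.num = dx ∧ k * c.1.den + k' * c.2.den = dy ∧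
          wedge c.1 c.2 = D := by
        intro c hc
        obtain ⟨h1, h2⟩ := Finset.mem_filter.mp hc
        obtain ⟨h3, h4, h5⟩ := Finset.mem_filter.mp h1
        exact ⟨h3, h4, h5, h2⟩
      rcases Finset.eq_empty_or_nonempty (U.filter (fun c => wedge c.1 c.2 = D)) with he | ⟨c0, hc0⟩
      · rw [he]; simp
        have : 0 ≤ Nm := by linarith
        positivity
      by_cases hk0 : k ≠ 0
      · have he : ∀ c ∈ U.filter (fun c => wedge c.1 c.2 = D),
            dx * (c.2.den:ℤ) - dy * c.2.num = k * D := by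
          intro c hc
          obtain ⟨_, h1, h2, h3⟩ := hdata c hc
          rw [← h1, ← h2, ← h3]; unfold wedge; ring
        have := card_residue (U.filter (fun c => wedge c.1 c.2 = D)) (fun c => c.2.num)
          (fun c => (c.2.den:ℤ)) dx dy (k * D) (K0 * Δ) (2 * Nm) hdx ?_ (by linarith) he ?_ ?_
        · exact this
        · apply hgen k hk0 hk
          rw [← he c0 hc0]
          exact dvd_sub (hg1.mul_right _) (hg2.mul_right _)
        · intro c hc
          have := num_bounds (mem_pairs.mp (hdata c hc).1).2.1
          exact ⟨by linarith, by linarith⟩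
        · intro c hc c' hc' e1 e2
          obtain ⟨_, h1, h2, _⟩ := hdata c hc
          obtain ⟨_, h1', h2', _⟩ := hdata c' hc'
          have e3 : c.2 = c'.2 := Rat.ext e1 (by exact_mod_cast e2)
          refine Prod.ext (Rat.ext ?_ ?_) e3
          · apply mul_left_cancel₀ hk0
            rw [e3] at h1; linarith
          · have : (c.1.den : ℤ) = c'.1.den := by
              apply mul_left_cancel₀ hk0
              rw [e3] at h2; linarith
            exact_mod_cast this
      · have hk1 : k' ≠ 0 := by tauto
        have he : ∀ c ∈ U.filter (fun c => wedge c.1 c.2 = D),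
            dx * (c.1.den:ℤ) - dy * c.1.num = -(k' * D) := by
          intro c hc
          obtain ⟨_, h1, h2, h3⟩ := hdata c hc
          rw [← h1, ← h2, ← h3]; unfold wedge; ring
        have := card_residue (U.filter (fun c => wedge c.1 c.2 = D)) (fun c => c.1.num)
          (fun c => (c.1.den:ℤ)) dx dy (-(k' * D)) (K0 * Δ) (2 * Nm) hdx ?_ (by linarith) he ?_ ?_
        · exact this
        · apply hgen k' hk1 hk'
          rw [← dvd_neg, ← he c0 hc0]
          exact dvd_sub (hg1.mul_right _) (hg2.mul_right _)
        · intro c hc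
          have := num_bounds (mem_pairs.mp (hdata c hc).1).1
          exact ⟨by linarith, by linarith⟩
        · intro c hc c' hc' e1 e2
          obtain ⟨_, h1, h2, _⟩ := hdata c hc
          obtain ⟨_, h1', h2', _⟩ := hdata c' hc'
          have e3 : c.1 = c'.1 := Rat.ext e1 (by exact_mod_cast e2)
          refine Prod.ext e3 (Rat.ext ?_ ?_)
          · apply mul_left_cancel₀ hk1
            rw [e3] at h1; linarith
          · have : (c.2.den : ℤ) = c'.2.den := by
              apply mul_left_cancel₀ hk1
              rw [e3] at h2; linarith
            exact_mod_cast this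
  refine hmain.trans ?_
  have : 0 ≤ Nm := by linarith
  gcongr
  exact card_nzI Δ hΔ

/-- the combined vector has nonzero first coordinate -/
theorem pairs_dx_ne (N N' Δ K0 : ℝ) (hN : 1 ≤ N) (hN' : 1 ≤ N') (hK0 : 0 ≤ K0)
    (h1 : K0 * Δ < N / 8) (h2 : K0 * Δ < N' / 8)
    (k k' : ℤ) (hk : |(k:ℝ)| ≤ K0) (hk' : |(k':ℝ)| ≤ K0) (hkk : k ≠ 0 ∨ k' ≠ 0) (c : ℚ × ℚ)
    (hc : c ∈ pairs N N' Δ) : k * c.1.num + k' * c.2.num ≠ 0 := by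
  intro h0
  obtain ⟨a1, a2, a3, a4⟩ := mem_pairs.mp hc
  have hw := wedge_ne a3
  have key : ∀ z x y D : ℤ, z ≠ 0 → D ≠ 0 → |(z:ℝ)| ≤ K0 → |(D:ℝ)| ≤ Δ → y * x = z * D →
      K0 * Δ < x → False := by
    intro z x y D hz hD hzK hDΔ he hx
    have hy : y ≠ 0 := by
      rintro rfl; rw [zero_mul] at he; exact mul_ne_zero hz hD he.symm
    have hy1 : (1:ℝ) ≤ |(y:ℝ)| := by exact_mod_cast Int.one_le_abs hy
    have e : |(y:ℝ)| * |(x:ℝ)| = |(z:ℝ)| * |(D:ℝ)| := by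
      rw [← abs_mul, ← abs_mul]; exact_mod_cast congrArg (fun i : ℤ => |(i:ℝ)|) he
    have : |(z:ℝ)| * |(D:ℝ)| ≤ K0 * Δ := by gcongr
    have hx2 := le_abs_self (x:ℝ)
    nlinarith [abs_nonneg (x:ℝ)]
  by_cases hk0 : k ≠ 0
  · refine key k c.2.num (-(k * c.1.den + k' * c.2.den)) (wedge c.1 c.2) hk0 hw hk a4 ?_ ?_
    · unfold wedge; linear_combination (-(c.2.den:ℤ)) * h0
    · linarith [(num_bounds a2).2.2.1]
  · have hk1 : k' ≠ 0 := by tauto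
    refine key k' c.1.num ((k * c.1.den + k' * c.2.den)) (wedge c.1 c.2) hk1 hw hk' a4 ?_ ?_
    · unfold wedge; linear_combination ((c.1.den:ℤ)) * h0
    · linarith [(num_bounds a1).2.2.1]

theorem sum_nz_le (M : ℕ) (β0 β1 : ℝ) (h0 : 0 ≤ β0) (h1 : 0 ≤ β1) :
    ∑ x ∈ (Finset.Icc (-(M:ℤ)) M).erase 0, (β0 + β1 / |(x:ℝ)|)
      ≤ 2 * M * β0 + 2 * β1 * (1 + Real.log M) := by
  classical
  have hmaps : ∀ x ∈ (Finset.Icc (-(M:ℤ)) M).erase 0, x.natAbs ∈ Finset.Icc 1 M := by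
    intro x hx
    simp only [Finset.mem_erase, Finset.mem_Icc] at hx ⊢
    omega
  rw [← Finset.sum_fiberwise_of_maps_to hmaps]
  have hb : ∀ m ∈ Finset.Icc 1 M, ∑ x ∈ ((Finset.Icc (-(M:ℤ)) M).erase 0).filter
      (fun x => x.natAbs = m), (β0 + β1 / |(x:ℝ)|) ≤ 2 * (β0 + β1 * (1 / m)) := by
    intro m hm
    have hm1 : 1 ≤ m := (Finset.mem_Icc.mp hm).1
    have e1 : ∀ x ∈ ((Finset.Icc (-(M:ℤ)) M).erase 0).filter (fun x => x.natAbs = m),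
        (β0 + β1 / |(x:ℝ)|) ≤ β0 + β1 * (1 / m) := by
      intro x hx
      have : |(x:ℝ)| = m := by
        rw [← (Finset.mem_filter.mp hx).2, Nat.cast_natAbs]; push_cast; rfl
      rw [this]; apply le_of_eq; ring
    refine (Finset.sum_le_card_nsmul _ _ _ e1).trans ?_
    rw [nsmul_eq_mul]
    gcongr
    have : ((Finset.Icc (-(M:ℤ)) M).erase 0).filter (fun x => x.natAbs = m) ⊆ {(m:ℤ), -(m:ℤ)} := by
      intro x hx
      have := (Finset.mem_filter.mp hx).2
      simp only [Finset.mem_insert, Finset.mem_singleton]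
      omega
    exact_mod_cast (Finset.card_le_card this).trans Finset.card_le_two
  refine (Finset.sum_le_sum hb).trans ?_
  rw [← Finset.mul_sum, Finset.sum_add_distrib, Finset.sum_const, ← Finset.mul_sum, nsmul_eq_mul,
    Nat.card_Icc, Nat.add_sub_cancel]
  have := sum_inv_le M
  nlinarith [mul_le_mul_of_nonneg_left this h1]

theorem eq0 {κ ι : Type*} (F : Finset κ) (al ga : κ → ℝ) (M : ℕ) (V : ℝ)
    (hV : ∀ x : ℤ, ∑ y ∈ Finset.Icc (-(M:ℤ)) M,
      ‖∑ r ∈ F, ee ((y:ℝ) * al r + (x:ℝ) * ga r)‖ ^ 2 ≤ V)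
    (P : Finset ι) (dx dy : ι → ℤ)
    (hd : ∀ i ∈ P, dx i ≠ 0 ∧ |dx i| ≤ M ∧ |dy i| ≤ M) (β0 β1 : ℝ) (h0 : 0 ≤ β0) (h1 : 0 ≤ β1)
    (hmult : ∀ x y : ℤ, x ≠ 0 →
      ((P.filter (fun i => dx i = x ∧ dy i = y)).card : ℝ) ≤ β0 + β1 / |(x:ℝ)|) :
    ‖∑ r ∈ F, ∑ i ∈ P, ee ((dy i:ℝ) * al r + (dx i:ℝ) * ga r)‖ ^ 2 ≤
      P.card * (V * (2 * M * β0 + 2 * β1 * (1 + Real.log M))) := by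
  classical
  rw [Finset.sum_comm]
  set f : ℤ → ℤ → ℝ := fun x y => ‖∑ r ∈ F, ee ((y:ℝ) * al r + (x:ℝ) * ga r)‖ ^ 2 with hf
  have hV0 : 0 ≤ V := (Finset.sum_nonneg (fun _ _ => by positivity)).trans (hV 0)
  have s1 : ‖∑ i ∈ P, ∑ r ∈ F, ee ((dy i:ℝ) * al r + (dx i:ℝ) * ga r)‖ ^ 2
      ≤ P.card * ∑ i ∈ P, f (dx i) (dy i) := by
    refine (pow_le_pow_left₀ (norm_nonneg _) (norm_sum_le _ _) 2).trans ?_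
    exact sq_sum_le_card_mul_sum_sq
  refine s1.trans ?_
  gcongr
  set X := (Finset.Icc (-(M:ℤ)) M).erase 0
  set Y := Finset.Icc (-(M:ℤ)) M
  have hmaps : ∀ i ∈ P, (dx i, dy i) ∈ X ×ˢ Y := by
    intro i hi
    obtain ⟨h1, h2, h3⟩ := hd i hi
    rw [abs_le] at h2 h3
    simp only [X, Y, Finset.mem_product, Finset.mem_erase, Finset.mem_Icc]
    exact ⟨⟨h1, h2⟩, h3⟩
  rw [← Finset.sum_fiberwise_of_maps_to hmaps, Finset.sum_product]
  calc _ ≤ ∑ x ∈ X, ∑ y ∈ Y, (β0 + β1 / |(x:ℝ)|) * f x y := by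
        apply Finset.sum_le_sum; intro x hx
        apply Finset.sum_le_sum; intro y hy
        have : ∀ i ∈ P.filter (fun i => (dx i, dy i) = (x, y)), f (dx i) (dy i) = f x y := by
          intro i hi
          have := (Finset.mem_filter.mp hi).2
          simp only [Prod.mk.injEq] at this
          rw [this.1, this.2]
        rw [Finset.sum_congr rfl this, Finset.sum_const, nsmul_eq_mul]
        have hx0 : x ≠ 0 := (Finset.mem_erase.mp hx).1
        have := hmult x y hx0
        simp only [Prod.mk.injEq]
        gcongr
    _ = ∑ x ∈ X, (β0 + β1 / |(x:ℝ)|) * ∑ y ∈ Y, f x y := by simp_rw [Finset.mul_sum]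
    _ ≤ ∑ x ∈ X, (β0 + β1 / |(x:ℝ)|) * V := by
        apply Finset.sum_le_sum; intro x _
        have : 0 ≤ β0 + β1 / |(x:ℝ)| := by positivity
        exact mul_le_mul_of_nonneg_left (hV x) this
    _ = V * ∑ x ∈ X, (β0 + β1 / |(x:ℝ)|) := by rw [← Finset.sum_mul, mul_comm]
    _ ≤ _ := by gcongr; exact sum_nz_le M β0 β1 h0 h1

/-! kernels -/

def kw (K : ℕ) (j : ℕ) : ℝ := Real.sin (Real.pi * j / K)
def kW (K : ℕ) : ℝ := ∑ j ∈ Finset.range K, kw K j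
def kH (K : ℕ) (θ : ℝ) : ℝ := ‖∑ j ∈ Finset.range K, (kw K j : ℂ) * ee (j * θ)‖ ^ 2 / kW K ^ 2
def kh0 (K : ℕ) : ℝ := (∑ j ∈ Finset.range K, kw K j ^ 2) / kW K ^ 2
def kcf (K : ℕ) (p : ℕ × ℕ) : ℝ := kw K p.1 * kw K p.2 / kW K ^ 2

theorem kw_nonneg {K j : ℕ} (h : j ≤ K) : 0 ≤ kw K j := by
  unfold kw
  have hj : (j:ℝ) ≤ K := by exact_mod_cast h
  apply Real.sin_nonneg_of_nonneg_of_le_pi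
  · have := Real.pi_pos; positivity
  · rcases Nat.eq_zero_or_pos K with h0 | h0
    · subst h0; simp [Real.pi_pos.le]
    · have : (0:ℝ) < K := by exact_mod_cast h0
      rw [div_le_iff₀ this]
      exact mul_le_mul_of_nonneg_left hj Real.pi_pos.le

theorem kw_le_one (K j : ℕ) : kw K j ≤ 1 := Real.sin_le_one _

theorem sum_kw_sq (K : ℕ) (hK : 2 ≤ K) : ∑ j ∈ Finset.range K, kw K j ^ 2 = K / 2 := by
  have hK0 : (0:ℝ) < K := by exact_mod_cast (by omega : 0 < K)
  have hK2 : (2:ℝ) ≤ K := by exact_mod_cast hK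
  have e1 : ∀ j ∈ Finset.range K, kw K j ^ 2 = 1 / 2 - ((ee (1 / K)) ^ j).re / 2 := by
    intro j _
    rw [← ee_nat_mul, re_ee, kw]
    have : 2 * Real.pi * (j * (1 / K)) = 2 * (Real.pi * j / K) := by ring
    rw [this, Real.cos_two_mul]
    have := Real.sin_sq_add_cos_sq (Real.pi * j / K)
    linarith
  rw [Finset.sum_congr rfl e1, Finset.sum_sub_distrib, ← Finset.sum_div, ← Finset.sum_div, ← Complex.re_sum]
  have hne : ee (1 / K) ≠ 1 := by
    intro h
    have := norm_ee_sub_one (1 / K)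
    rw [h, sub_self, norm_zero] at this
    have hs : 0 < Real.sin (Real.pi * (1 / K)) := by
      apply Real.sin_pos_of_pos_of_lt_pi
      · have := Real.pi_pos; positivity
      · rw [mul_one_div, div_lt_iff₀ hK0]; nlinarith [Real.pi_pos]
    rw [abs_of_pos hs] at this
    linarith
  have hz : ee (1 / K) ^ K = 1 := by
    rw [← ee_nat_mul]
    have : (K:ℝ) * (1 / K) = 1 := by field_simp
    rw [this]; unfold ee
    rw [mul_one]; push_cast; exact Complex.exp_two_pi_mul_I
  rw [geom_sum_eq hne, hz]
  simp

theorem kW_ge (K : ℕ) (hK : 2 ≤ K) : (K:ℝ) / 2 ≤ kW K := by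
  rw [← sum_kw_sq K hK]
  apply Finset.sum_le_sum
  intro j hj
  have h1 := kw_nonneg (K := K) (Finset.mem_range.mp hj).le
  nlinarith [kw_le_one K j]

theorem kW_le (K : ℕ) : kW K ≤ K := by
  refine (Finset.sum_le_card_nsmul _ _ 1 (fun j _ => kw_le_one K j)).trans ?_
  simp

theorem kh0_bounds (K : ℕ) (hK : 2 ≤ K) : 1 / (2 * K) ≤ kh0 K ∧ kh0 K ≤ 2 / K := by
  have hK0 : (0:ℝ) < K := by exact_mod_cast (by omega : 0 < K)
  have h1 := kW_ge K hK
  have h2 := kW_le K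
  have h3 : 0 < kW K := by linarith
  unfold kh0
  rw [sum_kw_sq K hK]
  constructor
  · rw [div_le_div_iff₀ (by positivity) (by positivity)]
    nlinarith
  · rw [div_le_div_iff₀ (by positivity) (by positivity)]
    nlinarith

theorem kcf_nonneg (K : ℕ) (p : ℕ × ℕ) (hp : p ∈ Finset.range K ×ˢ Finset.range K) :
    0 ≤ kcf K p := by
  rw [Finset.mem_product] at hp
  have h1 := kw_nonneg (K := K) (Finset.mem_range.mp hp.1).le
  have h2 := kw_nonneg (K := K) (Finset.mem_range.mp hp.2).le
  unfold kcf; positivity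

theorem sum_kcf (K : ℕ) (hK : 2 ≤ K) : ∑ p ∈ Finset.range K ×ˢ Finset.range K, kcf K p = 1 := by
  have hK0 : (0:ℝ) < K := by exact_mod_cast (by omega : 0 < K)
  have h1 := kW_ge K hK
  have h3 : 0 < kW K := by linarith
  unfold kcf
  rw [← Finset.sum_div, Finset.sum_product' (f := fun i j => kw K i * kw K j),
    ← Finset.sum_mul_sum]
  change kW K * kW K / kW K ^ 2 = 1
  field_simp

theorem sum_kcf_diag (K : ℕ) : ∑ p ∈ Finset.range K ×ˢ Finset.range K,
    kcf K p * (if p.1 = p.2 then 1 else 0) = kh0 K := by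
  unfold kcf kh0
  rw [Finset.sum_product, Finset.sum_div]
  apply Finset.sum_congr rfl
  intro i hi
  simp only [mul_ite, mul_one, mul_zero]
  rw [Finset.sum_ite_eq]
  simp only [hi, if_true]
  ring

theorem sum_kcf_off (K : ℕ) (hK : 2 ≤ K) : ∑ p ∈ Finset.range K ×ˢ Finset.range K,
    kcf K p * (if p.2 = p.1 + 1 then 1 else 0) = Real.cos (Real.pi / K) * kh0 K := by
  have hK0 : (0:ℝ) < K := by exact_mod_cast (by omega : 0 < K)
  have hend : kw K K = 0 := by
    unfold kw
    have : Real.pi * K / K = Real.pi := by field_simp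
    rw [this, Real.sin_pi]
  have h0 : kw K 0 = 0 := by simp [kw]
  unfold kcf kh0
  rw [Finset.sum_product]
  have e1 : ∀ i ∈ Finset.range K, ∑ j ∈ Finset.range K,
      kw K i * kw K j / kW K ^ 2 * (if j = i + 1 then 1 else 0) = kw K i * kw K (i+1) / kW K ^ 2 := by
    intro i hi
    simp only [mul_ite, mul_one, mul_zero]
    rw [Finset.sum_ite_eq' ]
    by_cases h : i + 1 ∈ Finset.range K
    · simp [h]
    · have : i + 1 = K := by
        rw [Finset.mem_range] at h hi; omega
      simp only [h, if_false]
      rw [this, hend]; simp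
  rw [Finset.sum_congr rfl e1, ← Finset.sum_div, mul_div_assoc']
  congr 1
  -- sum w_i w_{i+1} = cos * sum w_i^2
  have hrec : ∀ i, kw K (i + 2) + kw K i = 2 * Real.cos (Real.pi / K) * kw K (i + 1) := by
    intro i
    unfold kw
    have a1 : Real.pi * ((i + 2 : ℕ):ℝ) / K = Real.pi * ((i+1:ℕ):ℝ) / K + Real.pi / K := by push_cast; ring
    have a2 : Real.pi * ((i : ℕ):ℝ) / K = Real.pi * ((i+1:ℕ):ℝ) / K - Real.pi / K := by push_cast; ring
    rw [a1, a2, Real.sin_add, Real.sin_sub]; ring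
  obtain ⟨L, rfl⟩ : ∃ L, K = L + 1 := ⟨K - 1, by omega⟩
  have s1 : ∑ i ∈ Finset.range (L+1), kw (L+1) i * kw (L+1) (i+1)
      = ∑ i ∈ Finset.range L, kw (L+1) (i+1) * kw (L+1) (i+2) := by
    rw [Finset.sum_range_succ', h0]; simp
  have s2 : ∑ i ∈ Finset.range (L+1), kw (L+1) i * kw (L+1) (i+1)
      = ∑ i ∈ Finset.range L, kw (L+1) (i+1) * kw (L+1) i := by
    rw [Finset.sum_range_succ, hend, mul_zero, add_zero]
    exact Finset.sum_congr rfl fun i _ => mul_comm _ _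
  have s3 : ∑ i ∈ Finset.range (L+1), kw (L+1) i ^ 2 = ∑ i ∈ Finset.range L, kw (L+1) (i+1) ^ 2 := by
    rw [Finset.sum_range_succ', h0]; simp
  have s4 : 2 * ∑ i ∈ Finset.range (L+1), kw (L+1) i * kw (L+1) (i+1) =
      2 * (Real.cos (Real.pi / ((L+1:ℕ):ℝ)) * ∑ i ∈ Finset.range (L+1), kw (L+1) i ^ 2) := by
    rw [two_mul]
    nth_rewrite 1 [s1]
    rw [s2, s3, ← Finset.sum_add_distrib, ← mul_assoc, Finset.mul_sum]
    refine Finset.sum_congr rfl fun i _ => ?_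
    rw [← mul_add, hrec]; ring
  linarith

theorem kH_nonneg (K : ℕ) (θ : ℝ) : 0 ≤ kH K θ := by unfold kH; positivity

theorem kH_le_one (K : ℕ) (θ : ℝ) (hK : 2 ≤ K) : kH K θ ≤ 1 := by
  have hK0 : (0:ℝ) < K := by exact_mod_cast (by omega : 0 < K)
  have h1 := kW_ge K hK
  have h3 : 0 < kW K := by linarith
  unfold kH
  rw [div_le_one (by positivity)]
  apply pow_le_pow_left₀ (norm_nonneg _)
  refine (norm_sum_le _ _).trans ?_
  apply Finset.sum_le_sum
  intro j hj
  rw [norm_mul, norm_ee, mul_one, Complex.norm_real, Real.norm_eq_abs,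
    abs_of_nonneg (kw_nonneg (Finset.mem_range.mp hj).le)]

theorem kH_expand (K : ℕ) (θ : ℝ) : (kH K θ : ℂ) =
    ∑ p ∈ Finset.range K ×ˢ Finset.range K, (kcf K p : ℂ) * ee (((p.1:ℤ) - (p.2:ℤ) : ℤ) * θ) := by
  unfold kH
  have := Complex.mul_conj' (∑ j ∈ Finset.range K, (kw K j : ℂ) * ee (j * θ))
  push_cast
  rw [← this, map_sum, Finset.sum_mul_sum, Finset.sum_product, Finset.sum_div]
  refine Finset.sum_congr rfl fun i _ => ?_
  rw [Finset.sum_div]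
  refine Finset.sum_congr rfl fun j _ => ?_
  rw [map_mul, Complex.conj_ofReal, conj_ee]
  have : ee (((i:ℝ) - (j:ℝ)) * θ) = ee (i * θ) * ee (-(j * θ)) := by
    rw [← ee_add]; congr 1; ring
  rw [this]; unfold kcf; push_cast; ring

theorem kH_upper {ι : Type*} (P : Finset ι) (θ : ι → ℝ) (K : ℕ) (hK : 2 ≤ K) (δ : ℝ)
    (hδ0 : 0 ≤ δ)
    (hδ : ∀ m : ℤ, m ≠ 0 → |(m:ℝ)| ≤ K → ‖∑ i ∈ P, ee ((m:ℝ) * θ i)‖ ≤ δ) :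
    ∑ i ∈ P, kH K (θ i) ≤ P.card * kh0 K + δ := by
  have e1 : ((∑ i ∈ P, kH K (θ i) : ℝ) : ℂ) = ∑ p ∈ Finset.range K ×ˢ Finset.range K,
      (kcf K p : ℂ) * ∑ i ∈ P, ee (((p.1:ℤ) - (p.2:ℤ) : ℤ) * θ i) := by
    push_cast
    simp_rw [kH_expand, Finset.mul_sum]
    rw [Finset.sum_comm]
    push_cast; rfl
  have e2 : ∑ i ∈ P, kH K (θ i) = ∑ p ∈ Finset.range K ×ˢ Finset.range K,
      kcf K p * (∑ i ∈ P, ee (((p.1:ℤ) - (p.2:ℤ) : ℤ) * θ i)).re := by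
    rw [← Complex.ofReal_re (∑ i ∈ P, kH K (θ i)), e1, Complex.re_sum]
    exact Finset.sum_congr rfl fun p _ => Complex.re_ofReal_mul _ _
  rw [e2]
  have e3 : ∀ p ∈ Finset.range K ×ˢ Finset.range K,
      kcf K p * (∑ i ∈ P, ee (((p.1:ℤ) - (p.2:ℤ) : ℤ) * θ i)).re ≤
      P.card * (kcf K p * (if p.1 = p.2 then 1 else 0)) + δ * kcf K p := by
    intro p hp
    have hc := kcf_nonneg K p hp
    rw [Finset.mem_product, Finset.mem_range, Finset.mem_range] at hp
    have : (∑ i ∈ P, ee (((p.1:ℤ) - (p.2:ℤ) : ℤ) * θ i)).re ≤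
        P.card * (if p.1 = p.2 then 1 else 0) + δ := by
      refine (Complex.re_le_norm _).trans ?_
      by_cases h : p.1 = p.2
      · rw [if_pos h]
        refine (norm_sum_le _ _).trans ?_
        simp [norm_ee, hδ0]
      · rw [if_neg h, mul_zero, zero_add]
        apply hδ
        · omega
        · have : |((p.1:ℤ) - (p.2:ℤ))| ≤ K := by rw [abs_le]; omega
          exact_mod_cast this
    nlinarith
  refine (Finset.sum_le_sum e3).trans ?_
  rw [Finset.sum_add_distrib, ← Finset.mul_sum, ← Finset.mul_sum, sum_kcf K hK, sum_kcf_diag, mul_one]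

theorem kH_lower {ι : Type*} (P : Finset ι) (θ : ι → ℝ) (K : ℕ) (hK : 2 ≤ K) (δ : ℝ)
    (hδ0 : 0 ≤ δ)
    (hδ : ∀ m : ℤ, m ≠ 0 → |(m:ℝ)| ≤ K → ‖∑ i ∈ P, ee ((m:ℝ) * θ i)‖ ≤ δ) :
    P.card * (Real.cos (Real.pi / K) * kh0 K) - δ ≤
      ∑ i ∈ P, Real.cos (2 * Real.pi * θ i) * kH K (θ i) := by
  have e1 : ∑ i ∈ P, ee (θ i) * (kH K (θ i) : ℂ) = ∑ p ∈ Finset.range K ×ˢ Finset.range K,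
      (kcf K p : ℂ) * ∑ i ∈ P, ee (((p.1:ℤ) - (p.2:ℤ) + 1 : ℤ) * θ i) := by
    simp_rw [kH_expand, Finset.mul_sum]
    rw [Finset.sum_comm]
    refine Finset.sum_congr rfl fun p _ => Finset.sum_congr rfl fun i _ => ?_
    have : ee ((((p.1:ℤ) - (p.2:ℤ) + 1 : ℤ):ℝ) * θ i) = ee (θ i) * ee ((((p.1:ℤ) - (p.2:ℤ) : ℤ):ℝ) * θ i) := by
      rw [← ee_add]; congr 1; push_cast; ring
    rw [this]; ring
  have e2 : ∑ i ∈ P, Real.cos (2 * Real.pi * θ i) * kH K (θ i) = ∑ p ∈ Finset.range K ×ˢ Finset.range K,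
      kcf K p * (∑ i ∈ P, ee (((p.1:ℤ) - (p.2:ℤ) + 1 : ℤ) * θ i)).re := by
    have : (∑ i ∈ P, ee (θ i) * (kH K (θ i) : ℂ)).re = ∑ i ∈ P, Real.cos (2 * Real.pi * θ i) * kH K (θ i) := by
      rw [Complex.re_sum]
      refine Finset.sum_congr rfl fun i _ => ?_
      rw [Complex.re_mul_ofReal, re_ee]
    rw [← this, e1, Complex.re_sum]
    exact Finset.sum_congr rfl fun p _ => Complex.re_ofReal_mul _ _
  rw [e2]
  have e3 : ∀ p ∈ Finset.range K ×ˢ Finset.range K,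
      P.card * (kcf K p * (if p.2 = p.1 + 1 then 1 else 0)) - δ * kcf K p ≤
      kcf K p * (∑ i ∈ P, ee (((p.1:ℤ) - (p.2:ℤ) + 1 : ℤ) * θ i)).re := by
    intro p hp
    have hc := kcf_nonneg K p hp
    rw [Finset.mem_product, Finset.mem_range, Finset.mem_range] at hp
    have : P.card * (if p.2 = p.1 + 1 then (1:ℝ) else 0) - δ ≤
        (∑ i ∈ P, ee (((p.1:ℤ) - (p.2:ℤ) + 1 : ℤ) * θ i)).re := by
      by_cases h : p.2 = p.1 + 1
      · rw [if_pos h]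
        have h0 : ((p.1:ℤ) - (p.2:ℤ) + 1 : ℤ) = 0 := by omega
        rw [h0]
        have : ee 0 = 1 := by simp [ee]
        simp [this, hδ0]
      · rw [if_neg h, mul_zero, zero_sub]
        have h1 := hδ ((p.1:ℤ) - (p.2:ℤ) + 1 : ℤ) (by omega) (by
          have : |((p.1:ℤ) - (p.2:ℤ) + 1)| ≤ K := by rw [abs_le]; omega
          exact_mod_cast this)
        have h2 := (abs_le.mp ((Complex.abs_re_le_norm _).trans h1)).1
        exact h2
    nlinarith
  refine le_trans ?_ (Finset.sum_le_sum e3)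
  rw [Finset.sum_sub_distrib, ← Finset.mul_sum, ← Finset.mul_sum, sum_kcf K hK, sum_kcf_off K hK, mul_one]

theorem kHH_upper {ι : Type*} (P : Finset ι) (θ θ' : ι → ℝ) (K K' : ℕ) (hK : 2 ≤ K) (hK' : 2 ≤ K')
    (δ : ℝ) (hδ0 : 0 ≤ δ)
    (hδ : ∀ m m' : ℤ, (m ≠ 0 ∨ m' ≠ 0) → |(m:ℝ)| ≤ K → |(m':ℝ)| ≤ K' →
      ‖∑ i ∈ P, ee ((m:ℝ) * θ i + (m':ℝ) * θ' i)‖ ≤ δ) :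
    ∑ i ∈ P, kH K (θ i) * kH K' (θ' i) ≤ P.card * (kh0 K * kh0 K') + δ := by
  have e1 : ((∑ i ∈ P, kH K (θ i) * kH K' (θ' i) : ℝ) : ℂ) = ∑ p ∈ Finset.range K ×ˢ Finset.range K,
      ∑ p' ∈ Finset.range K' ×ˢ Finset.range K',
      ((kcf K p * kcf K' p' : ℝ) : ℂ) * ∑ i ∈ P, ee (((p.1:ℤ) - (p.2:ℤ) : ℤ) * θ i +
        ((p'.1:ℤ) - (p'.2:ℤ) : ℤ) * θ' i) := by
    rw [Complex.ofReal_sum]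
    simp_rw [Complex.ofReal_mul, kH_expand, Finset.sum_mul_sum, Finset.mul_sum]
    rw [Finset.sum_comm]
    refine Finset.sum_congr rfl fun p _ => ?_
    rw [Finset.sum_comm]
    refine Finset.sum_congr rfl fun p' _ => Finset.sum_congr rfl fun i _ => ?_
    rw [ee_add]; ring
  have e2 : ∑ i ∈ P, kH K (θ i) * kH K' (θ' i) = ∑ p ∈ Finset.range K ×ˢ Finset.range K,
      ∑ p' ∈ Finset.range K' ×ˢ Finset.range K',
      (kcf K p * kcf K' p') * (∑ i ∈ P, ee (((p.1:ℤ) - (p.2:ℤ) : ℤ) * θ i +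
        ((p'.1:ℤ) - (p'.2:ℤ) : ℤ) * θ' i)).re := by
    rw [← Complex.ofReal_re (∑ i ∈ P, kH K (θ i) * kH K' (θ' i)), e1, Complex.re_sum]
    refine Finset.sum_congr rfl fun p _ => ?_
    rw [Complex.re_sum]
    exact Finset.sum_congr rfl fun p _ => Complex.re_ofReal_mul _ _
  rw [e2]
  have e3 : ∀ p ∈ Finset.range K ×ˢ Finset.range K, ∀ p' ∈ Finset.range K' ×ˢ Finset.range K',
      (kcf K p * kcf K' p') * (∑ i ∈ P, ee (((p.1:ℤ) - (p.2:ℤ) : ℤ) * θ i +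
        ((p'.1:ℤ) - (p'.2:ℤ) : ℤ) * θ' i)).re ≤
      P.card * ((kcf K p * (if p.1 = p.2 then 1 else 0)) * (kcf K' p' * (if p'.1 = p'.2 then 1 else 0)))
        + δ * (kcf K p * kcf K' p') := by
    intro p hp p' hp'
    have hc := kcf_nonneg K p hp
    have hc' := kcf_nonneg K' p' hp'
    rw [Finset.mem_product, Finset.mem_range, Finset.mem_range] at hp hp'
    have : (∑ i ∈ P, ee (((p.1:ℤ) - (p.2:ℤ) : ℤ) * θ i +
        ((p'.1:ℤ) - (p'.2:ℤ) : ℤ) * θ' i)).re ≤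
        P.card * ((if p.1 = p.2 then 1 else 0) * (if p'.1 = p'.2 then 1 else 0)) + δ := by
      refine (Complex.re_le_norm _).trans ?_
      by_cases h : p.1 = p.2 ∧ p'.1 = p'.2
      · rw [if_pos h.1, if_pos h.2]
        refine (norm_sum_le _ _).trans ?_
        simp [norm_ee, hδ0]
      · have h0 : (if p.1 = p.2 then (1:ℝ) else 0) * (if p'.1 = p'.2 then 1 else 0) = 0 := by
          by_cases h1 : p.1 = p.2
          · have : ¬ p'.1 = p'.2 := by tauto
            simp [this]
          · simp [h1]
        rw [h0, mul_zero, zero_add]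
        apply hδ
        · omega
        · have : |((p.1:ℤ) - (p.2:ℤ))| ≤ K := by rw [abs_le]; omega
          exact_mod_cast this
        · have : |((p'.1:ℤ) - (p'.2:ℤ))| ≤ K' := by rw [abs_le]; omega
          exact_mod_cast this
    have h2 := mul_le_mul_of_nonneg_left this (mul_nonneg hc hc')
    refine h2.trans (le_of_eq ?_)
    ring
  refine (Finset.sum_le_sum fun p hp => Finset.sum_le_sum (e3 p hp)).trans ?_
  simp_rw [Finset.sum_add_distrib, ← Finset.mul_sum]
  rw [← Finset.sum_mul, ← Finset.sum_mul, sum_kcf K hK, sum_kcf K' hK', sum_kcf_diag, sum_kcf_diag]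
  linarith

def kG (K : ℕ) (σ θ : ℝ) : ℝ :=
  (Real.cos (2 * Real.pi * θ) * kH K θ - Real.cos (2 * Real.pi * σ) * kH K θ) /
    (1 - Real.cos (2 * Real.pi * σ))

theorem one_sub_cos_ge (σ : ℝ) (h0 : 0 < σ) (h1 : σ ≤ 1 / 4) : 8 * σ ^ 2 ≤ 1 - Real.cos (2 * Real.pi * σ) := by
  have h := Real.mul_le_sin (x := Real.pi * σ) (by have := Real.pi_pos; positivity)
    (by nlinarith [Real.pi_pos])
  have e : 2 / Real.pi * (Real.pi * σ) = 2 * σ := by field_simp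
  rw [e] at h
  have e2 : 2 * Real.pi * σ = 2 * (Real.pi * σ) := by ring
  rw [e2, Real.cos_two_mul]
  have := Real.sin_sq_add_cos_sq (Real.pi * σ)
  nlinarith

theorem kG_le (K : ℕ) (σ θ : ℝ) (h0 : 0 < σ) (h1 : σ ≤ 1 / 4) : kG K σ θ ≤ kH K θ := by
  have h := one_sub_cos_ge σ h0 h1
  have hp : 0 < 1 - Real.cos (2 * Real.pi * σ) := by nlinarith [sq_pos_of_pos h0]
  unfold kG
  rw [div_le_iff₀ hp]
  nlinarith [kH_nonneg K θ, Real.cos_le_one (2 * Real.pi * θ)]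

theorem kG_pos (K : ℕ) (σ θ : ℝ) (h0 : 0 < σ) (h1 : σ ≤ 1 / 4) (hG : 0 < kG K σ θ) :
    ∃ m : ℤ, |θ - m| < σ := by
  have h := one_sub_cos_ge σ h0 h1
  have hp : 0 < 1 - Real.cos (2 * Real.pi * σ) := by nlinarith [sq_pos_of_pos h0]
  unfold kG at hG
  rw [← sub_mul] at hG
  have h2 : 0 < (Real.cos (2 * Real.pi * θ) - Real.cos (2 * Real.pi * σ)) * kH K θ := by
    by_contra hh
    push Not at hh
    exact absurd (div_nonpos_of_nonpos_of_nonneg hh hp.le) (not_le.mpr hG)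
  have h3 : Real.cos (2 * Real.pi * σ) < Real.cos (2 * Real.pi * θ) := by
    by_contra hh
    push Not at hh
    nlinarith [kH_nonneg K θ]
  refine ⟨round θ, ?_⟩
  by_contra hh
  push Not at hh
  have hr := abs_sub_round θ
  have e : Real.cos (2 * Real.pi * θ) = Real.cos (2 * Real.pi * |θ - round θ|) := by
    have : 2 * Real.pi * |θ - round θ| = |2 * Real.pi * θ - (round θ : ℤ) * (2 * Real.pi)| := by
      have : 2 * Real.pi * θ - (round θ : ℤ) * (2 * Real.pi) = 2 * Real.pi * (θ - round θ) := by ring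
      rw [this, abs_mul, abs_of_pos (by have := Real.pi_pos; positivity : 0 < 2 * Real.pi)]
    rw [this, Real.cos_abs, Real.cos_sub_int_mul_two_pi]
  rw [e] at h3
  have hpi := Real.pi_pos
  have := Real.cos_le_cos_of_nonneg_of_le_pi (x := 2 * Real.pi * σ) (y := 2 * Real.pi * |θ - round θ|)
    (by positivity) (by nlinarith) (by nlinarith)
  linarith

theorem kG_lower {ι : Type*} (P : Finset ι) (θ : ι → ℝ) (K : ℕ) (hK : 2 ≤ K) (σ δ : ℝ)
    (h0 : 0 < σ) (h1 : σ ≤ 1 / 4) (hKσ : 1 / σ ≤ K)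
    (hδ0 : 0 ≤ δ)
    (hδ : ∀ m : ℤ, m ≠ 0 → |(m:ℝ)| ≤ K → ‖∑ i ∈ P, ee ((m:ℝ) * θ i)‖ ≤ δ) :
    P.card * (kh0 K / 2) - δ / (4 * σ ^ 2) ≤ ∑ i ∈ P, kG K σ (θ i) := by
  have hK0 : (0:ℝ) < K := by exact_mod_cast (by omega : 0 < K)
  have h := one_sub_cos_ge σ h0 h1
  set β := Real.cos (2 * Real.pi * σ) with hβ
  have hσ2 : 0 < σ ^ 2 := by positivity
  have hp : 0 < 1 - β := by nlinarith
  have hpi := Real.pi_pos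
  have hβ0 : 0 ≤ β := by
    apply Real.cos_nonneg_of_mem_Icc; constructor <;> nlinarith
  have hβ1 : β ≤ 1 := Real.cos_le_one _
  have a1 := kH_lower P θ K hK δ hδ0 hδ
  have a2 := kH_upper P θ K hK δ hδ0 hδ
  have e : ∑ i ∈ P, kG K σ (θ i) = (∑ i ∈ P, Real.cos (2 * Real.pi * θ i) * kH K (θ i)
      - β * ∑ i ∈ P, kH K (θ i)) / (1 - β) := by
    unfold kG
    rw [← Finset.sum_div, Finset.sum_sub_distrib, Finset.mul_sum]
  rw [e, le_div_iff₀ hp]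
  have hkh : 0 ≤ kh0 K := by
    refine le_trans ?_ (kh0_bounds K hK).1
    positivity
  -- cos(pi/K) - β ≥ (1-β)/2
  have hc : (1 - β) / 2 ≤ Real.cos (Real.pi / K) - β := by
    have b1 : Real.cos (Real.pi * σ) ≤ Real.cos (Real.pi / K) := by
      apply Real.cos_le_cos_of_nonneg_of_le_pi
      · positivity
      · nlinarith
      · rw [div_le_iff₀ hK0]
        rw [div_le_iff₀ h0] at hKσ
        nlinarith
    have b2 : β = 2 * Real.cos (Real.pi * σ) ^ 2 - 1 := by
      rw [hβ, ← Real.cos_two_mul]; ring_nf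
    have b3 : 0 ≤ Real.cos (Real.pi * σ) := by
      apply Real.cos_nonneg_of_mem_Icc; constructor <;> nlinarith
    have b4 := Real.cos_le_one (Real.pi * σ)
    nlinarith
  have hδ2 : δ / (4 * σ ^ 2) * (1 - β) ≥ 2 * δ := by
    rw [ge_iff_le, div_mul_eq_mul_div, le_div_iff₀ (by positivity)]
    nlinarith
  have hcard : (0:ℝ) ≤ P.card := by positivity
  have hx : (0:ℝ) ≤ P.card * kh0 K := by positivity
  have hm := mul_le_mul_of_nonneg_left hc hx
  have hm2 := mul_le_mul_of_nonneg_left a2 hβ0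
  nlinarith

def al (a b : ℝ) (r : ℚ) : ℝ := chi a b r.num r.den
def ga (a b : ℝ) (r : ℚ) : ℝ := chi a b (nn r) (nd r)
/-- character value of the vector attached to r and c -/
def th (a b : ℝ) (r c : ℚ) : ℝ := (c.den:ℝ) * al a b r + (c.num:ℝ) * ga a b r

theorem V_bound (a b : ℝ) (κ : ℕ) (s0 : ℝ)
    (h : ∀ E : ℤ, E ≠ 0 → ∀ m m' : ℤ,
      s0 ≤ |(E:ℝ)| ^ κ * max |E * a - m| |E * b - m'|)
    (X σ : ℝ) (hX : 0 < X) (hσ0 : 0 < σ) (hσ : (2 * X ^ 2) ^ κ * (2 * X * σ) ≤ s0)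
    (F : Finset ℚ) (hF : ∀ r ∈ F, |(r.num:ℝ)| ≤ X / 2 ∧ (r.den:ℝ) ≤ X / 2) (M : ℕ) (x : ℤ) :
    ∑ y ∈ Finset.Icc (-(M:ℤ)) M, ‖∑ r ∈ F, ee ((y:ℝ) * al a b r + (x:ℝ) * ga a b r)‖ ^ 2
      ≤ F.card * ((2 * X + 1) * (2 * M + 1)) + (F.card : ℝ) ^ 2 * (1 / (2 * σ)) := by
  classical
  apply normsq_sum_bound F (al a b) (fun r => (x:ℝ) * ga a b r) σ (2 * X + 1) hσ0 M
  intro r' hr' U hUF hU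
  have hinj : Set.InjOn (fun r : ℚ => (r.num - r'.num, (r.den:ℤ) - r'.den)) U := by
    intro r1 _ r2 _ he
    simp only [Prod.mk.injEq] at he
    refine Rat.ext (by linarith [he.1]) ?_
    have := he.2
    omega
  rw [← Finset.card_image_of_injOn hinj]
  apply card_bohr a b κ s0 h X σ hX hσ
  intro u hu
  obtain ⟨r, hr, rfl⟩ := Finset.mem_image.mp hu
  have f1 := hF r (hUF hr)
  have f2 := hF r' hr'
  have p1 : (0:ℝ) ≤ r.den := by positivity
  have p2 : (0:ℝ) ≤ r'.den := by positivity
  refine ⟨?_, ?_, ?_⟩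
  · push_cast
    have := abs_sub (r.num:ℝ) r'.num
    linarith
  · push_cast
    rw [abs_le]; constructor <;> linarith
  · obtain ⟨m, hm⟩ := hU r hr
    refine ⟨m, ?_⟩
    have : chi a b (r.num - r'.num) ((r.den:ℤ) - r'.den) = al a b r - al a b r' := by
      unfold al chi; push_cast; ring
    rw [this]; exact hm

theorem eq_single (F : Finset ℚ) (a b : ℝ) (M : ℕ) (V : ℝ)
    (hV : ∀ x : ℤ, ∑ y ∈ Finset.Icc (-(M:ℤ)) M,
      ‖∑ r ∈ F, ee ((y:ℝ) * al a b r + (x:ℝ) * ga a b r)‖ ^ 2 ≤ V)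
    (N K0 : ℝ) (hN : 1 ≤ N) (hM : 2 * (K0 * N) ≤ M) (k : ℤ) (hk0 : k ≠ 0) (hk : |(k:ℝ)| ≤ K0) :
    ‖∑ r ∈ F, ∑ c ∈ ratSet 1 2 N, ee ((k:ℝ) * th a b r c)‖ ^ 2 ≤
      (ratSet 1 2 N).card * (V * (2 * M)) := by
  have hK0 : 0 ≤ K0 := (abs_nonneg _).trans hk
  have h := eq0 F (al a b) (ga a b) M V hV (ratSet 1 2 N) (fun c => k * c.num) (fun c => k * c.den)
    ?_ 1 0 (by norm_num) le_rfl ?_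
  · convert h using 2
    · congr 1
      refine Finset.sum_congr rfl fun r _ => Finset.sum_congr rfl fun c _ => ?_
      unfold th; push_cast; congr 1; ring
    · ring
  · intro c hc
    obtain ⟨h1, h2, h3, h4⟩ := num_bounds hc
    have hcn : c.num ≠ 0 := by
      intro h0; rw [h0] at h3; push_cast at h3; linarith
    refine ⟨mul_ne_zero hk0 hcn, ?_, ?_⟩
    · have : |(k:ℝ) * c.num| ≤ M := by
        rw [abs_mul]
        have : |(c.num:ℝ)| ≤ 2 * N := by rw [abs_of_pos (by linarith)]; exact h4
        calc |(k:ℝ)| * |(c.num:ℝ)| ≤ K0 * (2 * N) := by gcongr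
          _ ≤ M := by linarith
      exact_mod_cast this
    · have : |(k:ℝ) * c.den| ≤ M := by
        rw [abs_mul]
        have : |(c.den:ℝ)| ≤ N := by rw [abs_of_pos (by linarith)]; exact h2
        calc |(k:ℝ)| * |(c.den:ℝ)| ≤ K0 * N := by gcongr
          _ ≤ M := by nlinarith
      exact_mod_cast this
  · intro x y _
    rw [zero_div, add_zero]
    have : ((ratSet 1 2 N).filter (fun c => k * c.num = x ∧ k * (c.den:ℤ) = y)).card ≤ 1 := by
      rw [Finset.card_le_one]
      intro c hc c' hc'
      have f1 := (Finset.mem_filter.mp hc).2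
      have f2 := (Finset.mem_filter.mp hc').2
      refine Rat.ext (mul_left_cancel₀ hk0 (f1.1.trans f2.1.symm)) ?_
      exact_mod_cast mul_left_cancel₀ hk0 (f1.2.trans f2.2.symm)
    exact_mod_cast this

theorem eq_pair (F : Finset ℚ) (a b : ℝ) (M : ℕ) (V : ℝ)
    (hV : ∀ x : ℤ, ∑ y ∈ Finset.Icc (-(M:ℤ)) M,
      ‖∑ r ∈ F, ee ((y:ℝ) * al a b r + (x:ℝ) * ga a b r)‖ ^ 2 ≤ V)
    (N N' Nm K0 Δ : ℝ) (hN : 1 ≤ N) (hN' : 1 ≤ N') (hNm : N ≤ Nm) (hNm' : N' ≤ Nm) (hΔ : 0 ≤ Δ)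
    (hM : 4 * (K0 * Nm) ≤ M)
    (h1 : K0 * Δ < N / 8) (h2 : K0 * Δ < N' / 8)
    (k k' : ℤ) (hkk : k ≠ 0 ∨ k' ≠ 0) (hk : |(k:ℝ)| ≤ K0) (hk' : |(k':ℝ)| ≤ K0) :
    ‖∑ r ∈ F, ∑ c ∈ pairs N N' Δ, ee ((k:ℝ) * th a b r c.1 + (k':ℝ) * th a b r c.2)‖ ^ 2 ≤
      (pairs N N' Δ).card * (V * (2 * M * (2 * Δ) + 2 * (2 * Δ * (2 * Nm * (K0 * Δ))) * (1 + Real.log M))) := by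
  have hK0 : 0 ≤ K0 := (abs_nonneg _).trans hk
  have hNm0 : 0 ≤ Nm := by linarith
  have h := eq0 F (al a b) (ga a b) M V hV (pairs N N' Δ) (fun c => k * c.1.num + k' * c.2.num)
    (fun c => k * c.1.den + k' * c.2.den)
    ?_ (2 * Δ) (2 * Δ * (2 * Nm * (K0 * Δ))) (by positivity) (by positivity) ?_
  · convert h using 2
    congr 1
    refine Finset.sum_congr rfl fun r _ => Finset.sum_congr rfl fun c _ => ?_
    unfold th; push_cast; congr 1; ring
  · intro c hc
    have hb1 := num_bounds (mem_pairs.mp hc).1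
    have hb2 := num_bounds (mem_pairs.mp hc).2.1
    have gen : ∀ x y : ℝ, 0 ≤ x → 0 ≤ y → x ≤ 2 * Nm → y ≤ 2 * Nm → |(k:ℝ) * x + k' * y| ≤ M := by
      intro x y hx hy hx2 hy2
      have a1 : |(k:ℝ) * x| ≤ K0 * (2 * Nm) := by
        rw [abs_mul, abs_of_nonneg hx]; gcongr
      have a2 : |(k':ℝ) * y| ≤ K0 * (2 * Nm) := by
        rw [abs_mul, abs_of_nonneg hy]; gcongr
      have := abs_add_le ((k:ℝ) * x) (k' * y)
      linarith
    refine ⟨pairs_dx_ne N N' Δ K0 hN hN' hK0 h1 h2 k k' hk hk' hkk c hc, ?_, ?_⟩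
    · have := gen c.1.num c.2.num (by linarith) (by linarith) (by linarith) (by linarith)
      exact_mod_cast this
    · have := gen c.1.den c.2.den (by linarith) (by linarith) (by linarith) (by linarith)
      exact_mod_cast this
  · intro x y hx
    refine (pairs_mult N N' Δ K0 Nm hN hN' hNm hNm' hΔ k k' hk hk' hkk x y hx).trans (le_of_eq ?_)
    ring

/-- equidistribution hypotheses at scale E -/
def EQs (a b : ℝ) (F : Finset ℚ) (E : ℝ) (τ : ℕ) : Prop :=
  ∀ N, E ^ (τ - 1) ≤ N → N ≤ E ^ (τ + 3) → ∀ k : ℤ, k ≠ 0 → |(k:ℝ)| ≤ E ^ 3 →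
    ‖∑ r ∈ F, ∑ c ∈ ratSet 1 2 N, ee ((k:ℝ) * th a b r c)‖ ≤ F.card * N ^ 2 / E ^ 20

def EQp (a b : ℝ) (F : Finset ℚ) (E : ℝ) (τ : ℕ) : Prop :=
  ∀ N N' Δ, E ^ (τ - 1) ≤ N → N ≤ E ^ (τ + 3) → E ^ (τ - 1) ≤ N' → N' ≤ E ^ (τ + 3) →
    0 ≤ Δ → Δ ≤ E ^ 6 →
    ∀ k k' : ℤ, (k ≠ 0 ∨ k' ≠ 0) → |(k:ℝ)| ≤ E ^ 3 → |(k':ℝ)| ≤ E ^ 3 →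
    ‖∑ r ∈ F, ∑ c ∈ pairs N N' Δ, ee ((k:ℝ) * th a b r c.1 + (k':ℝ) * th a b r c.2)‖
      ≤ F.card * (N * N' * Δ) / E ^ 20

theorem V_small (a b : ℝ) (κ : ℕ) (s0 : ℝ) (hs0 : 0 < s0)
    (h : ∀ E : ℤ, E ≠ 0 → ∀ m m' : ℤ,
      s0 ≤ |(E:ℝ)| ^ κ * max |E * a - m| |E * b - m'|)
    (E : ℝ) (hE : 100 ≤ E) (hs : 1 / s0 ≤ E) (τ : ℕ) (hτ : τ = 163 * κ + 170)
    (F : Finset ℚ) (hF : ∀ r ∈ F, |(r.num:ℝ)| ≤ E ^ 81 / 2 ∧ (r.den:ℝ) ≤ E ^ 81 / 2)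
    (hFc : E ^ 159 ≤ F.card) (M : ℕ) (hM : (M:ℝ) ≤ E ^ (τ + 7)) (x : ℤ) :
    ∑ y ∈ Finset.Icc (-(M:ℤ)) M, ‖∑ r ∈ F, ee ((y:ℝ) * al a b r + (x:ℝ) * ga a b r)‖ ^ 2
      ≤ (F.card : ℝ) ^ 2 * E ^ τ / E ^ 60 := by
  have hE0 : 0 < E := by linarith
  have hE1 : 1 ≤ E := by linarith
  set X := E ^ 81 with hX
  set σ := s0 / ((2 * X ^ 2) ^ κ * (2 * X)) with hσ
  have hX0 : 0 < X := by positivity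
  have hV := V_bound a b κ s0 h X σ hX0 (by positivity) (by rw [hσ]; field_simp; exact le_rfl) F hF M x
  refine hV.trans ?_
  have f0 : (0:ℝ) < F.card := lt_of_lt_of_le (by positivity) hFc
  have t1 : (2 * X + 1) * (2 * M + 1) ≤ F.card * (E ^ τ / E ^ 61) := by
    have a1 : 2 * X + 1 ≤ E ^ 82 := by
      have : E ^ 82 = E * X := by rw [hX]; ring
      have : 1 ≤ X := one_le_pow₀ hE1
      nlinarith
    have a2 : 2 * (M:ℝ) + 1 ≤ E ^ (τ + 8) := by
      have : E ^ (τ + 8) = E * E ^ (τ + 7) := by ring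
      have : 1 ≤ E ^ (τ + 7) := one_le_pow₀ hE1
      nlinarith
    calc (2 * X + 1) * (2 * M + 1) ≤ E ^ 82 * E ^ (τ + 8) := by gcongr
      _ = E ^ 90 * E ^ τ := by ring
      _ ≤ E ^ 98 * E ^ τ := by gcongr; norm_num
      _ = E ^ 159 * (E ^ τ / E ^ 61) := by field_simp
      _ ≤ _ := by gcongr
  have t2 : 1 / (2 * σ) ≤ E ^ τ / E ^ 61 := by
    have a1 : 1 / (2 * σ) = (2 * X ^ 2) ^ κ * X * (1 / s0) := by
      rw [hσ]; field_simp
    have a2 : 2 * X ^ 2 ≤ E ^ 163 := by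
      have : E ^ 163 = E * X ^ 2 := by rw [hX]; ring
      have : 0 < X ^ 2 := by positivity
      nlinarith
    rw [a1]
    calc (2 * X ^ 2) ^ κ * X * (1 / s0) ≤ (E ^ 163) ^ κ * X * E := by gcongr
      _ = E ^ (163 * κ) * E ^ 82 := by rw [hX, ← pow_mul]; ring
      _ ≤ E ^ (163 * κ) * E ^ 109 := by gcongr; norm_num
      _ = E ^ τ / E ^ 61 := by rw [hτ, pow_add]; field_simp
  calc (F.card:ℝ) * ((2 * X + 1) * (2 * M + 1)) + (F.card : ℝ) ^ 2 * (1 / (2 * σ))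
      ≤ F.card * (F.card * (E ^ τ / E ^ 61)) + (F.card : ℝ) ^ 2 * (E ^ τ / E ^ 61) := by gcongr
    _ = (F.card : ℝ) ^ 2 * E ^ τ / E ^ 60 * (2 / E) := by field_simp; ring
    _ ≤ (F.card : ℝ) ^ 2 * E ^ τ / E ^ 60 * 1 := by
        gcongr
        rw [div_le_one hE0]; linarith
    _ = _ := mul_one _

theorem EQ_holds (a b : ℝ) (κ : ℕ) (s0 : ℝ) (hs0 : 0 < s0)
    (h : ∀ E : ℤ, E ≠ 0 → ∀ m m' : ℤ,
      s0 ≤ |(E:ℝ)| ^ κ * max |E * a - m| |E * b - m'|)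
    (E : ℝ) (hE : 100 ≤ E) (hs : 1 / s0 ≤ E) (τ : ℕ) (hτ : τ = 163 * κ + 170)
    (hlog : 1 + (τ + 7) * Real.log E ≤ E ^ 2)
    (F : Finset ℚ) (hF : ∀ r ∈ F, |(r.num:ℝ)| ≤ E ^ 81 / 2 ∧ (r.den:ℝ) ≤ E ^ 81 / 2)
    (hFc : E ^ 159 ≤ F.card) : EQs a b F E τ ∧ EQp a b F E τ := by
  have hE0 : 0 < E := by linarith
  have hE1 : 1 ≤ E := by linarith
  set M := ⌈4 * E ^ (τ + 6)⌉₊ with hMdef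
  have hM1 : 4 * E ^ (τ + 6) ≤ M := Nat.le_ceil _
  have hM2 : (M:ℝ) ≤ E ^ (τ + 7) := by
    have := (Nat.ceil_lt_add_one (by positivity : 0 ≤ 4 * E ^ (τ + 6))).le
    have e : E ^ (τ + 7) = E * E ^ (τ + 6) := by ring
    have : 1 ≤ E ^ (τ + 6) := one_le_pow₀ hE1
    nlinarith
  set V := (F.card : ℝ) ^ 2 * E ^ τ / E ^ 60 with hVdef
  have hV := V_small a b κ s0 hs0 h E hE hs τ hτ F hF hFc M hM2
  have hτ1 : 1 ≤ τ := by omega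
  have eτ : E ^ (τ - 1) * E = E ^ τ := by
    rw [← pow_succ]; congr 1; omega
  have hlogM : 1 + Real.log M ≤ E ^ 2 := by
    refine le_trans ?_ hlog
    have hMpos : (0:ℝ) < M := lt_of_lt_of_le (by positivity) hM1
    have := Real.log_le_log hMpos hM2
    rw [Real.log_pow] at this
    push_cast at this
    linarith
  have hbig : ∀ N, E ^ (τ - 1) ≤ N → 1 ≤ N := fun N hN => (one_le_pow₀ hE1).trans hN
  have hV0 : 0 ≤ V := by positivity
  constructor
  · intro N hN1 hN2 k hk0 hk
    have hN := hbig N hN1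
    have h1 := eq_single F a b M V hV N (E ^ 3) hN (by
      calc 2 * (E ^ 3 * N) ≤ 2 * (E ^ 3 * E ^ (τ + 3)) := by gcongr
        _ = 2 * E ^ (τ + 6) := by ring
        _ ≤ 4 * E ^ (τ + 6) := by gcongr; norm_num
        _ ≤ M := hM1) k hk0 hk
    have hc := ratSet_card_upper 1 2 N (by linarith) (by norm_num)
    have hc2 : ((ratSet 1 2 N).card : ℝ) ≤ 2 * N ^ 2 := by nlinarith
    refine (sq_le_sq₀ (norm_nonneg _) (by positivity)).mp ?_
    refine h1.trans ?_
    calc ((ratSet 1 2 N).card:ℝ) * (V * (2 * M)) ≤ 2 * N ^ 2 * (V * (2 * E ^ (τ + 7))) := by gcongr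
      _ = N ^ 2 * (F.card : ℝ) ^ 2 * (E ^ τ) ^ 2 * (4 * E ^ 7 / E ^ 60) := by rw [hVdef]; ring
      _ = N ^ 2 * (F.card : ℝ) ^ 2 * (E ^ (τ - 1)) ^ 2 * (4 * E ^ 9 / E ^ 60) := by
          rw [← eτ]; ring
      _ ≤ N ^ 2 * (F.card : ℝ) ^ 2 * N ^ 2 * (E ^ 20 / E ^ 60) := by
          gcongr
          calc 4 * E ^ 9 ≤ E * E ^ 9 := by gcongr; linarith
            _ = E ^ 10 := by ring
            _ ≤ E ^ 20 := pow_le_pow_right₀ hE1 (by norm_num)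
      _ = _ := by field_simp
  · intro N N' Δ hN1 hN2 hN1' hN2' hΔ0 hΔ k k' hkk hk hk'
    have hN := hbig N hN1
    have hN' := hbig N' hN1'
    have hsm : ∀ N, E ^ (τ - 1) ≤ N → E ^ 3 * Δ < N / 8 := by
      intro N hN
      calc E ^ 3 * Δ ≤ E ^ 3 * E ^ 6 := by gcongr
        _ = E ^ 9 := by ring
        _ < E ^ 10 / 8 := by
            have : E ^ 10 = E * E ^ 9 := by ring
            have : 0 < E ^ 9 := by positivity
            nlinarith
        _ ≤ E ^ (τ - 1) / 8 := by gcongr; omega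
        _ ≤ N / 8 := by gcongr
    have h1 := eq_pair F a b M V hV N N' (E ^ (τ + 3)) (E ^ 3) Δ hN hN' hN2 hN2' hΔ0 (by
      refine le_trans (le_of_eq ?_) hM1
      ring) (hsm N hN1) (hsm N' hN1') k k' hkk hk hk'
    have hc := pairs_card N N' Δ hN hN' hΔ0
    refine (sq_le_sq₀ (norm_nonneg _) (by positivity)).mp ?_
    refine h1.trans ?_
    have hfac : 2 * M * (2 * Δ) + 2 * (2 * Δ * (2 * E ^ (τ + 3) * (E ^ 3 * Δ))) * (1 + Real.log M)
        ≤ Δ * (E ^ τ * E ^ 15) := by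
      calc _ ≤ 2 * E ^ (τ + 7) * (2 * Δ) + 2 * (2 * Δ * (2 * E ^ (τ + 3) * (E ^ 3 * E ^ 6))) * E ^ 2 := by
            gcongr
        _ = Δ * (E ^ τ * (4 * E ^ 7 + 8 * E ^ 14)) := by ring
        _ ≤ Δ * (E ^ τ * E ^ 15) := by
            gcongr
            have a1 : E ^ 7 ≤ E ^ 14 := pow_le_pow_right₀ hE1 (by norm_num)
            have a2 : E ^ 15 = E * E ^ 14 := by ring
            have : 0 < E ^ 14 := by positivity
            nlinarith
    calc ((pairs N N' Δ).card:ℝ) * (V * (2 * M * (2 * Δ) + 2 * (2 * Δ * (2 * E ^ (τ + 3) * (E ^ 3 * Δ))) * (1 + Real.log M)))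
        ≤ 68 * (N * N' * Δ) * (V * (Δ * (E ^ τ * E ^ 15))) := by gcongr
      _ = (N * N' * Δ ^ 2) * (F.card : ℝ) ^ 2 * (E ^ τ * E ^ τ) * (68 * E ^ 15 / E ^ 60) := by
          rw [hVdef]; ring
      _ = (N * N' * Δ ^ 2) * (F.card : ℝ) ^ 2 * (E ^ (τ - 1) * E ^ (τ - 1)) * (68 * E ^ 17 / E ^ 60) := by
          rw [← eτ]; ring
      _ ≤ (N * N' * Δ ^ 2) * (F.card : ℝ) ^ 2 * (N * N') * (E ^ 20 / E ^ 60) := by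
          gcongr
          calc 68 * E ^ 17 ≤ E * E ^ 17 := by gcongr; linarith
            _ = E ^ 18 := by ring
            _ ≤ E ^ 20 := pow_le_pow_right₀ hE1 (by norm_num)
      _ = _ := by field_simp

def vN (r c : ℚ) : ℤ := c.den * r.num + c.num * nn r
def vD (r c : ℚ) : ℤ := c.den * r.den + c.num * nd r
def ctr (r c : ℚ) : ℝ := (vN r c : ℝ) / vD r c

theorem th_eq (a b : ℝ) (r c : ℚ) : th a b r c = chi a b (vN r c) (vD r c) := by
  unfold th al ga chi vN vD; push_cast; ring

theorem wedge_eq (r c c' : ℚ) : vN r c * vD r c' - vN r c' * vD r c = wedge c c' := by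
  unfold vN vD wedge
  linear_combination (c.num * c'.den - c'.num * c.den) * nn_det r

theorem vD_bounds {r c : ℚ} {lo hi T N : ℝ} (hT : 0 < T) (hN : 0 < N) (hr : r ∈ ratSet lo hi T)
    (hc : c ∈ ratSet 1 2 N) : 0 < (vD r c : ℝ) ∧ (vD r c : ℝ) ≤ 5 * N * T := by
  obtain ⟨-, -, h1, h2⟩ := mem_ratSet.mp hr
  obtain ⟨h3, h4, h5, h6⟩ := num_bounds hc
  have g1 : (r.den:ℝ) < nd r := by exact_mod_cast nd_gt r
  have g2 : (nd r:ℝ) ≤ 2 * r.den := by exact_mod_cast nd_le r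
  have p1 : (0:ℝ) < r.den := by linarith
  have p2 : (0:ℝ) < c.den := by linarith
  have p3 : (0:ℝ) < c.num := by linarith
  have p4 : (0:ℝ) < nd r := by linarith
  have e : (vD r c : ℝ) = c.den * r.den + c.num * nd r := by unfold vD; push_cast; ring
  rw [e]
  refine ⟨by positivity, ?_⟩
  have q1 : (c.den:ℝ) * r.den ≤ N * T := by gcongr
  have q2 : (c.num:ℝ) * nd r ≤ (2 * N) * (2 * T) := by
    have : (nd r : ℝ) ≤ 2 * T := by linarith
    gcongr
  linarith

theorem ball_loc {r c : ℚ} {lo hi T N ρ x : ℝ} (hT : 0 < T) (hN : 0 < N) (hr : r ∈ ratSet lo hi T)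
    (hc : c ∈ ratSet 1 2 N) (hρ : ρ ≤ 1 / (160 * T ^ 2)) (hx : x ∈ Metric.closedBall (ctr r c) ρ) :
    (r:ℝ) ≤ x ∧ x ≤ r + 64 / T ^ 2 := by
  obtain ⟨hv0, hv1⟩ := vD_bounds hT hN hr hc
  obtain ⟨-, -, h1, h2⟩ := mem_ratSet.mp hr
  obtain ⟨h3, h4, h5, h6⟩ := num_bounds hc
  have g1 : (r.den:ℝ) < nd r := by exact_mod_cast nd_gt r
  have g2 : (nd r:ℝ) ≤ 2 * r.den := by exact_mod_cast nd_le r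
  have p1 : (0:ℝ) < r.den := by linarith
  have p2 : (0:ℝ) < c.den := by linarith
  have p3 : (0:ℝ) < c.num := by linarith
  have p4 : (0:ℝ) < nd r := by linarith
  have det : (nn r : ℝ) * r.den - r.num * nd r = 1 := by exact_mod_cast nn_det r
  have eD : (vD r c : ℝ) = c.den * r.den + c.num * nd r := by unfold vD; push_cast; ring
  have eN : (vN r c : ℝ) = c.den * r.num + c.num * nn r := by unfold vN; push_cast; ring
  have er : (r:ℝ) = r.num / r.den := by exact_mod_cast (Rat.num_div_den r).symm
  have hx' := abs_le.mp (by simpa [Real.dist_eq] using hx : |x - ctr r c| ≤ ρ)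
  have d1 : ctr r c - r = c.num / (r.den * vD r c) := by
    rw [er]; unfold ctr; field_simp; rw [eN, eD]; linear_combination (c.num:ℝ) * det
  have d2 : (nn r : ℝ) / nd r - ctr r c = c.den / (nd r * vD r c) := by
    unfold ctr; field_simp; rw [eN, eD]; linear_combination (c.den:ℝ) * det
  have d3 : (nn r : ℝ) / nd r - r = 1 / (r.den * nd r) := by
    rw [er]; field_simp; linear_combination det
  have b1 : 1 / (160 * T ^ 2) ≤ ctr r c - r := by
    rw [d1, div_le_div_iff₀ (by positivity) (by positivity)]
    have : (r.den:ℝ) * vD r c ≤ T * (5 * N * T) := by gcongr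
    have : N / 8 * T ^ 2 ≤ c.num * T ^ 2 := by gcongr
    nlinarith
  have b2 : 1 / (160 * T ^ 2) ≤ (nn r : ℝ) / nd r - ctr r c := by
    rw [d2, div_le_div_iff₀ (by positivity) (by positivity)]
    have : (nd r:ℝ) * vD r c ≤ (2 * T) * (5 * N * T) := by
      have : (nd r : ℝ) ≤ 2 * T := by linarith
      gcongr
    have : N / 8 * T ^ 2 ≤ c.den * T ^ 2 := by gcongr
    nlinarith
  have b3 : (nn r : ℝ) / nd r - r ≤ 64 / T ^ 2 := by
    rw [d3, div_le_div_iff₀ (by positivity) (by positivity)]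
    have : (T / 8) * (T / 8) ≤ r.den * nd r := by gcongr; linarith
    nlinarith
  constructor <;> linarith

theorem wedge_le {r c c' : ℚ} {X X' ρ ρ' : ℝ} (hX0 : 0 < (vD r c:ℝ)) (hX0' : 0 < (vD r c':ℝ))
    (hX : (vD r c:ℝ) ≤ X) (hX' : (vD r c':ℝ) ≤ X')
    (x : ℝ) (hx : x ∈ Metric.closedBall (ctr r c) ρ) (hx' : x ∈ Metric.closedBall (ctr r c') ρ') :
    |(wedge c c' : ℝ)| ≤ X * X' * (ρ + ρ') := by
  have e : (wedge c c' : ℝ) = (ctr r c - ctr r c') * (vD r c * vD r c') := by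
    rw [← wedge_eq r c c']; unfold ctr; push_cast; field_simp
  have h1 : |ctr r c - ctr r c'| ≤ ρ + ρ' := by
    have a1 : |x - ctr r c| ≤ ρ := by simpa [Real.dist_eq] using hx
    have a2 : |x - ctr r c'| ≤ ρ' := by simpa [Real.dist_eq] using hx'
    rw [abs_le] at *; constructor <;> linarith [a1.1, a1.2, a2.1, a2.2]
  rw [e, abs_mul, abs_of_pos (mul_pos hX0 hX0')]
  have hh : 0 ≤ ρ + ρ' := (abs_nonneg _).trans h1
  have hXX : 0 ≤ X := hX0.le.trans hX
  calc _ ≤ (ρ + ρ') * (X * X') := by gcongr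
    _ = _ := by ring

theorem memB_of (a b ε t s η x : ℝ) (p q m : ℤ) (hq : 0 < q) (hη : η ≤ ε * (s + t) ^ (-(2 / 3) : ℝ))
    (hη0 : 0 < η)
    (hqle : (q:ℝ) ≤ η * Real.exp (t + s)) (hx : |x - (p:ℝ) / q| ≤ Real.exp (-2 * (t + s) + t))
    (hm : |chi a b p q - m| < η * Real.exp (-t) / 2) (ha : |a| * Real.exp (t - s) ≤ 1 / 2) :
    memB a b ε t s x := by
  have hq' : (0:ℝ) < q := by exact_mod_cast hq
  have h1 : |(q:ℝ) * x - p| ≤ η * Real.exp (-s) := by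
    have : (q:ℝ) * x - p = q * (x - (p:ℝ) / q) := by field_simp
    rw [this, abs_mul, abs_of_pos hq']
    calc (q:ℝ) * |x - (p:ℝ) / q| ≤ (η * Real.exp (t + s)) * Real.exp (-2 * (t + s) + t) := by gcongr
      _ = η * (Real.exp (t + s) * Real.exp (-2 * (t + s) + t)) := by ring
      _ = _ := by rw [← Real.exp_add]; congr 2; ring
  refine ⟨![-m, -p, q], ?_, ?_⟩
  · intro h; have := congrFun h 2; simp at this; omega
  refine le_trans ?_ hη
  rw [pi_norm_le_iff_of_nonneg hη0.le]
  intro i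
  fin_cases i
  · have e : ((aM t s * uM (a * x + b) x).mulVec fun i => ((![-m, -p, q] i : ℤ) : ℝ)) 0 =
        Real.exp t * ((chi a b p q - m) + a * (q * x - p)) := by
      simp [aM, uM, Matrix.mulVec, dotProduct, Fin.sum_univ_three, Matrix.mul_apply, chi]
      ring
    simp only [Fin.zero_eta]
    rw [e, Real.norm_eq_abs, abs_mul, abs_of_pos (Real.exp_pos t)]
    calc Real.exp t * |chi a b p q - m + a * (q * x - p)|
        ≤ Real.exp t * (η * Real.exp (-t) / 2 + |a| * (η * Real.exp (-s))) := by
          gcongr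
          refine (abs_add_le _ _).trans ?_
          rw [abs_mul]; gcongr
      _ = η * (Real.exp t * Real.exp (-t)) / 2 + η * (|a| * (Real.exp t * Real.exp (-s))) := by ring
      _ = η / 2 + η * (|a| * Real.exp (t - s)) := by
          rw [← Real.exp_add, ← Real.exp_add]; simp [sub_eq_add_neg]
      _ ≤ η / 2 + η * (1 / 2) := by gcongr
      _ = η := by ring
  · have e : ((aM t s * uM (a * x + b) x).mulVec fun i => ((![-m, -p, q] i : ℤ) : ℝ)) 1 =
        Real.exp s * (q * x - p) := by
      simp [aM, uM, Matrix.mulVec, dotProduct, Fin.sum_univ_three, Matrix.mul_apply]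
      ring
    simp only [Fin.mk_one]
    rw [e, Real.norm_eq_abs, abs_mul, abs_of_pos (Real.exp_pos s)]
    calc Real.exp s * |(q:ℝ) * x - p| ≤ Real.exp s * (η * Real.exp (-s)) := by gcongr
      _ = η * (Real.exp s * Real.exp (-s)) := by ring
      _ = η := by rw [← Real.exp_add]; simp
  · have e : ((aM t s * uM (a * x + b) x).mulVec fun i => ((![-m, -p, q] i : ℤ) : ℝ)) 2 =
        Real.exp (-t - s) * q := by
      simp [aM, uM, Matrix.mulVec, dotProduct, Fin.sum_univ_three, Matrix.mul_apply]
    simp only [Fin.reduceFinMk]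
    rw [e, Real.norm_eq_abs, abs_mul, abs_of_pos (Real.exp_pos _), abs_of_pos hq']
    calc Real.exp (-t - s) * q ≤ Real.exp (-t - s) * (η * Real.exp (t + s)) := by gcongr
      _ = η * (Real.exp (-t - s) * Real.exp (t + s)) := by ring
      _ = η := by rw [← Real.exp_add]; simp

/-- telescoping bound -/
theorem geo_sum (n j : ℕ) : ∑ j' ∈ Finset.range n, Real.exp (-|(j:ℝ) - j'|) ≤ 3 := by
  let g : ℕ → ℝ := fun m => if m ≤ j then (1/2:ℝ) ^ (j - m) else 3 - 2 * (1/2:ℝ) ^ (m - j)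
  have hexp : ∀ d : ℕ, Real.exp (-(d:ℝ)) ≤ (1/2:ℝ) ^ d := by
    intro d
    have : Real.exp (-(d:ℝ)) = Real.exp (-1) ^ d := by rw [← Real.exp_nat_mul]; congr 1; ring
    rw [this]
    gcongr
    rw [Real.exp_neg, inv_le_comm₀ (Real.exp_pos _) (by norm_num)]
    have := Real.add_one_le_exp (1:ℝ)
    norm_num; linarith
  have hstep : ∀ m : ℕ, Real.exp (-|(j:ℝ) - m|) ≤ g (m + 1) - g m := by
    intro m
    rcases lt_or_ge m j with h | h
    · obtain ⟨d, rfl⟩ : ∃ d, j = m + 1 + d := ⟨j - (m+1), by omega⟩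
      have e1 : |((m + 1 + d : ℕ):ℝ) - m| = ((d + 1 : ℕ) : ℝ) := by
        push_cast; rw [abs_of_nonneg (by linarith [(Nat.cast_nonneg d : (0:ℝ) ≤ d)])]; ring
      rw [e1]
      have : g (m + 1) - g m = (1/2:ℝ) ^ (d+1) := by
        simp only [g]
        rw [if_pos (by omega), if_pos (by omega)]
        rw [show m + 1 + d - (m + 1) = d by omega, show m + 1 + d - m = d + 1 by omega]; ring
      rw [this]; exact hexp _
    · obtain ⟨d, rfl⟩ : ∃ d, m = j + d := ⟨m - j, by omega⟩
      have e1 : |(j:ℝ) - ((j + d : ℕ):ℝ)| = (d : ℝ) := by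
        push_cast; rw [show (j:ℝ) - (j + d) = -d by ring, abs_neg, abs_of_nonneg (by positivity)]
      rw [e1]
      have : g (j + d + 1) - g (j + d) = (1/2:ℝ) ^ d := by
        simp only [g]
        rw [if_neg (by omega)]
        rcases Nat.eq_zero_or_pos d with rfl | hd
        · simp; norm_num
        · rw [if_neg (by omega), show j + d + 1 - j = d + 1 by omega, show j + d - j = d by omega]
          ring
      rw [this]; exact hexp _
  have hg : ∀ m, 0 ≤ g m ∧ g m ≤ 3 := by
    intro m
    have q0 : ∀ d : ℕ, 0 ≤ (1/2:ℝ) ^ d ∧ (1/2:ℝ) ^ d ≤ 1 := fun d =>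
      ⟨by positivity, pow_le_one₀ (by norm_num) (by norm_num)⟩
    simp only [g]
    split_ifs
    · have := q0 (j - m); constructor <;> linarith
    · have := q0 (m - j); constructor <;> linarith
  calc _ ≤ ∑ m ∈ Finset.range n, (g (m + 1) - g m) := Finset.sum_le_sum fun m _ => hstep m
    _ = g n - g 0 := Finset.sum_range_sub g n
    _ ≤ 3 := by linarith [(hg n).2, (hg 0).1]

def bI (x ρ : ℝ) : ℝ → ℝ := (Metric.closedBall x ρ).indicator 1

theorem bI_int (x ρ : ℝ) (hρ : 0 ≤ ρ) : ∫ y, bI x ρ y = 2 * ρ := by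
  unfold bI
  rw [integral_indicator_one Metric.isClosed_closedBall.measurableSet, vol_cb x ρ hρ]

theorem bI_integrable (x ρ : ℝ) : Integrable (bI x ρ) := by
  unfold bI
  rw [integrable_indicator_iff Metric.isClosed_closedBall.measurableSet]
  apply integrableOn_const
  · exact (measure_closedBall_lt_top).ne
  · simp

theorem bI_nonneg (x ρ y : ℝ) : 0 ≤ bI x ρ y := Set.indicator_nonneg (fun _ _ => by simp) _

theorem bI_mul (x ρ x' ρ' : ℝ) : (fun y => bI x ρ y * bI x' ρ' y) =
    (Metric.closedBall x ρ ∩ Metric.closedBall x' ρ').indicator 1 := by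
  funext y
  unfold bI
  rw [Set.inter_indicator_one]; rfl

theorem bI_mul_int (x ρ x' ρ' : ℝ) : ∫ y, bI x ρ y * bI x' ρ' y =
    volume.real (Metric.closedBall x ρ ∩ Metric.closedBall x' ρ') := by
  rw [bI_mul, integral_indicator_one]
  exact (Metric.isClosed_closedBall.inter Metric.isClosed_closedBall).measurableSet

theorem bI_mul_integrable (x ρ x' ρ' : ℝ) : Integrable (fun y => bI x ρ y * bI x' ρ' y) := by
  rw [bI_mul, integrable_indicator_iff
    (Metric.isClosed_closedBall.inter Metric.isClosed_closedBall).measurableSet]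
  apply integrableOn_const
  · exact ((measure_mono Set.inter_subset_left).trans_lt measure_closedBall_lt_top).ne
  · simp

theorem sq_sum_int {ι : Type*} (P : Finset ι) (h x ρ : ι → ℝ) :
    Integrable (fun y => (∑ i ∈ P, h i * bI (x i) (ρ i) y) ^ 2) ∧
    ∫ y, (∑ i ∈ P, h i * bI (x i) (ρ i) y) ^ 2 = ∑ i ∈ P, ∑ j ∈ P, h i * h j *
      volume.real (Metric.closedBall (x i) (ρ i) ∩ Metric.closedBall (x j) (ρ j)) := by
  have e : (fun y => (∑ i ∈ P, h i * bI (x i) (ρ i) y) ^ 2) =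
      fun y => ∑ i ∈ P, ∑ j ∈ P, h i * h j * (bI (x i) (ρ i) y * bI (x j) (ρ j) y) := by
    funext y
    rw [sq, Finset.sum_mul_sum]
    refine Finset.sum_congr rfl fun i _ => Finset.sum_congr rfl fun j _ => by ring
  rw [e]
  have hint : ∀ i j, Integrable (fun y => h i * h j * (bI (x i) (ρ i) y * bI (x j) (ρ j) y)) :=
    fun i j => (bI_mul_integrable _ _ _ _).const_mul _
  refine ⟨integrable_finsetSum _ fun i _ => integrable_finsetSum _ fun j _ => hint i j, ?_⟩
  rw [integral_finsetSum _ fun i _ => integrable_finsetSum _ fun j _ => hint i j]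
  refine Finset.sum_congr rfl fun i _ => ?_
  rw [integral_finsetSum _ fun j _ => hint i j]
  refine Finset.sum_congr rfl fun j _ => ?_
  rw [integral_const_mul, bI_mul_int]

theorem PZ {ι : Type*} (P : Finset ι) (g h x ρ : ι → ℝ) (hρ : ∀ i ∈ P, 0 ≤ ρ i)
    (hh : ∀ i ∈ P, 0 ≤ h i) (hgh : ∀ i ∈ P, g i ≤ h i) (m M : ℝ) (hm : 0 < m)
    (hm1 : m ≤ ∑ i ∈ P, g i * (2 * ρ i))
    (hM : ∫ y, (∑ i ∈ P, h i * bI (x i) (ρ i) y) ^ 2 ≤ M) :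
    m ^ 2 / M ≤ volume.real {y | ∃ i ∈ P, 0 < g i ∧ y ∈ Metric.closedBall (x i) (ρ i)} := by
  set S := {y | ∃ i ∈ P, 0 < g i ∧ y ∈ Metric.closedBall (x i) (ρ i)} with hS
  have hSeq : S = ⋃ i ∈ P.filter (fun i => 0 < g i), Metric.closedBall (x i) (ρ i) := by
    ext y; simp [hS, and_assoc]
  have hSc : IsCompact S := by
    rw [hSeq]; exact (P.filter _).isCompact_biUnion fun i _ => isCompact_closedBall _ _
  have hSm : MeasurableSet S := hSc.isClosed.measurableSet
  set Z : ℝ → ℝ := fun y => ∑ i ∈ P, h i * bI (x i) (ρ i) y with hZ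
  have hZint : Integrable Z := integrable_finsetSum _ fun i _ => (bI_integrable _ _).const_mul _
  have hZ2 : Integrable (fun y => Z y ^ 2) := (sq_sum_int P h x ρ).1
  set w : ℝ → ℝ := S.indicator 1 with hw
  have hwint : Integrable w := by
    rw [hw, integrable_indicator_iff hSm]
    apply integrableOn_const
    · exact hSc.measure_lt_top.ne
    · simp
  have hwI : ∫ y, w y = volume.real S := integral_indicator_one hSm
  have hwZ : (fun y => w y * Z y) = S.indicator Z := by
    funext y; by_cases hy : y ∈ S <;> simp [hw, hy]
  have hwZi : Integrable (fun y => w y * Z y) := by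
    rw [hwZ]; exact hZint.indicator hSm
  have hww : ∀ y, w y ^ 2 = w y := by
    intro y; by_cases hy : y ∈ S <;> simp [hw, hy]
  -- first moment
  have h1 : m ≤ ∫ y, w y * Z y := by
    refine hm1.trans ?_
    have e : ∑ i ∈ P, g i * (2 * ρ i) = ∫ y, ∑ i ∈ P, g i * bI (x i) (ρ i) y := by
      rw [integral_finsetSum _ fun i _ => (bI_integrable _ _).const_mul _]
      refine Finset.sum_congr rfl fun i hi => ?_
      rw [integral_const_mul, bI_int _ _ (hρ i hi)]
    rw [e]
    refine integral_mono (integrable_finsetSum _ fun i _ => (bI_integrable _ _).const_mul _) hwZi ?_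
    intro y
    simp only [hZ, Finset.mul_sum]
    refine Finset.sum_le_sum fun i hi => ?_
    have hb := bI_nonneg (x i) (ρ i) y
    by_cases hgi : 0 < g i ∧ y ∈ Metric.closedBall (x i) (ρ i)
    · have : y ∈ S := ⟨i, hi, hgi⟩
      have : w y = 1 := by simp [hw, this]
      rw [this, one_mul]
      exact mul_le_mul_of_nonneg_right (hgh i hi) hb
    · have r1 : 0 ≤ w y * (h i * bI (x i) (ρ i) y) :=
        mul_nonneg (Set.indicator_nonneg (fun _ _ => by simp) _) (mul_nonneg (hh i hi) hb)
      refine le_trans ?_ r1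
      by_cases hy : y ∈ Metric.closedBall (x i) (ρ i)
      · have : g i ≤ 0 := by
          by_contra hc; exact hgi ⟨not_le.mp hc, hy⟩
        exact mul_nonpos_of_nonpos_of_nonneg this hb
      · have : bI (x i) (ρ i) y = 0 := by unfold bI; exact Set.indicator_of_notMem hy _
        rw [this]; simp
  set I1 := ∫ y, w y * Z y
  have hq : ∀ c : ℝ, 0 ≤ (∫ y, Z y ^ 2) - 2 * c * I1 + c ^ 2 * volume.real S := by
    intro c
    have : 0 ≤ ∫ y, (Z y - c * w y) ^ 2 := integral_nonneg fun y => sq_nonneg _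
    have e : (fun y => (Z y - c * w y) ^ 2) = fun y => Z y ^ 2 - (2 * c) * (w y * Z y) + c ^ 2 * w y := by
      funext y
      have := hww y
      linear_combination c ^ 2 * this
    have hsub : Integrable (fun y => Z y ^ 2 - (2 * c) * (w y * Z y)) := hZ2.sub (hwZi.const_mul _)
    rw [e, integral_add hsub (hwint.const_mul _),
      integral_sub hZ2 (hwZi.const_mul _), integral_const_mul, integral_const_mul, hwI] at this
    exact this
  have hM0 : 0 ≤ M := (integral_nonneg fun y => sq_nonneg _).trans hM
  rcases hM0.eq_or_lt with h0 | hMp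
  · rw [← h0]; simp
  have := hq (M / m)
  rw [div_le_iff₀ hMp]
  have k1 : (∫ y, Z y ^ 2) ≤ M := hM
  have k2 : 2 * (M / m) * m ≤ 2 * (M / m) * I1 := by gcongr
  have k3 : 2 * (M / m) * m = 2 * M := by field_simp
  have k4 : M ≤ (M / m) ^ 2 * volume.real S := by linarith
  have k5 : (M / m) ^ 2 * volume.real S = M * (M * volume.real S) / m ^ 2 := by ring
  rw [k5, le_div_iff₀ (by positivity)] at k4
  have := le_of_mul_le_mul_left k4 hMp
  linarith

open Classical in
theorem overlap_sq {α β : Type*} (F : Finset α) (Q : Finset β) (L : ℝ) (h x ρ : α → β → ℝ)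
    (hov : ∀ y, ((F.filter fun r => ∃ q ∈ Q, y ∈ Metric.closedBall (x r q) (ρ r q)).card : ℝ) ≤ L) :
    ∫ y, (∑ i ∈ F ×ˢ Q, h i.1 i.2 * bI (x i.1 i.2) (ρ i.1 i.2) y) ^ 2 ≤
      L * ∑ r ∈ F, ∑ q ∈ Q, ∑ q' ∈ Q, h r q * h r q' *
        volume.real (Metric.closedBall (x r q) (ρ r q) ∩ Metric.closedBall (x r q') (ρ r q')) := by
  have hi := (sq_sum_int (F ×ˢ Q) (fun i => h i.1 i.2) (fun i => x i.1 i.2) (fun i => ρ i.1 i.2)).1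
  have e : ∀ r, (∑ q ∈ Q, ∑ q' ∈ Q, h r q * h r q' *
        volume.real (Metric.closedBall (x r q) (ρ r q) ∩ Metric.closedBall (x r q') (ρ r q'))) =
        ∫ y, (∑ q ∈ Q, h r q * bI (x r q) (ρ r q) y) ^ 2 := fun r =>
    ((sq_sum_int Q (h r) (x r) (ρ r)).2).symm
  simp_rw [e]
  rw [← integral_finsetSum _ fun r _ => (sq_sum_int Q (h r) (x r) (ρ r)).1, ← integral_const_mul]
  refine integral_mono hi ((integrable_finsetSum _ fun r _ =>
    (sq_sum_int Q (h r) (x r) (ρ r)).1).const_mul _) ?_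
  intro y
  simp only
  rw [Finset.sum_product]
  have key : ∑ r ∈ F, ∑ q ∈ Q, h r q * bI (x r q) (ρ r q) y =
      ∑ r ∈ F.filter (fun r => ∃ q ∈ Q, y ∈ Metric.closedBall (x r q) (ρ r q)),
        ∑ q ∈ Q, h r q * bI (x r q) (ρ r q) y := by
    symm
    refine Finset.sum_subset (Finset.filter_subset _ _) ?_
    intro r hr hr'
    refine Finset.sum_eq_zero fun q hq => ?_
    have : y ∉ Metric.closedBall (x r q) (ρ r q) := fun hy =>
      hr' (Finset.mem_filter.mpr ⟨hr, q, hq, hy⟩)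
    unfold bI
    rw [Set.indicator_of_notMem this, mul_zero]
  rw [key]
  refine sq_sum_le_card_mul_sum_sq.trans ?_
  have : ∑ r ∈ F.filter (fun r => ∃ q ∈ Q, y ∈ Metric.closedBall (x r q) (ρ r q)),
        (∑ q ∈ Q, h r q * bI (x r q) (ρ r q) y) ^ 2 ≤
      ∑ r ∈ F, (∑ q ∈ Q, h r q * bI (x r q) (ρ r q) y) ^ 2 :=
    Finset.sum_le_sum_of_subset_of_nonneg (Finset.filter_subset _ _) fun _ _ _ => sq_nonneg _
  exact mul_le_mul (hov y) this (Finset.sum_nonneg fun _ _ => sq_nonneg _) ((Nat.cast_nonneg _).trans (hov y))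

theorem sig_facts {σ E : ℝ} {K : ℕ} (hE : 100 ≤ E) (h0 : 0 < σ) (h1 : σ ≤ 1 / 4)
    (hK1 : 2 / σ ≤ K) (hK2 : (K:ℝ) ≤ 2 / σ + 1) (hK3 : (K:ℝ) ≤ E ^ 3) :
    2 ≤ K ∧ kh0 K ≤ σ ∧ σ / 5 ≤ kh0 K ∧ 2 / E ^ 3 ≤ σ := by
  have h8 : 8 ≤ 2 / σ := by rw [le_div_iff₀ h0]; linarith
  have hK : 2 ≤ K := by
    have : (2:ℝ) ≤ K := by linarith
    exact_mod_cast this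
  have hE3 : 0 < E ^ 3 := by positivity
  have hK0 : (0:ℝ) < K := by linarith
  obtain ⟨b1, b2⟩ := kh0_bounds K hK
  have hKσ : 2 ≤ K * σ := by rwa [div_le_iff₀ h0] at hK1
  refine ⟨hK, b2.trans ?_, le_trans ?_ b1, ?_⟩
  · rw [div_le_iff₀ hK0]; linarith
  · rw [div_le_div_iff₀ (by norm_num) (by positivity)]
    have : (K:ℝ) * σ ≤ 2 + σ := by
      calc (K:ℝ) * σ ≤ (2 / σ + 1) * σ := by gcongr
        _ = 2 + σ := by field_simp
    nlinarith
  · rw [div_le_iff₀ hE3]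
    nlinarith

theorem first_mom (a b : ℝ) (F : Finset ℚ) (E : ℝ) (τ : ℕ) (hEQ : EQs a b F E τ) (hE : 100 ≤ E)
    (N : ℝ) (hN1 : E ^ (τ - 1) ≤ N) (hN2 : N ≤ E ^ (τ + 3)) (hC : N ^ 2 / 32 ≤ (ratSet 1 2 N).card)
    (σ : ℝ) (h0 : 0 < σ) (h1 : σ ≤ 1 / 4) (K : ℕ)
    (hK1 : 2 / σ ≤ K) (hK2 : (K:ℝ) ≤ 2 / σ + 1) (hK3 : (K:ℝ) ≤ E ^ 3) :
    F.card * N ^ 2 * σ / 640 ≤ ∑ r ∈ F, ∑ c ∈ ratSet 1 2 N, kG K σ (th a b r c) := by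
  obtain ⟨hK, b1, b2, b3⟩ := sig_facts hE h0 h1 hK1 hK2 hK3
  have hE0 : 0 < E := by linarith
  have h := kG_lower (F ×ˢ ratSet 1 2 N) (fun i => th a b i.1 i.2) K hK σ (F.card * N ^ 2 / E ^ 20) h0 h1
    (le_trans (by gcongr; norm_num) hK1) (by positivity) (by
      intro m hm hmK
      rw [Finset.sum_product]
      exact hEQ N hN1 hN2 m hm (hmK.trans hK3))
  rw [Finset.sum_product] at h
  refine le_trans ?_ h
  rw [Finset.card_product]
  push_cast
  have k1 : (F.card:ℝ) * (N ^ 2 / 32) * (σ / 5 / 2) ≤ F.card * (ratSet 1 2 N).card * (kh0 K / 2) := by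
    gcongr
  have k2 : 1 / E ^ 20 / (4 * σ ^ 2) ≤ σ / 640 := by
    rw [div_div, div_le_div_iff₀ (by positivity) (by norm_num)]
    have : (2 / E ^ 3) ^ 3 ≤ σ ^ 3 := by gcongr
    have e : (2 / E ^ 3) ^ 3 * E ^ 20 = 8 * E ^ 11 := by field_simp; norm_num
    have e2 : E ^ 11 ≥ 100 := le_trans hE (le_self_pow₀ (by linarith) (by norm_num))
    have e3 : (2 / E ^ 3) ^ 3 * E ^ 20 ≤ σ ^ 3 * E ^ 20 := by gcongr
    nlinarith
  have k3 : (F.card:ℝ) * N ^ 2 * (1 / E ^ 20 / (4 * σ ^ 2)) ≤ F.card * N ^ 2 * (σ / 640) := by gcongr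
  have k4 : (F.card:ℝ) * N ^ 2 / E ^ 20 / (4 * σ ^ 2) = F.card * N ^ 2 * (1 / E ^ 20 / (4 * σ ^ 2)) := by ring
  rw [k4]
  linarith

theorem up_mom (a b : ℝ) (F : Finset ℚ) (E : ℝ) (τ : ℕ) (hEQ : EQs a b F E τ) (hE : 100 ≤ E)
    (N : ℝ) (hN1 : E ^ (τ - 1) ≤ N) (hN2 : N ≤ E ^ (τ + 3))
    (σ : ℝ) (h0 : 0 < σ) (h1 : σ ≤ 1 / 4) (K : ℕ)
    (hK1 : 2 / σ ≤ K) (hK2 : (K:ℝ) ≤ 2 / σ + 1) (hK3 : (K:ℝ) ≤ E ^ 3) :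
    ∑ r ∈ F, ∑ c ∈ ratSet 1 2 N, kH K (th a b r c) ≤ 3 * F.card * N ^ 2 * σ := by
  obtain ⟨hK, b1, b2, b3⟩ := sig_facts hE h0 h1 hK1 hK2 hK3
  have hE0 : 0 < E := by linarith
  have hN : 1 ≤ N := (one_le_pow₀ (by linarith)).trans hN1
  have h := kH_upper (F ×ˢ ratSet 1 2 N) (fun i => th a b i.1 i.2) K hK (F.card * N ^ 2 / E ^ 20)
    (by positivity) (by
      intro m hm hmK
      rw [Finset.sum_product]
      exact hEQ N hN1 hN2 m hm (hmK.trans hK3))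
  rw [Finset.sum_product, Finset.card_product] at h
  push_cast at h
  refine h.trans ?_
  have hc := ratSet_card_upper 1 2 N (by linarith) (by norm_num)
  have hc2 : ((ratSet 1 2 N).card : ℝ) ≤ 2 * N ^ 2 := by nlinarith
  have k1 : (F.card:ℝ) * (ratSet 1 2 N).card * kh0 K ≤ F.card * (2 * N ^ 2) * σ := by
    gcongr
    exact le_trans (by positivity) b2
  have k2 : 1 / E ^ 20 ≤ σ := by
    refine le_trans ?_ b3
    rw [div_le_div_iff₀ (by positivity) (by positivity)]
    have : E ^ 3 ≤ E ^ 20 := pow_le_pow_right₀ (by linarith) (by norm_num)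
    have : 0 < E ^ 3 := by positivity
    linarith
  have k3 : (F.card:ℝ) * N ^ 2 * (1 / E ^ 20) ≤ F.card * N ^ 2 * σ := by gcongr
  have k4 : (F.card:ℝ) * N ^ 2 / E ^ 20 = F.card * N ^ 2 * (1 / E ^ 20) := by ring
  rw [k4]; linarith

theorem pair_mom (a b : ℝ) (F : Finset ℚ) (E : ℝ) (τ : ℕ) (hEQ : EQp a b F E τ) (hE : 100 ≤ E)
    (N N' Δ : ℝ) (hN1 : E ^ (τ - 1) ≤ N) (hN2 : N ≤ E ^ (τ + 3))
    (hN1' : E ^ (τ - 1) ≤ N') (hN2' : N' ≤ E ^ (τ + 3)) (hΔ0 : 0 ≤ Δ) (hΔ : Δ ≤ E ^ 6)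
    (σ σ' : ℝ) (h0 : 0 < σ) (h1 : σ ≤ 1 / 4) (h0' : 0 < σ') (h1' : σ' ≤ 1 / 4) (K K' : ℕ)
    (hK1 : 2 / σ ≤ K) (hK2 : (K:ℝ) ≤ 2 / σ + 1) (hK3 : (K:ℝ) ≤ E ^ 3)
    (hK1' : 2 / σ' ≤ K') (hK2' : (K':ℝ) ≤ 2 / σ' + 1) (hK3' : (K':ℝ) ≤ E ^ 3) :
    ∑ r ∈ F, ∑ c ∈ pairs N N' Δ, kH K (th a b r c.1) * kH K' (th a b r c.2)
      ≤ 69 * F.card * (N * N' * Δ) * (σ * σ') := by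
  obtain ⟨hK, b1, b2, b3⟩ := sig_facts hE h0 h1 hK1 hK2 hK3
  obtain ⟨hK', b1', b2', b3'⟩ := sig_facts hE h0' h1' hK1' hK2' hK3'
  have hE0 : 0 < E := by linarith
  have hN : 1 ≤ N := (one_le_pow₀ (by linarith)).trans hN1
  have hN' : 1 ≤ N' := (one_le_pow₀ (by linarith)).trans hN1'
  have h := kHH_upper (F ×ˢ pairs N N' Δ) (fun i => th a b i.1 i.2.1) (fun i => th a b i.1 i.2.2)
    K K' hK hK' (F.card * (N * N' * Δ) / E ^ 20)
    (by positivity) (by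
      intro m m' hm hmK hmK'
      rw [Finset.sum_product]
      exact hEQ N N' Δ hN1 hN2 hN1' hN2' hΔ0 hΔ m m' hm (hmK.trans hK3) (hmK'.trans hK3'))
  rw [Finset.sum_product, Finset.card_product] at h
  push_cast at h
  refine h.trans ?_
  have hc := pairs_card N N' Δ hN hN' hΔ0
  have hk0 : 0 ≤ kh0 K := le_trans (by positivity) b2
  have hk0' : 0 ≤ kh0 K' := le_trans (by positivity) b2'
  have k1 : (F.card:ℝ) * (pairs N N' Δ).card * (kh0 K * kh0 K') ≤
      F.card * (68 * (N * N' * Δ)) * (σ * σ') := by gcongr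
  have k2 : 1 / E ^ 20 ≤ σ * σ' := by
    have : 2 / E ^ 3 * (2 / E ^ 3) ≤ σ * σ' := by gcongr
    refine le_trans ?_ this
    rw [div_mul_div_comm, div_le_div_iff₀ (by positivity) (by positivity)]
    have : E ^ 3 * E ^ 3 ≤ E ^ 20 := by
      rw [← pow_add]; exact pow_le_pow_right₀ (by linarith) (by norm_num)
    have : 0 < E ^ 3 * E ^ 3 := by positivity
    linarith
  have k3 : (F.card:ℝ) * (N * N' * Δ) * (1 / E ^ 20) ≤ F.card * (N * N' * Δ) * (σ * σ') := by gcongr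
  have k4 : (F.card:ℝ) * (N * N' * Δ) / E ^ 20 = F.card * (N * N' * Δ) * (1 / E ^ 20) := by ring
  rw [k4]; linarith

theorem vol_inter_le (x x' ρ ρ' : ℝ) (h : 0 ≤ ρ) (h' : 0 ≤ ρ') :
    volume.real (Metric.closedBall x ρ ∩ Metric.closedBall x' ρ') ≤ 2 * min ρ ρ' := by
  rcases le_total ρ ρ' with hh | hh
  · rw [min_eq_left hh, ← vol_cb x ρ h]
    exact measureReal_mono Set.inter_subset_left measure_closedBall_lt_top.ne
  · rw [min_eq_right hh, ← vol_cb x' ρ' h']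
    exact measureReal_mono Set.inter_subset_right measure_closedBall_lt_top.ne

theorem off_diag (r : ℚ) (N N' Δ ρ ρ' : ℝ) (h : 0 ≤ ρ) (h' : 0 ≤ ρ') (X X' : ℝ) (f f' : ℚ → ℝ)
    (hf : ∀ c, 0 ≤ f c) (hf' : ∀ c, 0 ≤ f' c)
    (hX : ∀ c ∈ ratSet 1 2 N, 0 < (vD r c:ℝ) ∧ (vD r c:ℝ) ≤ X)
    (hX' : ∀ c ∈ ratSet 1 2 N', 0 < (vD r c:ℝ) ∧ (vD r c:ℝ) ≤ X')
    (hΔ : X * X' * (ρ + ρ') ≤ Δ) :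
    ∑ c ∈ ratSet 1 2 N, ∑ c' ∈ ratSet 1 2 N', f c * f' c' *
      volume.real (Metric.closedBall (ctr r c) ρ ∩ Metric.closedBall (ctr r c') ρ') ≤
    2 * min ρ ρ' * ∑ c ∈ pairs N N' Δ, f c.1 * f' c.2 +
      2 * min ρ ρ' * ∑ c ∈ ratSet 1 2 N, if c ∈ ratSet 1 2 N' then f c * f' c else 0 := by
  classical
  set C := ratSet 1 2 N
  set C' := ratSet 1 2 N'
  set μ := 2 * min ρ ρ' with hμ
  have hμ0 : 0 ≤ μ := by positivity
  have e1 : ∑ c ∈ pairs N N' Δ, f c.1 * f' c.2 =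
      ∑ c ∈ C, ∑ c' ∈ C', if (c, c') ∈ pairs N N' Δ then f c * f' c' else 0 := by
    rw [← Finset.sum_product' (f := fun c c' => if (c, c') ∈ pairs N N' Δ then f c * f' c' else 0)]
    rw [← Finset.sum_filter]
    refine Finset.sum_congr ?_ fun _ _ => rfl
    ext c
    rw [Finset.mem_filter, Finset.mem_product]
    constructor
    · intro hc; have := mem_pairs.mp hc; exact ⟨⟨this.1, this.2.1⟩, hc⟩
    · exact fun hc => hc.2
  have e2 : ∑ c ∈ C, (if c ∈ C' then f c * f' c else 0) =
      ∑ c ∈ C, ∑ c' ∈ C', if c = c' then f c * f' c' else 0 := by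
    refine Finset.sum_congr rfl fun c _ => ?_
    rw [Finset.sum_ite_eq]
  rw [e1, e2, ← mul_add, ← Finset.sum_add_distrib, Finset.mul_sum]
  refine Finset.sum_le_sum fun c hc => ?_
  rw [← Finset.sum_add_distrib, Finset.mul_sum]
  refine Finset.sum_le_sum fun c' hc' => ?_
  have hff : 0 ≤ f c * f' c' := mul_nonneg (hf c) (hf' c')
  have hv := vol_inter_le (ctr r c) (ctr r c') ρ ρ' h h'
  have main : f c * f' c' * volume.real (Metric.closedBall (ctr r c) ρ ∩ Metric.closedBall (ctr r c') ρ')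
      ≤ μ * (f c * f' c') := by
    rw [mul_comm μ]; gcongr
  have i1 : (0:ℝ) ≤ if (c, c') ∈ pairs N N' Δ then f c * f' c' else 0 := by split_ifs <;> simp [hff]
  have i2 : (0:ℝ) ≤ if c = c' then f c * f' c' else 0 := by split_ifs <;> simp [hff]
  by_cases hcc : c = c'
  · refine main.trans ?_
    gcongr
    rw [if_pos hcc] at i2 ⊢
    linarith
  by_cases hne : (Metric.closedBall (ctr r c) ρ ∩ Metric.closedBall (ctr r c') ρ').Nonempty
  · obtain ⟨x, hx, hx'⟩ := hne
    have hw := wedge_le (hX c hc).1 (hX' c' hc').1 (hX c hc).2 (hX' c' hc').2 x hx hx'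
    have hp : (c, c') ∈ pairs N N' Δ := mem_pairs.mpr ⟨hc, hc', hcc, hw.trans hΔ⟩
    refine main.trans ?_
    gcongr
    rw [if_pos hp]
    linarith
  · rw [Set.not_nonempty_iff_eq_empty] at hne
    rw [hne]
    simp only [measureReal_empty, mul_zero]
    positivity

structure SC (E η T : ℝ) (τ : ℕ) (t l N ρ σ : ℝ) (K : ℕ) : Prop where
  N_eq : N = η * Real.exp l / (5 * T)
  r_eq : ρ = Real.exp (-2 * l + t)
  s_eq : σ = η * Real.exp (-t) / 2
  N1 : E ^ (τ - 1) ≤ N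
  N2 : N ≤ E ^ (τ + 3)
  s1 : σ ≤ 1 / 4
  K1 : 2 / σ ≤ K
  K2 : (K:ℝ) ≤ 2 / σ + 1
  K3 : (K:ℝ) ≤ E ^ 3

theorem S_off {E η T : ℝ} {τ : ℕ} {t l N ρ σ : ℝ} {K : ℕ} {t' l' N' ρ' σ' : ℝ} {K' : ℕ}
    (S : SC E η T τ t l N ρ σ K) (S' : SC E η T τ t' l' N' ρ' σ' K')
    (hη0 : 0 < η) (hη1 : η ≤ 1 / 2) (hT : 0 < T) (hE : 100 ≤ E)
    (a b : ℝ) (F : Finset ℚ) (hEQ : EQp a b F E τ)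
    (hl1 : Real.exp (l' - l + t) ≤ E ^ 5) (hl2 : Real.exp (l - l' + t') ≤ E ^ 5) :
    2 * min ρ ρ' * ∑ r ∈ F, ∑ c ∈ pairs N N' (2 * η ^ 2 * Real.exp (l + l') * max ρ ρ'),
      kH K (th a b r c.1) * kH K' (th a b r c.2) ≤ 3 * F.card * η ^ 6 / T ^ 2 := by
  set Δ := 2 * η ^ 2 * Real.exp (l + l') * max ρ ρ' with hΔ
  have hσ0 : 0 < σ := by rw [S.s_eq]; positivity
  have hσ0' : 0 < σ' := by rw [S'.s_eq]; positivity
  have hρ0 : 0 < ρ := by rw [S.r_eq]; positivity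
  have hρ0' : 0 < ρ' := by rw [S'.r_eq]; positivity
  have hΔ0 : 0 ≤ Δ := by positivity
  have hΔ1 : Δ ≤ E ^ 6 := by
    have m1 : Real.exp (l + l') * max ρ ρ' ≤ E ^ 5 := by
      rw [mul_max_of_nonneg _ _ (Real.exp_pos _).le, S.r_eq, S'.r_eq, ← Real.exp_add, ← Real.exp_add]
      refine max_le ?_ ?_
      · refine le_trans (le_of_eq ?_) hl1; congr 1; ring
      · refine le_trans (le_of_eq ?_) hl2; congr 1; ring
    have m2 : 2 * η ^ 2 ≤ 1 := by nlinarith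
    have m3 : E ^ 5 ≤ E ^ 6 := pow_le_pow_right₀ (by linarith) (by norm_num)
    calc Δ = (2 * η ^ 2) * (Real.exp (l + l') * max ρ ρ') := by rw [hΔ]; ring
      _ ≤ 1 * E ^ 5 := by gcongr
      _ ≤ _ := by linarith
  have h := pair_mom a b F E τ hEQ hE N N' Δ S.N1 S.N2 S'.N1 S'.N2 hΔ0 hΔ1 σ σ' hσ0 S.s1 hσ0' S'.s1
    K K' S.K1 S.K2 S.K3 S'.K1 S'.K2 S'.K3
  calc _ ≤ 2 * min ρ ρ' * (69 * F.card * (N * N' * Δ) * (σ * σ')) := by gcongr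
    _ = 276 * F.card * (min ρ ρ' * max ρ ρ') * (N * N' * (η ^ 2 * Real.exp (l + l'))) * (σ * σ') := by
        rw [hΔ]; ring
    _ = (276 / 100) * F.card * η ^ 6 / T ^ 2 := by
        rw [min_mul_max, S.N_eq, S'.N_eq, S.s_eq, S'.s_eq, S.r_eq, S'.r_eq]
        have e1 : ∀ l t : ℝ, Real.exp (-2 * l + t) = Real.exp t / Real.exp l ^ 2 := by
          intro l t
          rw [← Real.exp_nat_mul, ← Real.exp_sub]; congr 1; push_cast; ring
        rw [e1, e1, Real.exp_add, Real.exp_neg, Real.exp_neg]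
        field_simp
        ring
    _ ≤ _ := by gcongr; norm_num

theorem S_diag {E η T : ℝ} {τ : ℕ} {t l N ρ σ : ℝ} {K : ℕ} {t' l' N' ρ' σ' : ℝ} {K' : ℕ}
    (S : SC E η T τ t l N ρ σ K) (S' : SC E η T τ t' l' N' ρ' σ' K')
    (hη0 : 0 < η) (hT : 0 < T) (hE : 100 ≤ E)
    (a b : ℝ) (F : Finset ℚ) (hEQ : EQs a b F E τ) (hl : l = l') :
    2 * min ρ ρ' * ∑ r ∈ F, ∑ c ∈ ratSet 1 2 N, (if c ∈ ratSet 1 2 N' then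
      kH K (th a b r c) * kH K' (th a b r c) else 0) ≤ F.card * η ^ 3 / T ^ 2 * Real.exp (-|t - t'|) := by
  subst hl
  have hNN : N' = N := by rw [S.N_eq, S'.N_eq]
  subst hNN
  have hσ0 : 0 < σ := by rw [S.s_eq]; positivity
  have hσ0' : 0 < σ' := by rw [S'.s_eq]; positivity
  have hρ0 : 0 < ρ := by rw [S.r_eq]; positivity
  have hρ0' : 0 < ρ' := by rw [S'.r_eq]; positivity
  have e1 : ∀ l t : ℝ, Real.exp (-2 * l + t) = Real.exp t / Real.exp l ^ 2 := by
    intro l t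
    rw [← Real.exp_nat_mul, ← Real.exp_sub]; congr 1; push_cast; ring
  have hK := (sig_facts hE hσ0 S.s1 S.K1 S.K2 S.K3).1
  have hK' := (sig_facts hE hσ0' S'.s1 S'.K1 S'.K2 S'.K3).1
  rcases le_total t t' with h | h
  · have hρ : ρ ≤ ρ' := by rw [S.r_eq, S'.r_eq]; gcongr
    rw [min_eq_left hρ, abs_of_nonpos (by linarith)]
    have u := up_mom a b F E τ hEQ hE N' S.N1 S.N2 σ' hσ0' S'.s1 K' S'.K1 S'.K2 S'.K3
    calc _ ≤ 2 * ρ * ∑ r ∈ F, ∑ c ∈ ratSet 1 2 N', kH K' (th a b r c) := by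
          gcongr with r _ c hc
          rw [if_pos hc]
          exact mul_le_of_le_one_left (kH_nonneg _ _) (kH_le_one _ _ hK)
      _ ≤ 2 * ρ * (3 * F.card * N' ^ 2 * σ') := by gcongr
      _ = (3 / 25) * (F.card * η ^ 3 / T ^ 2 * Real.exp (- -(t - t'))) := by
          rw [S.r_eq, S'.s_eq, S.N_eq, e1, neg_neg, Real.exp_sub, Real.exp_neg]
          field_simp
          norm_num
      _ ≤ 1 * (F.card * η ^ 3 / T ^ 2 * Real.exp (- -(t - t'))) := by gcongr; norm_num
      _ = _ := one_mul _
  · have hρ : ρ' ≤ ρ := by rw [S.r_eq, S'.r_eq]; gcongr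
    rw [min_eq_right hρ, abs_of_nonneg (by linarith)]
    have u := up_mom a b F E τ hEQ hE N' S.N1 S.N2 σ hσ0 S.s1 K S.K1 S.K2 S.K3
    calc _ ≤ 2 * ρ' * ∑ r ∈ F, ∑ c ∈ ratSet 1 2 N', kH K (th a b r c) := by
          gcongr with r _ c hc
          rw [if_pos hc]
          exact mul_le_of_le_one_right (kH_nonneg _ _) (kH_le_one _ _ hK')
      _ ≤ 2 * ρ' * (3 * F.card * N' ^ 2 * σ) := by gcongr
      _ = (3 / 25) * (F.card * η ^ 3 / T ^ 2 * Real.exp (-(t - t'))) := by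
          rw [S'.r_eq, S.s_eq, S.N_eq, e1, neg_sub, Real.exp_sub, Real.exp_neg]
          field_simp
          norm_num
      _ ≤ 1 * (F.card * η ^ 3 / T ^ 2 * Real.exp (-(t - t'))) := by gcongr; norm_num
      _ = _ := one_mul _

theorem disj_aux {η T l l' N N' : ℝ} (hη0 : 0 < η) (hT : 0 < T)
    (hN : N = η * Real.exp l / (5 * T)) (hN' : N' = η * Real.exp l' / (5 * T)) (h : l + 3 ≤ l') :
    8 * N ≤ N' := by
  have e3 : (8:ℝ) ≤ Real.exp 3 := by
    have h1 := Real.exp_one_gt_d9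
    have : Real.exp 3 = Real.exp 1 ^ 3 := by rw [← Real.exp_nat_mul]; norm_num
    rw [this]
    calc (8:ℝ) = 2 ^ 3 := by norm_num
      _ ≤ _ := by gcongr; linarith
  have : 8 * Real.exp l ≤ Real.exp l' := by
    calc 8 * Real.exp l ≤ Real.exp 3 * Real.exp l := by gcongr
      _ = Real.exp (l + 3) := by rw [← Real.exp_add, add_comm]
      _ ≤ _ := by gcongr
  rw [hN, hN', mul_div_assoc', div_le_div_iff_of_pos_right (by positivity)]
  nlinarith

theorem S_bound {E η T : ℝ} {τ : ℕ} {t l N ρ σ : ℝ} {K : ℕ} {t' l' N' ρ' σ' : ℝ} {K' : ℕ}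
    (S : SC E η T τ t l N ρ σ K) (S' : SC E η T τ t' l' N' ρ' σ' K')
    (hη0 : 0 < η) (hη1 : η ≤ 1 / 2) (hT : 0 < T) (hE : 100 ≤ E)
    (a b lo hi : ℝ) (hEQ : EQs a b (ratSet lo hi T) E τ) (hEQp : EQp a b (ratSet lo hi T) E τ)
    (hl1 : Real.exp (l' - l + t) ≤ E ^ 5) (hl2 : Real.exp (l - l' + t') ≤ E ^ 5)
    (hl3 : l = l' ∨ l + 3 ≤ l' ∨ l' + 3 ≤ l) :
    ∑ r ∈ ratSet lo hi T, ∑ c ∈ ratSet 1 2 N, ∑ c' ∈ ratSet 1 2 N', kH K (th a b r c) * kH K' (th a b r c') *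
      volume.real (Metric.closedBall (ctr r c) ρ ∩ Metric.closedBall (ctr r c') ρ') ≤
    3 * (ratSet lo hi T).card * η ^ 6 / T ^ 2 +
      if l = l' then (ratSet lo hi T).card * η ^ 3 / T ^ 2 * Real.exp (-|t - t'|) else 0 := by
  set F := ratSet lo hi T with hF
  set Δ := 2 * η ^ 2 * Real.exp (l + l') * max ρ ρ' with hΔ
  have hρ0 : 0 < ρ := by rw [S.r_eq]; positivity
  have hρ0' : 0 < ρ' := by rw [S'.r_eq]; positivity
  have hN0 : 0 < N := by rw [S.N_eq]; positivity
  have hN0' : 0 < N' := by rw [S'.N_eq]; positivity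
  have h1 : ∀ r ∈ F, _ := fun r hr => off_diag r N N' Δ ρ ρ' hρ0.le hρ0'.le (5 * N * T) (5 * N' * T)
    (fun c => kH K (th a b r c)) (fun c => kH K' (th a b r c)) (fun c => kH_nonneg _ _)
    (fun c => kH_nonneg _ _) (fun c hc => vD_bounds hT hN0 hr hc) (fun c hc => vD_bounds hT hN0' hr hc) (by
      have x1 : 5 * N * T = η * Real.exp l := by rw [S.N_eq]; field_simp
      have x2 : 5 * N' * T = η * Real.exp l' := by rw [S'.N_eq]; field_simp
      rw [x1, x2, hΔ, Real.exp_add]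
      have : ρ + ρ' ≤ 2 * max ρ ρ' := by linarith [le_max_left ρ ρ', le_max_right ρ ρ']
      calc η * Real.exp l * (η * Real.exp l') * (ρ + ρ') ≤
          η * Real.exp l * (η * Real.exp l') * (2 * max ρ ρ') := by gcongr
        _ = _ := by ring)
  refine (Finset.sum_le_sum h1).trans ?_
  rw [Finset.sum_add_distrib, ← Finset.mul_sum, ← Finset.mul_sum]
  refine add_le_add (S_off S S' hη0 hη1 hT hE a b F hEQp hl1 hl2) ?_
  split_ifs with hl
  · exact S_diag S S' hη0 hT hE a b F hEQ hl
  · refine le_of_eq ?_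
    have : ∀ r ∈ F, ∑ c ∈ ratSet 1 2 N, (if c ∈ ratSet 1 2 N' then
      kH K (th a b r c) * kH K' (th a b r c) else 0) = 0 := by
      intro r _
      refine Finset.sum_eq_zero fun c hc => ?_
      rw [if_neg]
      intro hc'
      have p1 := mem_ratSet.mp hc
      have p2 := mem_ratSet.mp hc'
      rcases hl3 with h | h | h
      · exact hl h
      · have := disj_aux hη0 hT S.N_eq S'.N_eq h
        linarith [p1.2.2.2, p2.2.2.1]
      · have := disj_aux hη0 hT S'.N_eq S.N_eq h
        linarith [p1.2.2.1, p2.2.2.2]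
    rw [Finset.sum_eq_zero this, mul_zero]

theorem card_overlap (lo hi T y : ℝ) (hT : 0 < T) (U : Finset ℚ) (hU : U ⊆ ratSet lo hi T)
    (h : ∀ r ∈ U, (r:ℝ) ≤ y ∧ y ≤ r + 64 / T ^ 2) : (U.card : ℝ) ≤ 65 := by
  have := rat_card_upper U (y - 64 / T ^ 2) y T hT (by have : 0 < 64 / T ^ 2 := by positivity
                                                       linarith) (by
    intro r hr
    refine ⟨by linarith [(h r hr).2], (h r hr).1, (mem_ratSet.mp (hU hr)).2.2.2⟩)
  refine this.trans (le_of_eq ?_)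
  field_simp
  norm_num

/-- block estimate over an abstract family of scales -/
theorem block {E η T : ℝ} {τ n : ℕ} (t l N ρ σ : ℕ × ℕ → ℝ) (K : ℕ × ℕ → ℕ)
    (hS : ∀ p ∈ Finset.range n ×ˢ Finset.range n,
      SC E η T τ (t p) (l p) (N p) (ρ p) (σ p) (K p))
    (hρ : ∀ p ∈ Finset.range n ×ˢ Finset.range n, ρ p ≤ 1 / (160 * T ^ 2))
    (hC : ∀ p ∈ Finset.range n ×ˢ Finset.range n, N p ^ 2 / 32 ≤ (ratSet 1 2 (N p)).card)
    (hη0 : 0 < η) (hη1 : η ≤ 1 / 2) (hT : 0 < T) (hE : 100 ≤ E) (hn : 0 < n)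
    (a b lo hi : ℝ) (hEQ : EQs a b (ratSet lo hi T) E τ) (hEQp : EQp a b (ratSet lo hi T) E τ)
    (hF : 0 < ((ratSet lo hi T).card : ℝ))
    (hl1 : ∀ p ∈ Finset.range n ×ˢ Finset.range n, ∀ p' ∈ Finset.range n ×ˢ Finset.range n,
      Real.exp (l p' - l p + t p) ≤ E ^ 5)
    (hl3 : ∀ p p' : ℕ × ℕ, (l p = l p' ∧ p.2 = p'.2) ∨ (l p + 3 ≤ l p' ∧ p.2 ≠ p'.2) ∨
      (l p' + 3 ≤ l p ∧ p.2 ≠ p'.2))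
    (ht : ∀ p p' : ℕ × ℕ, t p - t p' = (p.1:ℝ) - p'.1)
    (ω : ℝ) (hω : ω = (n:ℝ) ^ 2 * η ^ 3) :
    (ratSet lo hi T).card / T ^ 2 * (ω / (10 ^ 11 * (ω + 1))) ≤
      volume.real {y | ∃ r ∈ ratSet lo hi T, ∃ p ∈ Finset.range n ×ˢ Finset.range n,
        ∃ c ∈ ratSet 1 2 (N p), 0 < kG (K p) (σ p) (th a b r c) ∧
          y ∈ Metric.closedBall (ctr r c) (ρ p)} := by
  classical
  set F := ratSet lo hi T with hFdef
  set Λ := Finset.range n ×ˢ Finset.range n with hΛ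
  have hn' : (0:ℝ) < n := by exact_mod_cast hn
  have hω0 : 0 < ω := by rw [hω]; positivity
  have hσ0 : ∀ p ∈ Λ, 0 < σ p := fun p hp => by rw [(hS p hp).s_eq]; positivity
  have hρ0 : ∀ p ∈ Λ, 0 < ρ p := fun p hp => by rw [(hS p hp).r_eq]; positivity
  have hN0 : ∀ p ∈ Λ, 0 < N p := fun p hp => by rw [(hS p hp).N_eq]; positivity
  set Q : Finset (Σ _ : ℕ × ℕ, ℚ) := Λ.sigma (fun p => ratSet 1 2 (N p)) with hQ
  have hQm : ∀ q ∈ Q, q.1 ∈ Λ ∧ q.2 ∈ ratSet 1 2 (N q.1) := fun q hq => Finset.mem_sigma.mp hq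
  set A : ℝ := (F.card : ℝ) with hA
  have e1 : ∀ l t : ℝ, Real.exp (-2 * l + t) = Real.exp t / Real.exp l ^ 2 := by
    intro l t
    rw [← Real.exp_nat_mul, ← Real.exp_sub]; congr 1; push_cast; ring
  -- first moment
  have first : A * ω / (16000 * T ^ 2) ≤ ∑ i ∈ F ×ˢ Q,
      kG (K i.2.1) (σ i.2.1) (th a b i.1 i.2.2) * (2 * ρ i.2.1) := by
    rw [Finset.sum_product_right, hQ, Finset.sum_sigma]
    have : ∀ p ∈ Λ, A * η ^ 3 / (16000 * T ^ 2) ≤ ∑ c ∈ ratSet 1 2 (N p), ∑ r ∈ F,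
        kG (K p) (σ p) (th a b r c) * (2 * ρ p) := by
      intro p hp
      have S := hS p hp
      have := first_mom a b F E τ hEQ hE (N p) S.N1 S.N2 (hC p hp) (σ p) (hσ0 p hp) S.s1 (K p)
        S.K1 S.K2 S.K3
      rw [Finset.sum_comm]
      simp_rw [← Finset.sum_mul]
      calc A * η ^ 3 / (16000 * T ^ 2) = A * N p ^ 2 * σ p / 640 * (2 * ρ p) := by
            rw [S.N_eq, S.s_eq, S.r_eq, e1, Real.exp_neg]
            field_simp
            norm_num
        _ ≤ _ := by
            have := (hρ0 p hp).le
            gcongr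
    refine le_trans (le_of_eq ?_) (Finset.sum_le_sum this)
    rw [Finset.sum_const, hΛ, Finset.card_product, Finset.card_range, hω, nsmul_eq_mul]
    push_cast; ring
  -- second moment
  have second : ∫ y, (∑ i ∈ F ×ˢ Q, kH (K i.2.1) (th a b i.1 i.2.2) *
      bI (ctr i.1 i.2.2) (ρ i.2.1) y) ^ 2 ≤ 195 * A / T ^ 2 * (ω ^ 2 + ω) := by
    have h := overlap_sq F Q 65 (fun r q => kH (K q.1) (th a b r q.2)) (fun r q => ctr r q.2)
      (fun r q => ρ q.1) (by
        intro y
        apply card_overlap lo hi T y hT _ (Finset.filter_subset _ _)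
        intro r hr
        obtain ⟨hr, q, hq, hy⟩ := Finset.mem_filter.mp hr
        obtain ⟨hq1, hq2⟩ := hQm q hq
        exact ball_loc hT (hN0 _ hq1) hr hq2 (hρ _ hq1) hy)
    refine h.trans ?_
    have hsum : ∑ r ∈ F, ∑ q ∈ Q, ∑ q' ∈ Q, kH (K q.1) (th a b r q.2) * kH (K q'.1) (th a b r q'.2) *
        volume.real (Metric.closedBall (ctr r q.2) (ρ q.1) ∩ Metric.closedBall (ctr r q'.2) (ρ q'.1)) =
        ∑ p ∈ Λ, ∑ p' ∈ Λ, ∑ r ∈ F, ∑ c ∈ ratSet 1 2 (N p), ∑ c' ∈ ratSet 1 2 (N p'),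
          kH (K p) (th a b r c) * kH (K p') (th a b r c') *
          volume.real (Metric.closedBall (ctr r c) (ρ p) ∩ Metric.closedBall (ctr r c') (ρ p')) := by
      simp_rw [hQ, Finset.sum_sigma]
      rw [Finset.sum_comm]
      refine Finset.sum_congr rfl fun p _ => ?_
      rw [Finset.sum_comm]
      rw [Finset.sum_comm (s := Λ)]
      rw [Finset.sum_comm]
      refine Finset.sum_congr rfl fun r _ => ?_
      rw [Finset.sum_comm]
    rw [hsum]
    have hb : ∀ p ∈ Λ, ∀ p' ∈ Λ, _ := fun p hp p' hp' =>
      S_bound (hS p hp) (hS p' hp') hη0 hη1 hT hE a b lo hi hEQ hEQp (hl1 p hp p' hp')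
        (hl1 p' hp' p hp) (by rcases hl3 p p' with h | h | h <;> tauto)
    have hd : ∀ p ∈ Λ, ∑ p' ∈ Λ, (if l p = l p' then A * η ^ 3 / T ^ 2 * Real.exp (-|t p - t p'|) else 0)
        ≤ A * η ^ 3 / T ^ 2 * 3 := by
      intro p hp
      have hp2 := (Finset.mem_product.mp hp).2
      have c1 : ∀ p' : ℕ × ℕ, (if l p = l p' then A * η ^ 3 / T ^ 2 * Real.exp (-|t p - t p'|) else 0)
          = if p.2 = p'.2 then A * η ^ 3 / T ^ 2 * Real.exp (-|(p.1:ℝ) - p'.1|) else 0 := by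
        intro p'
        rw [ht]
        rcases hl3 p p' with h | h | h
        · rw [if_pos h.1, if_pos h.2]
        · rw [if_neg (by linarith), if_neg h.2]
        · rw [if_neg (by linarith), if_neg h.2]
      simp_rw [c1]
      rw [hΛ, Finset.sum_product]
      simp only [Finset.sum_ite_eq, hp2, if_true]
      rw [← Finset.mul_sum]
      gcongr
      exact geo_sum n p.1
    have hc : (Λ.card : ℝ) = (n:ℝ) ^ 2 := by
      rw [hΛ, Finset.card_product, Finset.card_range]; push_cast; ring
    calc _ ≤ 65 * ∑ p ∈ Λ, ∑ p' ∈ Λ, (3 * A * η ^ 6 / T ^ 2 +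
        if l p = l p' then A * η ^ 3 / T ^ 2 * Real.exp (-|t p - t p'|) else 0) := by
          gcongr with p hp p' hp'
          exact hb p hp p' hp'
      _ ≤ 65 * ∑ p ∈ Λ, ((n:ℝ) ^ 2 * (3 * A * η ^ 6 / T ^ 2) + A * η ^ 3 / T ^ 2 * 3) := by
          gcongr with p hp
          rw [Finset.sum_add_distrib, Finset.sum_const, nsmul_eq_mul, hc]
          gcongr
          exact hd p hp
      _ = _ := by
          rw [Finset.sum_const, nsmul_eq_mul, hc, hω]; ring
  have hpz := PZ (F ×ˢ Q) (fun i => kG (K i.2.1) (σ i.2.1) (th a b i.1 i.2.2))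
    (fun i => kH (K i.2.1) (th a b i.1 i.2.2)) (fun i => ctr i.1 i.2.2) (fun i => ρ i.2.1)
    (fun i hi => (hρ0 _ (hQm _ (Finset.mem_product.mp hi).2).1).le)
    (fun i hi => kH_nonneg _ _)
    (fun i hi => kG_le _ _ _ (hσ0 _ (hQm _ (Finset.mem_product.mp hi).2).1)
      (hS _ (hQm _ (Finset.mem_product.mp hi).2).1).s1)
    (A * ω / (16000 * T ^ 2)) _ (by positivity) first second
  have hset : {y | ∃ i ∈ F ×ˢ Q, 0 < kG (K i.2.1) (σ i.2.1) (th a b i.1 i.2.2) ∧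
      y ∈ Metric.closedBall (ctr i.1 i.2.2) (ρ i.2.1)} =
      {y | ∃ r ∈ F, ∃ p ∈ Λ, ∃ c ∈ ratSet 1 2 (N p), 0 < kG (K p) (σ p) (th a b r c) ∧
          y ∈ Metric.closedBall (ctr r c) (ρ p)} := by
    ext y
    constructor
    · rintro ⟨⟨r, ⟨p, c⟩⟩, hi, h⟩
      obtain ⟨h1, h2⟩ := Finset.mem_product.mp hi
      obtain ⟨h3, h4⟩ := hQm _ h2
      exact ⟨r, h1, p, h3, c, h4, h⟩
    · rintro ⟨r, h1, p, h3, c, h4, h⟩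
      exact ⟨⟨r, ⟨p, c⟩⟩, Finset.mem_product.mpr ⟨h1, Finset.mem_sigma.mpr ⟨h3, h4⟩⟩, h⟩
  rw [hset] at hpz
  refine le_trans ?_ hpz
  have : (A * ω / (16000 * T ^ 2)) ^ 2 / (195 * A / T ^ 2 * (ω ^ 2 + ω)) =
      A / T ^ 2 * (ω / (16000 ^ 2 * 195 * (ω + 1))) := by
    field_simp
  rw [this]
  gcongr
  norm_num

def tS (n : ℕ) (p : ℕ × ℕ) : ℕ := n + p.1
def lS (C n : ℕ) (p : ℕ × ℕ) : ℕ := C * n + 3 * p.2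

theorem SC_holds (n : ℕ) (E η T : ℝ) (τ : ℕ) (hE : E = Real.exp n) (hE2 : 100 ≤ E) (hT : T = E ^ 80)
    (hτ : 170 ≤ τ) (hη1 : 5 / E ≤ η) (hη2 : η ≤ 1 / 2) (p : ℕ × ℕ)
    (hp : p ∈ Finset.range n ×ˢ Finset.range n) :
    SC E η T τ (tS n p) (lS (80 + τ) n p) (η * Real.exp (lS (80 + τ) n p) / (5 * T))
      (Real.exp (-2 * (lS (80 + τ) n p) + tS n p)) (η * Real.exp (-(tS n p)) / 2)
      ⌈2 / (η * Real.exp (-(tS n p)) / 2)⌉₊ ∧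
    Real.exp (-2 * (lS (80 + τ) n p) + tS n p) ≤ 1 / (160 * T ^ 2) := by
  obtain ⟨h1, h2⟩ := Finset.mem_product.mp hp
  rw [Finset.mem_range] at h1 h2
  have hE0 : 0 < E := by linarith
  have hη0 : 0 < η := lt_of_lt_of_le (by positivity) hη1
  have hT0 : 0 < T := by rw [hT]; positivity
  have hpow : ∀ k : ℕ, E ^ k = Real.exp ((k * n : ℕ)) := by
    intro k; rw [hE, ← Real.exp_nat_mul]; push_cast; rfl
  have ht2 : Real.exp (tS n p) ≤ E ^ 2 := by
    rw [hpow]; gcongr; unfold tS; omega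
  have hl1 : E ^ (80 + τ) ≤ Real.exp (lS (80 + τ) n p) := by
    rw [hpow]; gcongr; unfold lS; omega
  have hl2 : Real.exp (lS (80 + τ) n p) ≤ E ^ (80 + τ + 3) := by
    rw [hpow]; gcongr; unfold lS
    rw [add_mul (80 + τ) 3 n]; omega
  set l : ℝ := (lS (80 + τ) n p : ℝ) with hl
  set t : ℝ := (tS n p : ℝ) with ht
  set σ := η * Real.exp (-t) / 2 with hσ
  have hσ0 : 0 < σ := by positivity
  have hK2 : (⌈2 / σ⌉₊ : ℝ) ≤ 2 / σ + 1 := (Nat.ceil_lt_add_one (by positivity)).le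
  refine ⟨⟨rfl, rfl, rfl, ?_, ?_, ?_, Nat.le_ceil _, hK2, ?_⟩, ?_⟩
  · rw [le_div_iff₀ (by positivity), hT]
    have e : E ^ (80 + τ) = E ^ (τ - 1) * E ^ 80 * E := by
      rw [← pow_add, ← pow_succ]; congr 1; omega
    have : 5 ≤ η * E := by rwa [div_le_iff₀ hE0] at hη1
    calc E ^ (τ - 1) * (5 * E ^ 80) = 5 * (E ^ (τ - 1) * E ^ 80) := by ring
      _ ≤ (η * E) * (E ^ (τ - 1) * E ^ 80) := by gcongr
      _ = η * E ^ (80 + τ) := by rw [e]; ring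
      _ ≤ _ := by gcongr
  · rw [div_le_iff₀ (by positivity), hT]
    calc η * Real.exp l ≤ 5 * E ^ (80 + τ + 3) := by gcongr; linarith
      _ = _ := by ring
  · have : Real.exp (-t) ≤ 1 := Real.exp_le_one_iff.mpr (by rw [ht]; simp)
    rw [hσ]
    have : η * Real.exp (-t) ≤ 1 / 2 * 1 := by gcongr
    linarith
  · refine hK2.trans ?_
    have e : 2 / σ = 4 * Real.exp t / η := by
      rw [hσ, Real.exp_neg]; field_simp; norm_num
    have : 2 / σ ≤ 4 * E ^ 2 / (5 / E) := by rw [e]; gcongr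
    have e2 : 4 * E ^ 2 / (5 / E) = 4 / 5 * E ^ 3 := by field_simp
    have : E ≤ E ^ 3 := le_self_pow₀ (by linarith) (by norm_num)
    linarith
  · rw [hT, ← pow_mul, le_div_iff₀ (by positivity)]
    have : 160 ≤ E ^ 2 := by nlinarith
    calc Real.exp (-2 * l + t) * (160 * E ^ (80 * 2)) ≤ Real.exp (-2 * l + t) * (E ^ 2 * E ^ (80 * 2)) := by gcongr
      _ = Real.exp (-2 * l + t) * E ^ 162 := by ring
      _ = Real.exp (-2 * l + t + (162 * n : ℕ)) := by rw [hpow, ← Real.exp_add]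
      _ ≤ 1 := by
        apply Real.exp_le_one_iff.mpr
        have : tS n p + 162 * n ≤ 2 * lS (80 + τ) n p := by
          unfold tS lS
          have : 250 * n ≤ (80 + τ) * n := Nat.mul_le_mul_right _ (by omega)
          omega
        have : (t:ℝ) + (162 * n : ℕ) ≤ 2 * l := by rw [ht, hl]; exact_mod_cast this
        linarith

/-- the good set at stage n -/
def Gd (a b ε : ℝ) (C n : ℕ) : Set ℝ := {x | ∃ q : ℕ × ℕ, n ≤ q.1 + q.2 ∧ 0 < q.1 ∧ 0 < q.2 ∧
  1 / ((C:ℝ) + 3) * q.2 ≤ q.1 ∧ (q.1:ℝ) ≤ 2 / ((C:ℝ) - 2) * q.2 ∧ memB a b ε q.1 q.2 x}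

theorem good_of (a b ε : ℝ) (n : ℕ) (E η T lo mid hi : ℝ) (τ : ℕ) (hE : E = Real.exp n)
    (hE2 : 100 ≤ E) (hT : T = E ^ 80) (hn : 0 < n) (hε : 0 < ε)
    (hτ : 170 ≤ τ) (hη0 : 0 < η)
    (hη : η = ε * ((((80 + τ : ℕ):ℝ) + 3) * n) ^ (-(2/3) : ℝ))
    (ha : 2 * |a| ≤ E) (hmid : mid + 64 / T ^ 2 ≤ hi) (hη1 : η ≤ 1 / 2)
    (p : ℕ × ℕ)
    (hp : p ∈ Finset.range n ×ˢ Finset.range n) (r c : ℚ) (hr : r ∈ ratSet lo mid T)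
    (hc : c ∈ ratSet 1 2 (η * Real.exp (lS (80 + τ) n p) / (5 * T)))
    (K : ℕ) (hG : 0 < kG K (η * Real.exp (-(tS n p)) / 2) (th a b r c)) (y : ℝ)
    (hy : y ∈ Metric.closedBall (ctr r c) (Real.exp (-2 * (lS (80 + τ) n p) + tS n p)))
    (hρ : Real.exp (-2 * (lS (80 + τ) n p) + tS n p) ≤ 1 / (160 * T ^ 2)) :
    y ∈ Gd a b ε (80 + τ) n ∩ Set.Icc lo hi := by
  have hE0 : 0 < E := by linarith
  have hT0 : 0 < T := by rw [hT]; positivity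
  have hN0 : 0 < η * Real.exp (lS (80 + τ) n p) / (5 * T) := by positivity
  obtain ⟨h1, h2⟩ := Finset.mem_product.mp hp
  rw [Finset.mem_range] at h1 h2
  have hloc := ball_loc hT0 hN0 hr hc hρ hy
  have hr' := mem_ratSet.mp hr
  refine ⟨?_, by linarith [hr'.1], by linarith [hr'.2.1]⟩
  set C := 80 + τ with hC
  have hCn : 250 * n ≤ C * n := Nat.mul_le_mul_right _ (by omega)
  have hst : tS n p ≤ lS C n p := by unfold tS lS; omega
  set s := lS C n p - tS n p with hs
  have hsl : (s:ℝ) = (lS C n p : ℝ) - tS n p := by rw [hs]; push_cast [hst]; ring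
  have hls : (tS n p : ℝ) + s = lS C n p := by rw [hsl]; ring
  obtain ⟨hv0, hv1⟩ := vD_bounds hT0 hN0 hr hc
  have hC3 : (0:ℝ) < (C:ℝ) + 3 := by positivity
  have hC250 : (250:ℝ) ≤ C := by exact_mod_cast (by omega : 250 ≤ C)
  have ht1 : (n:ℝ) ≤ tS n p := by exact_mod_cast (by unfold tS; omega : n ≤ tS n p)
  have ht2 : (tS n p:ℝ) ≤ 2 * n := by exact_mod_cast (by unfold tS; omega : tS n p ≤ 2 * n)
  have hl1 : (C:ℝ) * n ≤ lS C n p := by exact_mod_cast (by unfold lS; omega : C * n ≤ lS C n p)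
  have hl2 : (lS C n p:ℝ) ≤ ((C:ℝ) + 3) * n := by
    have : lS C n p ≤ (C + 3) * n := by unfold lS; rw [add_mul C 3 n]; omega
    exact_mod_cast this
  have hn' : (0:ℝ) < n := by exact_mod_cast hn
  have hl0 : (0:ℝ) < lS C n p := lt_of_lt_of_le (by positivity) hl1
  refine ⟨(tS n p, s), ?_, ?_, ?_, ?_, ?_, ?_⟩
  · show n ≤ tS n p + s
    unfold tS; omega
  · show 0 < tS n p
    unfold tS; omega
  · show 0 < s
    rw [hs]; unfold tS lS; omega
  · show 1 / ((C:ℝ) + 3) * s ≤ tS n p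
    rw [div_mul_eq_mul_div, one_mul, div_le_iff₀ hC3]
    nlinarith
  · show (tS n p:ℝ) ≤ 2 / ((C:ℝ) - 2) * s
    rw [div_mul_eq_mul_div, le_div_iff₀ (by linarith)]
    nlinarith
  · show memB a b ε (tS n p) s y
    have hσ1 : η * Real.exp (-(tS n p:ℝ)) / 2 ≤ 1 / 4 := by
      have : Real.exp (-(tS n p:ℝ)) ≤ 1 := Real.exp_le_one_iff.mpr (by simp)
      have : η * Real.exp (-(tS n p:ℝ)) ≤ 1 / 2 * 1 := by gcongr
      linarith
    obtain ⟨m, hm⟩ := kG_pos K _ _ (by positivity) hσ1 hG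
    rw [th_eq] at hm
    apply memB_of a b ε (tS n p) s η y (vN r c) (vD r c) m (by exact_mod_cast hv0) _ hη0 _ _ hm
    · have : Real.exp ((tS n p:ℝ) - s) ≤ Real.exp (-(n:ℝ)) := by
        gcongr
        rw [hsl]
        nlinarith
      calc |a| * Real.exp ((tS n p:ℝ) - s) ≤ (E / 2) * Real.exp (-(n:ℝ)) := by
            gcongr; linarith
        _ = 1 / 2 := by rw [hE, Real.exp_neg]; field_simp
    · rw [hη, add_comm (s:ℝ), hls]
      gcongr ε * ?_
      exact Real.rpow_le_rpow_of_nonpos hl0 hl2 (by norm_num)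
    · rw [hls]
      refine hv1.trans (le_of_eq ?_)
      field_simp
    · rw [hls]
      simpa [Real.dist_eq, ctr] using hy

theorem eta_cube (ε C n : ℝ) (hC : 0 < C) (hn : 0 < n) :
    n ^ 2 * (ε * (C * n) ^ (-(2/3) : ℝ)) ^ 3 = ε ^ 3 / C ^ 2 := by
  have h : 0 < C * n := by positivity
  have : ((C * n) ^ (-(2/3) : ℝ)) ^ 3 = ((C * n) ^ 2)⁻¹ := by
    rw [← Real.rpow_natCast, ← Real.rpow_mul h.le, ← Real.rpow_natCast, ← Real.rpow_neg h.le]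
    norm_num
  rw [mul_pow, this]
  field_simp

set_option maxHeartbeats 2000000 in
theorem block_final (a b : ℝ) (hab : IsDiophantine a b) (ε : ℝ) (hε : 0 < ε) :
    ∃ (C : ℕ) (c : ℝ), 250 ≤ C ∧ 0 < c ∧ ∀ lo hi : ℝ, lo < hi → ∀ᶠ n : ℕ in Filter.atTop,
      c * (hi - lo) ≤ volume.real (Gd a b ε C n ∩ Set.Icc lo hi) := by
  obtain ⟨κ, s0, hs0, hdio⟩ := dio_int a b hab
  obtain ⟨τ, hτ⟩ : ∃ τ : ℕ, τ = 163 * κ + 170 := ⟨_, rfl⟩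
  obtain ⟨C, hC⟩ : ∃ C : ℕ, C = 80 + τ := ⟨_, rfl⟩
  obtain ⟨ω, hω⟩ : ∃ ω : ℝ, ω = ε ^ 3 / ((C:ℝ) + 3) ^ 2 := ⟨_, rfl⟩
  have hω0 : 0 < ω := by rw [hω]; positivity
  refine ⟨C, ω / (64 * 10 ^ 11 * (ω + 1)), by omega, by positivity, ?_⟩
  intro lo hi hlh
  obtain ⟨mid, hmid⟩ : ∃ mid, mid = (lo + hi) / 2 := ⟨_, rfl⟩
  have hlm : lo < mid := by rw [hmid]; linarith
  obtain ⟨T0, hT0⟩ := ratSet_card_lower lo mid hlm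
  obtain ⟨T1, hT1⟩ := ratSet_card_lower 1 2 (by norm_num)
  have ev : ∀ x : ℝ, ∀ᶠ n : ℕ in Filter.atTop, x ≤ (n:ℝ) := fun x =>
    tendsto_natCast_atTop_atTop.eventually_ge_atTop x
  have hη2 : ∀ᶠ n : ℕ in Filter.atTop, ε * (((C:ℝ) + 3) * n) ^ (-(2/3) : ℝ) ≤ 1 / 2 := by
    have h1 : Filter.Tendsto (fun n : ℕ => ((C:ℝ) + 3) * (n:ℝ)) Filter.atTop Filter.atTop :=
      Filter.Tendsto.const_mul_atTop (by positivity) tendsto_natCast_atTop_atTop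
    have h2 := ((tendsto_rpow_neg_atTop (by norm_num : (0:ℝ) < 2/3)).comp h1).const_mul ε
    rw [mul_zero] at h2
    exact (h2.eventually (eventually_le_nhds (by norm_num : (0:ℝ) < 1/2)))
  filter_upwards [hη2, ev 100, ev (1 / s0), ev (τ + 8), ev T0, ev T1, ev (32 / (mid - lo)),
    ev (2 * (|lo| + |mid|)), ev 2, ev (2 * |a|), ev (64 / (hi - mid)), ev (10 * ((C:ℝ) + 3) / ε)]
    with n hη1 n1 n2 n3 n4 n5 n6 n7 n8 n9 n10 n11
  obtain ⟨E, hE⟩ : ∃ E, E = Real.exp (n:ℝ) := ⟨_, rfl⟩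
  obtain ⟨T, hT⟩ : ∃ T, T = E ^ 80 := ⟨_, rfl⟩
  have hnE : (n:ℝ) + 1 ≤ E := by rw [hE]; exact Real.add_one_le_exp _
  have hn0 : (0:ℝ) < n := by linarith
  have hn : 0 < n := by exact_mod_cast hn0
  have hE2 : 100 ≤ E := by linarith
  have hE0 : 0 < E := by linarith
  have hE1 : 1 ≤ E := by linarith
  have hET : E ≤ T := by rw [hT]; exact le_self_pow₀ hE1 (by norm_num)
  have hTT : T ≤ T ^ 2 := le_self_pow₀ (by linarith) (by norm_num)
  have hTp : 0 < T := by linarith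
  obtain ⟨η, hη⟩ : ∃ η, η = ε * (((C:ℝ) + 3) * n) ^ (-(2/3) : ℝ) := ⟨_, rfl⟩
  rw [← hη] at hη1
  have hη0 : 0 < η := by rw [hη]; positivity
  have hη5 : 5 / E ≤ η := by
    have q := Real.quadratic_le_exp_of_nonneg hn0.le
    rw [← hE] at q
    rw [hη]
    have p1 : 1 ≤ ((C:ℝ) + 3) * n := by
      have : (0:ℝ) ≤ C := by positivity
      nlinarith
    have p2 : (((C:ℝ) + 3) * n) ^ (-1 : ℝ) ≤ (((C:ℝ) + 3) * n) ^ (-(2/3) : ℝ) :=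
      Real.rpow_le_rpow_of_exponent_le p1 (by norm_num)
    rw [Real.rpow_neg_one] at p2
    refine le_trans ?_ (mul_le_mul_of_nonneg_left p2 hε.le)
    rw [← div_eq_mul_inv, div_le_div_iff₀ hE0 (by positivity)]
    rw [div_le_iff₀ hε] at n11
    have : 10 * ((C:ℝ) + 3) * n ≤ n * ε * n := by gcongr
    have : ε * (n ^ 2 / 2) ≤ ε * E := by gcongr; linarith
    linarith
  have hcard : (mid - lo) * T ^ 2 / 32 ≤ (ratSet lo mid T).card := hT0 T (by linarith)
  have hml : 0 < mid - lo := by linarith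
  obtain ⟨hEQ, hEQp⟩ := EQ_holds a b κ s0 hs0 hdio E hE2 (by linarith) τ hτ (by
      rw [hE, Real.log_exp, ← hE]
      have : (τ:ℝ) + 8 ≤ E := by linarith
      have : ((τ:ℝ) + 8) * (n + 1) ≤ E * E := by gcongr
      have : (0:ℝ) ≤ τ := by positivity
      nlinarith)
    (ratSet lo mid T) (by
      intro r hr
      obtain ⟨r1, r2, r3, r4⟩ := mem_ratSet.mp hr
      have e81 : E ^ 81 / 2 = E / 2 * T := by rw [hT]; ring
      rw [e81]
      constructor
      · have er : (r.num:ℝ) = r * r.den := by exact_mod_cast (Rat.mul_den_eq_num r).symm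
        rw [er, abs_mul, abs_of_nonneg (by positivity : (0:ℝ) ≤ r.den)]
        have : |(r:ℝ)| ≤ E / 2 := by
          have : |(r:ℝ)| ≤ |lo| + |mid| := by
            rw [abs_le]
            constructor
            · linarith [neg_abs_le lo, abs_nonneg mid]
            · linarith [le_abs_self mid, abs_nonneg lo]
          linarith
        gcongr
      · calc (r.den:ℝ) ≤ 1 * T := by linarith
          _ ≤ E / 2 * T := by gcongr; linarith) (by
      refine le_trans ?_ hcard
      have : 32 ≤ E * (mid - lo) := by
        rw [← div_le_iff₀ hml]; linarith
      have e160 : T ^ 2 = E ^ 159 * E := by rw [hT]; ring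
      rw [e160]
      have : 0 < E ^ 159 := by positivity
      nlinarith)
  have hSC := fun p hp => SC_holds n E η T τ hE hE2 hT (by omega) hη5 hη1 p hp
  have main := block (fun p => (tS n p : ℝ)) (fun p => (lS (80 + τ) n p : ℝ))
    (fun p => η * Real.exp (lS (80 + τ) n p) / (5 * T))
    (fun p => Real.exp (-2 * (lS (80 + τ) n p) + tS n p)) (fun p => η * Real.exp (-(tS n p)) / 2)
    (fun p => ⌈2 / (η * Real.exp (-(tS n p)) / 2)⌉₊)
    (fun p hp => (hSC p hp).1) (fun p hp => (hSC p hp).2)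
    (by
      intro p hp
      have hN1 := (hSC p hp).1.N1
      have : E ≤ E ^ (τ - 1) := le_self_pow₀ hE1 (by omega)
      have := hT1 _ (by linarith : T1 ≤ η * Real.exp (lS (80 + τ) n p) / (5 * T))
      refine le_trans (le_of_eq ?_) this
      ring)
    hη0 hη1 hTp hE2 hn a b lo mid hEQ hEQp (lt_of_lt_of_le (by positivity) hcard)
    (by
      intro p hp p' hp'
      obtain ⟨h1, h2⟩ := Finset.mem_product.mp hp
      obtain ⟨h1', h2'⟩ := Finset.mem_product.mp hp'
      rw [Finset.mem_range] at h1 h2 h1' h2'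
      rw [hE, ← Real.exp_nat_mul]
      gcongr
      have : lS (80 + τ) n p' + tS n p ≤ 5 * n + lS (80 + τ) n p := by unfold lS tS; omega
      have : (lS (80 + τ) n p' : ℝ) + tS n p ≤ 5 * n + lS (80 + τ) n p := by exact_mod_cast this
      push_cast
      linarith)
    (by
      intro p p'
      simp only [lS]
      push_cast
      rcases lt_trichotomy p.2 p'.2 with h | h | h
      · right; left
        have : (p.2:ℝ) + 1 ≤ p'.2 := by exact_mod_cast h
        exact ⟨by linarith, h.ne⟩
      · left; rw [h]; exact ⟨rfl, rfl⟩
      · right; right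
        have : (p'.2:ℝ) + 1 ≤ p.2 := by exact_mod_cast h
        exact ⟨by linarith, h.ne'⟩)
    (by intro p p'; simp only [tS]; push_cast; ring)
    ω (by rw [hη, hω]; exact (eta_cube ε _ n (by positivity) hn0).symm)
  have hfin : volume (Gd a b ε C n ∩ Set.Icc lo hi) ≠ ⊤ :=
    ((measure_mono Set.inter_subset_right).trans_lt measure_Icc_lt_top).ne
  have hhm : 0 < hi - mid := by rw [hmid]; linarith
  have h64 : 64 / T ^ 2 ≤ hi - mid := by
    have : 64 / (hi - mid) ≤ T ^ 2 := by linarith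
    rw [div_le_iff₀ hhm] at this
    rw [div_le_iff₀ (by positivity)]; linarith
  refine le_trans ?_ (main.trans (measureReal_mono ?_ hfin))
  swap
  · rintro y ⟨r, hr, p, hp, c, hc, hG, hy⟩
    rw [hC]
    exact good_of a b ε n E η T lo mid hi τ hE hE2 hT hn hε (by omega) hη0 (by rw [hη, hC]) (by linarith)
      (by linarith) hη1 p hp r c hr hc _ hG y hy (hSC p hp).2
  calc ω / (64 * 10 ^ 11 * (ω + 1)) * (hi - lo) = (mid - lo) * T ^ 2 / 32 / T ^ 2 * (ω / (10 ^ 11 * (ω + 1))) := by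
        rw [hmid]; field_simp; ring
    _ ≤ _ := by gcongr

theorem memB_meas (a b ε t s : ℝ) : MeasurableSet {x | memB a b ε t s x} := by
  have : {x | memB a b ε t s x} = ⋃ v : {v : Fin 3 → ℤ // v ≠ 0},
      {x | ‖(aM t s * uM (a * x + b) x).mulVec fun i => ((v.1 i : ℝ))‖ ≤ ε * (s + t) ^ (-(2 / 3) : ℝ)} := by
    ext x; simp [memB]
  rw [this]
  refine MeasurableSet.iUnion fun v => ?_
  apply IsClosed.measurableSet
  refine isClosed_le ?_ continuous_const
  apply Continuous.norm
  refine Continuous.matrix_mulVec (Continuous.matrix_mul continuous_const ?_) continuous_const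
  refine continuous_matrix fun i j => ?_
  fin_cases i <;> fin_cases j <;> simp [uM] <;> fun_prop

theorem Gd_meas (a b ε : ℝ) (C n : ℕ) : MeasurableSet (Gd a b ε C n) := by
  have : Gd a b ε C n = ⋃ q : {q : ℕ × ℕ // n ≤ q.1 + q.2 ∧ 0 < q.1 ∧ 0 < q.2 ∧
      1 / ((C:ℝ) + 3) * q.2 ≤ q.1 ∧ (q.1:ℝ) ≤ 2 / ((C:ℝ) - 2) * q.2},
      {x | memB a b ε q.1.1 q.1.2 x} := by
    ext x; simp [Gd, and_assoc]
  rw [this]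
  exact MeasurableSet.iUnion fun q => memB_meas _ _ _ _ _

theorem Gd_anti (a b ε : ℝ) (C : ℕ) : Antitone (Gd a b ε C) := by
  rintro m n hmn x ⟨q, h1, h2⟩
  exact ⟨q, hmn.trans h1, h2⟩

theorem null_of_density (D : Set ℝ) (hD : MeasurableSet D) (c : ℝ) (hc : 0 < c)
    (h : ∀ lo hi : ℝ, lo < hi → volume.real (D ∩ Set.Icc lo hi) ≤ (1 - c) * (hi - lo)) :
    volume D = 0 := by
  have hb := Besicovitch.ae_tendsto_measure_inter_div (volume : Measure ℝ) D
  have hfalse : ∀ᵐ x ∂(volume.restrict D), False := by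
    filter_upwards [hb] with x hx
    have hle : ∀ᶠ r in nhdsWithin (0:ℝ) (Set.Ioi 0),
        volume (D ∩ Metric.closedBall x r) / volume (Metric.closedBall x r) ≤ ENNReal.ofReal (1 - c) := by
      filter_upwards [self_mem_nhdsWithin] with r hr
      have hr : 0 < r := hr
      have h1 := h (x - r) (x + r) (by linarith)
      rw [Real.closedBall_eq_Icc, Real.volume_Icc]
      have hfin : volume (D ∩ Set.Icc (x - r) (x + r)) ≠ ⊤ :=
        ((measure_mono Set.inter_subset_right).trans_lt measure_Icc_lt_top).ne
      rw [← ENNReal.ofReal_toReal hfin, ← ENNReal.ofReal_div_of_pos (by linarith)]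
      apply ENNReal.ofReal_le_ofReal
      rw [div_le_iff₀ (by linarith)]
      exact h1
    have := le_of_tendsto hx hle
    rw [ENNReal.one_le_ofReal] at this
    linarith
  rw [Filter.eventually_false_iff_eq_bot, ae_eq_bot, Measure.restrict_eq_zero] at hfalse
  exact hfalse

/-- **Full measure of the limsup set** (Chow–Yang, Proposition 3.1).
The limsup over any enumeration of `𝓡 = {(t,s) ∈ ℤ₊² : c₁ s ≤ t ≤ c₂ s}` is the set
of points lying in `B_ε(t,s)` for infinitely many `(t,s) ∈ 𝓡`. -/
theorem limsup_full_measure (a b : ℝ) (hab : IsDiophantine a b)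
    (A B : ℝ) (hAB : A ≤ B) (ε : ℝ) (hε : 0 < ε) :
    ∃ c₁ c₂ : ℝ, 0 < c₁ ∧ c₁ < c₂ ∧ c₂ < 1 ∧
      volume {x ∈ Set.Icc A B |
        {p : ℕ × ℕ | 0 < p.1 ∧ 0 < p.2 ∧
          c₁ * (p.2 : ℝ) ≤ (p.1 : ℝ) ∧ (p.1 : ℝ) ≤ c₂ * (p.2 : ℝ) ∧
          memB a b ε p.1 p.2 x}.Infinite}
      = volume (Set.Icc A B) := by
  obtain ⟨C, c, hC, hc, hblk⟩ := block_final a b hab ε hε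
  have hC' : (250:ℝ) ≤ C := by exact_mod_cast hC
  refine ⟨1 / ((C:ℝ) + 3), 2 / ((C:ℝ) - 2), by positivity, ?_, ?_, ?_⟩
  · rw [div_lt_div_iff₀ (by linarith) (by linarith)]; linarith
  · rw [div_lt_one (by linarith)]; linarith
  set G := ⋂ n, Gd a b ε C n with hG
  have hGm : MeasurableSet G := MeasurableSet.iInter fun n => Gd_meas a b ε C n
  have hGJ : ∀ lo hi : ℝ, lo < hi → c * (hi - lo) ≤ volume.real (G ∩ Set.Icc lo hi) := by
    intro lo hi hlh
    have hlim : Filter.Tendsto (fun n => volume (Gd a b ε C n ∩ Set.Icc lo hi)) Filter.atTop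
        (nhds (volume (⋂ n, Gd a b ε C n ∩ Set.Icc lo hi))) := by
      apply tendsto_measure_iInter_atTop
      · exact fun n => ((Gd_meas a b ε C n).inter measurableSet_Icc).nullMeasurableSet
      · exact fun m n hmn => Set.inter_subset_inter_left _ (Gd_anti a b ε C hmn)
      · exact ⟨0, ((measure_mono Set.inter_subset_right).trans_lt measure_Icc_lt_top).ne⟩
    rw [← Set.iInter_inter] at hlim
    have hfin : volume (G ∩ Set.Icc lo hi) ≠ ⊤ :=
      ((measure_mono Set.inter_subset_right).trans_lt measure_Icc_lt_top).ne
    have hlim2 := (ENNReal.tendsto_toReal hfin).comp hlim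
    exact ge_of_tendsto hlim2 (hblk lo hi hlh)
  have hD : volume Gᶜ = 0 := by
    refine null_of_density Gᶜ hGm.compl c hc ?_
    intro lo hi hlh
    have h1 := hGJ lo hi hlh
    have h2 := measureReal_inter_add_sdiff (μ := volume) (s := Set.Icc lo hi) hGm
      (measure_Icc_lt_top.ne)
    have h3 : volume.real (Set.Icc lo hi) = hi - lo := by
      rw [Measure.real, Real.volume_Icc, ENNReal.toReal_ofReal (by linarith)]
    rw [Set.inter_comm, h3] at h2
    have h4 : Set.Icc lo hi \ G = Gᶜ ∩ Set.Icc lo hi := by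
      rw [Set.sdiff_eq, Set.inter_comm]
    rw [h4] at h2
    linarith
  refine le_antisymm (measure_mono fun x hx => hx.1) ?_
  set S := {x ∈ Set.Icc A B |
        {p : ℕ × ℕ | 0 < p.1 ∧ 0 < p.2 ∧
          1 / ((C:ℝ) + 3) * (p.2 : ℝ) ≤ (p.1 : ℝ) ∧ (p.1 : ℝ) ≤ 2 / ((C:ℝ) - 2) * (p.2 : ℝ) ∧
          memB a b ε p.1 p.2 x}.Infinite} with hS
  have hsub : Set.Icc A B ⊆ S ∪ Gᶜ := by
    intro x hx
    by_cases hxG : x ∈ G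
    · left
      refine ⟨hx, ?_⟩
      intro hfin
      have hb : BddAbove ((fun q : ℕ × ℕ => q.1 + q.2) '' _) := (hfin.image _).bddAbove
      obtain ⟨M, hM⟩ := hb
      obtain ⟨q, hq1, hq⟩ := Set.mem_iInter.mp hxG (M + 1)
      have := hM (Set.mem_image_of_mem _ (show q ∈ _ from hq))
      omega
    · right; exact hxG
  calc volume (Set.Icc A B) ≤ volume (S ∪ Gᶜ) := measure_mono hsub
    _ ≤ volume S + volume Gᶜ := measure_union_le _ _
    _ = volume S := by rw [hD, add_zero]

end
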